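/- arXiv:1207.1831 — 2 statements merged into one kernel-verified Lean document; each statement's English description precedes it below -/
import Mathlib

section
/- For every d ≥ 1 and every ε > 0 there exists a constant C = C(d, ε) > 0 such that for every finite metric space (P, dist) with n ≥ 2 points and doubling dimension at most d, and every real ρ ≥ 2, there exists a (1+ε)-spanner H for P with at most C·n edges, degree Δ(H) ≤ C·ρ, and hop-diameter at most C·(log_ρ n + α(ρ)). -/
open scoped BigOperators

namespace Stmt5

variable {P : Type} [MetricSpace P]

/-- The weight of an edge (an unordered pair of points) is the distance between its
endpoints. -/
noncomputable def edgeWeight (e : Sym2 P) : ℝ :=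
  Sym2.lift ⟨fun p q => dist p q, fun p q => dist_comm p q⟩ e

/-- The total weight `ω(H)` of a graph, given as a finite set of edges. -/
noncomputable def totalWeight (H : Finset (Sym2 P)) : ℝ :=
  ∑ e ∈ H, edgeWeight e

/-- `H` is a graph on `P`: a finite set of unordered pairs of *distinct* points. -/
def IsGraphOn (H : Finset (Sym2 P)) : Prop :=
  ∀ e ∈ H, ¬ e.IsDiag

open Classical in
/-- The degree of the point `p` in the graph `H`: the number of edges incident on `p`. -/
noncomputable def degree (H : Finset (Sym2 P)) (p : P) : ℕ :=
  (H.filter (fun e => p ∈ e)).card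

/-- A `t`-spanner path with `k` edges between `p` and `q` in the graph `H`. -/
def IsSpannerPath (H : Finset (Sym2 P)) (t : ℝ) (p q : P) (k : ℕ) : Prop :=
  ∃ x : Fin (k + 1) → P, x 0 = p ∧ x (Fin.last k) = q ∧
    (∀ i : Fin k, s(x i.castSucc, x i.succ) ∈ H) ∧
    ∑ i : Fin k, dist (x i.castSucc) (x i.succ) ≤ t * dist p q

/-- `H` is a `t`-spanner: every pair of points admits a `t`-spanner path. -/
def IsSpanner (H : Finset (Sym2 P)) (t : ℝ) : Prop :=
  ∀ p q : P, ∃ k : ℕ, IsSpannerPath H t p q k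

/-- The graph `T` connects all the points of `P`. -/
def IsConnectedOn (T : Finset (Sym2 P)) : Prop :=
  ∀ p q : P, ∃ (k : ℕ) (x : Fin (k + 1) → P), x 0 = p ∧ x (Fin.last k) = q ∧
    ∀ i : Fin k, s(x i.castSucc, x i.succ) ∈ T

/-- `ω(MST(P))`: the minimum weight of a connected graph on `P` with `|P| - 1` edges. -/
noncomputable def mstWeight (P : Type) [MetricSpace P] [Fintype P] : ℝ :=
  sInf {w : ℝ | ∃ T : Finset (Sym2 P), IsGraphOn T ∧ IsConnectedOn T ∧
    T.card = Fintype.card P - 1 ∧ totalWeight T = w}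

/-- The inverse Ackermann function: the least `k ≥ 1` with `A(k,k) ≥ x`. -/
noncomputable def invAck (x : ℝ) : ℕ :=
  sInf {k : ℕ | 1 ≤ k ∧ x ≤ ack k k}

/-- A metric space has doubling dimension at most `d` if every ball can be covered
by at most `2^d` balls of half its radius. -/
def DoublingDimLE (P : Type) [MetricSpace P] (d : ℕ) : Prop :=
  ∀ (x : P) (r : ℝ), ∃ S : Finset P, S.card ≤ 2 ^ d ∧
    Metric.ball x r ⊆ ⋃ y ∈ S, Metric.ball y (r / 2)

section Forest

open Classical

variable {X : Type*}

/-- `Hop F h a b`: one can go from `a` to `b` along at most `h` of the pairs in `F`. -/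
inductive Hop (F : Finset (X × X)) : ℕ → X → X → Prop
  | refl (h : ℕ) (a : X) : Hop F h a a
  | step {h : ℕ} {a c b : X} : (a, c) ∈ F → Hop F h c b → Hop F (h + 1) a b

theorem Hop.mono {F G : Finset (X × X)} (hFG : F ⊆ G) {h k : ℕ} {a b : X} (H : Hop F h a b)
    (hk : h ≤ k) : Hop G k a b := by
  induction H generalizing k with
  | refl h a => exact Hop.refl _ _
  | step hm _ ih =>
    obtain ⟨k, rfl⟩ : ∃ j, k = j + 1 := ⟨k - 1, by omega⟩
    exact Hop.step (hFG hm) (ih (by omega))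

theorem Hop.trans {F : Finset (X × X)} {h k : ℕ} {a b c : X} (H : Hop F h a b)
    (K : Hop F k b c) : Hop F (h + k) a c := by
  induction H with
  | refl h a => exact K.mono (Finset.Subset.refl _) (by omega)
  | @step h a d b hm _ ih =>
    have := Hop.step hm (ih K)
    rwa [show h + 1 + k = h + k + 1 by omega]

theorem Hop.single {F : Finset (X × X)} {a b : X} (h : (a, b) ∈ F) : Hop F 1 a b :=
  Hop.step h (Hop.refl 0 b)

/-- The number of pairs of `F` containing `a`. -/
noncomputable def pairDegree (F : Finset (X × X)) (a : X) : ℕ :=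
  (F.filter fun e => e.1 = a ∨ e.2 = a).card

theorem pairDegree_union_le (F G : Finset (X × X)) (a : X) :
    pairDegree (F ∪ G) a ≤ pairDegree F a + pairDegree G a := by
  unfold pairDegree
  rw [Finset.filter_union]
  exact Finset.card_union_le _ _

theorem pairDegree_mono {F G : Finset (X × X)} {a : X}
    (h : ∀ e ∈ F, e.1 = a ∨ e.2 = a → e ∈ G) : pairDegree F a ≤ pairDegree G a := by
  refine Finset.card_le_card fun e he => ?_
  obtain ⟨he, hea⟩ := Finset.mem_filter.1 he
  exact Finset.mem_filter.2 ⟨h e he hea, hea⟩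

theorem card_le_of_pairDegree_le {A : Finset X} {F : Finset (X × X)} (hF : F ⊆ A ×ˢ A) {D : ℕ}
    (hD : ∀ a, pairDegree F a ≤ D) : F.card ≤ D * A.card := by
  have : F ⊆ A.biUnion fun a => F.filter fun e => e.1 = a ∨ e.2 = a := by
    intro e he
    exact Finset.mem_biUnion.2 ⟨e.1, (Finset.mem_product.1 (hF he)).1,
      Finset.mem_filter.2 ⟨he, Or.inl rfl⟩⟩
  refine (Finset.card_le_card this).trans (Finset.card_biUnion_le.trans ?_)
  rw [mul_comm, ← smul_eq_mul]
  exact Finset.sum_le_card_nsmul _ _ _ fun a _ => hD a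

variable [PartialOrder X]

/-- A partial order is a forest if the elements above any given element form a chain. -/
def IsForest (X : Type*) [PartialOrder X] : Prop :=
  ∀ a b c : X, a ≤ b → a ≤ c → b ≤ c ∨ c ≤ b

/-- The comparable pairs of `A`. -/
noncomputable def ltPairs (A : Finset X) : Finset (X × X) :=
  (A ×ˢ A).filter fun e => e.1 < e.2

theorem mem_ltPairs {A : Finset X} {e : X × X} :
    e ∈ ltPairs A ↔ e.1 ∈ A ∧ e.2 ∈ A ∧ e.1 < e.2 := by
  simp [ltPairs, and_assoc]

theorem ltPairs_mono {A B : Finset X} (h : A ⊆ B) : ltPairs A ⊆ ltPairs B := by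
  intro e he
  rw [mem_ltPairs] at he ⊢
  exact ⟨h he.1, h he.2.1, he.2.2⟩

theorem ltPairs_subset_product (A : Finset X) : ltPairs A ⊆ A ×ˢ A :=
  Finset.filter_subset _ _

theorem hop_ltPairs {A : Finset X} {a b : X} (ha : a ∈ A) (hb : b ∈ A) (hab : a ≤ b) :
    Hop (ltPairs A) 1 a b := by
  rcases hab.eq_or_lt with rfl | h
  · exact Hop.refl _ _
  · exact Hop.single (mem_ltPairs.2 ⟨ha, hb, h⟩)

/-- The `w`-weight of the part of `A` below `v`. -/
noncomputable def weightBelow (A : Finset X) (w : X → ℕ) (v : X) : ℕ :=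
  ∑ x ∈ A.filter (· ≤ v), w x

theorem weightBelow_mono (A : Finset X) (w : X → ℕ) {u v : X} (h : u ≤ v) :
    weightBelow A w u ≤ weightBelow A w v := by
  apply Finset.sum_le_sum_of_subset
  intro x hx
  rw [Finset.mem_filter] at hx ⊢
  exact ⟨hx.1, hx.2.trans h⟩

theorem sum_weightBelow_le (hX : IsForest X) (A : Finset X) (w : X → ℕ) (M B : Finset X)
    (hM : ∀ s ∈ M, ∀ t ∈ M, s ≤ t → s = t) (hB : ∀ s ∈ M, ∀ x ∈ A, x ≤ s → x ∈ B) :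
    ∑ s ∈ M, weightBelow A w s ≤ ∑ x ∈ B, w x := by
  unfold weightBelow
  rw [← Finset.sum_biUnion]
  · apply Finset.sum_le_sum_of_subset
    intro x hx
    simp only [Finset.mem_biUnion, Finset.mem_filter] at hx
    obtain ⟨s, hs, hx⟩ := hx
    exact hB s hs x hx.1 hx.2
  · intro s hs t ht hst
    rw [Function.onFun, Finset.disjoint_left]
    intro x hx hx'
    rw [Finset.mem_filter] at hx hx'
    rcases hX x s t hx.2 hx'.2 with h | h
    · exact hst (hM s hs t ht h)
    · exact hst (hM t ht s hs h).symm

theorem sum_div_le {ι : Type*} (M : Finset ι) (f : ι → ℕ) (l : ℕ) :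
    ∑ s ∈ M, f s / l ≤ (∑ s ∈ M, f s) / l := by
  rcases Nat.eq_zero_or_pos l with rfl | hl
  · simp
  · rw [Nat.le_div_iff_mul_le hl, Finset.sum_mul]
    exact Finset.sum_le_sum fun s _ => Nat.div_mul_le_self _ _

/-- The elements of `A` where the weight below, counted in multiples of `l`, jumps. -/
noncomputable def jumps (A : Finset X) (w : X → ℕ) (l : ℕ) : Finset X :=
  A.filter fun v => 1 ≤ weightBelow A w v / l ∧
    ∀ x ∈ A, x < v → weightBelow A w x / l < weightBelow A w v / l

/-- The component of `A \ S` consisting of the elements below `r` and not separated from `r`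
by an element of `S`. -/
noncomputable def comp (A S : Finset X) (r : X) : Finset X :=
  A.filter fun v => v ≤ r ∧ ∀ s ∈ S, v ≤ s → ¬ s ≤ r

theorem mem_comp {A S : Finset X} {r v : X} :
    v ∈ comp A S r ↔ v ∈ A ∧ v ≤ r ∧ ∀ s ∈ S, v ≤ s → ¬ s ≤ r := by
  simp [comp]

/-- The maximal elements of the components of `A \ S`. -/
noncomputable def roots (A S : Finset X) : Finset X :=
  A.filter fun r => r ∉ S ∧ ∀ u ∈ A, r < u → ∃ s ∈ S, r ≤ s ∧ s ≤ u

theorem card_jumps_below_le (hX : IsForest X) (A : Finset X) (w : X → ℕ) (l : ℕ) (v : X)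
    (hv : v ∈ A) :
    (jumps A w l).filter (· ≤ v) = ∅ ∨
      ((jumps A w l).filter (· ≤ v)).card + 1 ≤ 2 * (weightBelow A w v / l) := by
  induction hn : (A.filter (· ≤ v)).card using Nat.strong_induction_on generalizing v with
  | _ n ih =>
  subst hn
  set S := jumps A w l with hS
  set M := (S.filter (· < v)).filter (fun t => ∀ s ∈ S, s < v → t ≤ s → t = s) with hMdef
  have hMS : ∀ t ∈ M, t ∈ S ∧ t < v := by
    intro t ht
    simp only [hMdef, Finset.mem_filter] at ht
    exact ht.1
  have hSA : S ⊆ A := Finset.filter_subset _ _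
  have hanti : ∀ s ∈ M, ∀ t ∈ M, s ≤ t → s = t := by
    intro s hs t ht hst
    simp only [hMdef, Finset.mem_filter] at hs
    exact hs.2 t (hMS t ht).1 (hMS t ht).2 hst
  have hg : ∑ t ∈ M, weightBelow A w t / l ≤ weightBelow A w v / l := by
    refine (sum_div_le _ _ _).trans (Nat.div_le_div_right ?_)
    refine sum_weightBelow_le hX A w M _ hanti ?_
    intro s hs x hx hxs
    rw [Finset.mem_filter]
    exact ⟨hx, hxs.trans (hMS s hs).2.le⟩
  have hcard : ∀ t ∈ M, (S.filter (· ≤ t)).card + 1 ≤ 2 * (weightBelow A w t / l) := by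
    intro t ht
    obtain ⟨htS, htv⟩ := hMS t ht
    have hlt : (A.filter (· ≤ t)).card < (A.filter (· ≤ v)).card := by
      apply Finset.card_lt_card
      rw [Finset.ssubset_iff_of_subset]
      · refine ⟨v, Finset.mem_filter.2 ⟨hv, le_rfl⟩, ?_⟩
        rw [Finset.mem_filter]
        exact fun h => absurd (h.2.trans_lt htv) (lt_irrefl _)
      · intro x hx
        rw [Finset.mem_filter] at hx ⊢
        exact ⟨hx.1, hx.2.trans htv.le⟩
    rcases ih _ hlt t (hSA htS) rfl with h | h
    · exfalso
      have : t ∈ S.filter (· ≤ t) := Finset.mem_filter.2 ⟨htS, le_rfl⟩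
      rw [h] at this
      simp at this
    · exact h
  have hcover : S.filter (· < v) ⊆ M.biUnion fun t => S.filter (· ≤ t) := by
    intro x hx
    obtain ⟨t, hxt, ht⟩ := (S.filter (· < v)).exists_le_maximal hx
    rw [Finset.mem_biUnion]
    refine ⟨t, ?_, Finset.mem_filter.2 ⟨(Finset.mem_filter.1 hx).1, hxt⟩⟩
    simp only [hMdef, Finset.mem_filter]
    refine ⟨Finset.mem_filter.1 ht.1, fun s hs hsv hts => ?_⟩
    exact le_antisymm hts (ht.2 (Finset.mem_filter.2 ⟨hs, hsv⟩) hts)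
  have hlt : (S.filter (· < v)).card + M.card ≤ 2 * ∑ t ∈ M, weightBelow A w t / l := by
    have h1 := (Finset.card_le_card hcover).trans Finset.card_biUnion_le
    have h2 := Finset.sum_le_sum hcard
    rw [Finset.sum_add_distrib, ← Finset.mul_sum] at h2
    simp only [Finset.sum_const, smul_eq_mul, mul_one] at h2
    omega
  by_cases hvS : v ∈ S
  · right
    have hv1 : 1 ≤ weightBelow A w v / l := (Finset.mem_filter.1 hvS).2.1
    have hv2 := (Finset.mem_filter.1 hvS).2.2
    have hle : (S.filter (· ≤ v)).card ≤ (S.filter (· < v)).card + 1 := by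
      have : S.filter (· ≤ v) ⊆ insert v (S.filter (· < v)) := by
        intro x hx
        rw [Finset.mem_filter] at hx
        rw [Finset.mem_insert, Finset.mem_filter]
        rcases hx.2.eq_or_lt with h | h
        · exact Or.inl h
        · exact Or.inr ⟨hx.1, h⟩
      exact (Finset.card_le_card this).trans (Finset.card_insert_le _ _)
    rcases Nat.lt_or_ge 1 M.card with hM | hM
    · omega
    · rcases Nat.eq_zero_or_pos M.card with h0 | h0
      · rw [Finset.card_eq_zero] at h0
        rw [h0] at hlt
        simp only [Finset.card_empty, Finset.sum_empty] at hlt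
        omega
      · obtain ⟨t, ht⟩ := Finset.card_eq_one.1 (le_antisymm hM h0)
        have htM : t ∈ M := by rw [ht]; simp
        have := hv2 t (hSA (hMS t htM).1) (hMS t htM).2
        rw [ht] at hlt
        simp only [Finset.card_singleton, Finset.sum_singleton] at hlt
        omega
  · have heq : S.filter (· ≤ v) = S.filter (· < v) := by
      ext x
      simp only [Finset.mem_filter]
      refine and_congr_right fun hx => ⟨fun h => lt_of_le_of_ne h ?_, le_of_lt⟩
      rintro rfl
      exact hvS hx
    rw [heq]
    rcases Nat.eq_zero_or_pos M.card with h0 | h0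
    · left
      rw [Finset.card_eq_zero] at h0
      rw [h0] at hcover
      simpa using hcover
    · right
      omega

theorem card_jumps_le (hX : IsForest X) (A : Finset X) (w : X → ℕ) (l : ℕ) :
    l * (jumps A w l).card ≤ 2 * ∑ x ∈ A, w x := by
  set S := jumps A w l with hS
  have hSA : S ⊆ A := Finset.filter_subset _ _
  set M := S.filter (fun t => ∀ s ∈ S, t ≤ s → t = s) with hM
  have hcover : S ⊆ M.biUnion fun t => S.filter (· ≤ t) := by
    intro x hx
    obtain ⟨t, hxt, ht⟩ := S.exists_le_maximal hx
    rw [Finset.mem_biUnion]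
    refine ⟨t, ?_, Finset.mem_filter.2 ⟨hx, hxt⟩⟩
    exact Finset.mem_filter.2 ⟨ht.1, fun s hs hts => le_antisymm hts (ht.2 hs hts)⟩
  have h1 := (Finset.card_le_card hcover).trans Finset.card_biUnion_le
  have h2 : ∑ t ∈ M, (S.filter (· ≤ t)).card ≤ ∑ t ∈ M, 2 * (weightBelow A w t / l) := by
    refine Finset.sum_le_sum fun t ht => ?_
    rcases card_jumps_below_le hX A w l t (hSA (Finset.mem_filter.1 ht).1) with h | h
    · rw [h]; simp
    · exact (Nat.le_succ _).trans h
  rw [← Finset.mul_sum] at h2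
  have h3 : ∑ t ∈ M, weightBelow A w t / l ≤ (∑ x ∈ A, w x) / l := by
    refine (sum_div_le _ _ _).trans (Nat.div_le_div_right ?_)
    refine sum_weightBelow_le hX A w M A ?_ fun _ _ x hx _ => hx
    intro s hs t ht hst
    exact (Finset.mem_filter.1 hs).2 t (Finset.mem_filter.1 ht).1 hst
  calc l * S.card ≤ l * (2 * ((∑ x ∈ A, w x) / l)) := Nat.mul_le_mul_left _ (by omega)
    _ = 2 * (l * ((∑ x ∈ A, w x) / l)) := by ring
    _ ≤ 2 * ∑ x ∈ A, w x := Nat.mul_le_mul_left _ (Nat.mul_div_le _ _)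

/-- `S` cuts `A` into components of weight less than `l`, each of which has at most one element
of `S` directly below it. -/
structure IsSeparator (A S : Finset X) (w : X → ℕ) (l : ℕ) : Prop where
  subset : S ⊆ A
  mul_card_le : l * S.card ≤ 2 * ∑ x ∈ A, w x
  weight_lt : ∀ r ∈ A, r ∉ S → ∑ x ∈ comp A S r, w x < l
  exists_greatest : ∀ u ∈ A, (∃ s ∈ S, s ≤ u) → ∃ t ∈ S, t ≤ u ∧ ∀ s ∈ S, s ≤ u → s ≤ t
  mem_of_le : ∀ v ∈ A, l ≤ w v → v ∈ S

theorem exists_jump_of_notMem (A : Finset X) (w : X → ℕ) (l : ℕ) {u : X} (hu : u ∈ A)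
    (h1 : 1 ≤ weightBelow A w u / l) :
    ∃ t ∈ jumps A w l, t ≤ u ∧ weightBelow A w t / l = weightBelow A w u / l := by
  obtain ⟨t, ht⟩ := (A.filter fun x => x ≤ u ∧
    weightBelow A w x / l = weightBelow A w u / l).exists_minimal
    ⟨u, Finset.mem_filter.2 ⟨hu, le_rfl, rfl⟩⟩
  obtain ⟨htA, htu, hte⟩ := Finset.mem_filter.1 ht.1
  refine ⟨t, Finset.mem_filter.2 ⟨htA, hte ▸ h1, fun x hx hxt => ?_⟩, htu, hte⟩
  refine lt_of_le_of_ne (Nat.div_le_div_right (weightBelow_mono A w hxt.le)) fun he => ?_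
  have := ht.2 (Finset.mem_filter.2 ⟨hx, hxt.le.trans htu, he.trans hte⟩) hxt.le
  exact absurd (hxt.trans_le this) (lt_irrefl _)

theorem isSeparator_jumps (hX : IsForest X) (A : Finset X) (w : X → ℕ) {l : ℕ} (hl : 0 < l) :
    IsSeparator A (jumps A w l) w l := by
  have hSA : jumps A w l ⊆ A := Finset.filter_subset _ _
  refine ⟨hSA, card_jumps_le hX A w l, ?_, ?_, ?_⟩
  · intro r hr _
    rcases Nat.eq_zero_or_pos (weightBelow A w r / l) with h0 | h1
    · have : weightBelow A w r < l := by
        rcases Nat.div_eq_zero_iff.1 h0 with h | h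
        · omega
        · exact h
      refine lt_of_le_of_lt (Finset.sum_le_sum_of_subset ?_) this
      intro x hx
      rw [mem_comp] at hx
      exact Finset.mem_filter.2 ⟨hx.1, hx.2.1⟩
    · obtain ⟨t, htS, htr, hte⟩ := exists_jump_of_notMem A w l hr h1
      have hdisj : Disjoint (comp A (jumps A w l) r) (A.filter (· ≤ t)) := by
        rw [Finset.disjoint_left]
        intro x hx hxt
        exact (mem_comp.1 hx).2.2 t htS (Finset.mem_filter.1 hxt).2 htr
      have hsum : ∑ x ∈ comp A (jumps A w l) r, w x + weightBelow A w t ≤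
          weightBelow A w r := by
        unfold weightBelow
        rw [← Finset.sum_union hdisj]
        apply Finset.sum_le_sum_of_subset
        intro x hx
        rcases Finset.mem_union.1 hx with h | h
        · exact Finset.mem_filter.2 ⟨(mem_comp.1 h).1, (mem_comp.1 h).2.1⟩
        · exact Finset.mem_filter.2
            ⟨(Finset.mem_filter.1 h).1, (Finset.mem_filter.1 h).2.trans htr⟩
      have e1 := Nat.div_add_mod (weightBelow A w r) l
      have e2 := Nat.div_add_mod (weightBelow A w t) l
      have e3 := Nat.mod_lt (weightBelow A w r) hl
      rw [hte] at e2
      omega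
  · rintro u hu ⟨s₀, hs₀, hs₀u⟩
    have h1 : 1 ≤ weightBelow A w u / l :=
      (Finset.mem_filter.1 hs₀).2.1.trans (Nat.div_le_div_right (weightBelow_mono A w hs₀u))
    obtain ⟨t, htS, htu, hte⟩ := exists_jump_of_notMem A w l hu h1
    refine ⟨t, htS, htu, fun s hs hsu => ?_⟩
    by_contra hst
    obtain ⟨hsA, hs1, hs2⟩ := Finset.mem_filter.1 hs
    by_cases hts : t ≤ s
    · have h2 := hs2 t (hSA htS) (lt_of_le_of_ne hts fun h => hst h.ge)
      have h3 : weightBelow A w s / l ≤ weightBelow A w u / l :=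
        Nat.div_le_div_right (weightBelow_mono A w hsu)
      omega
    · have hne : s ≠ t := fun h => hst h.le
      have h2 : ∑ x ∈ {s, t}, weightBelow A w x ≤ weightBelow A w u := by
        refine sum_weightBelow_le hX A w {s, t} _ ?_ ?_
        · intro a ha b hb hab
          simp only [Finset.mem_insert, Finset.mem_singleton] at ha hb
          rcases ha with rfl | rfl <;> rcases hb with rfl | rfl <;> first | rfl | contradiction
        · intro a ha x hx hxa
          simp only [Finset.mem_insert, Finset.mem_singleton] at ha
          refine Finset.mem_filter.2 ⟨hx, hxa.trans ?_⟩
          rcases ha with rfl | rfl <;> assumption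
      have h3 := (sum_div_le {s, t} (weightBelow A w) l).trans (Nat.div_le_div_right h2)
      rw [Finset.sum_pair hne] at h3
      omega
  · intro v hv hw
    have hself : ∀ x ∈ A, x < v → weightBelow A w x + l ≤ weightBelow A w v := by
      intro x _ hxv
      have hnot : v ∉ A.filter (· ≤ x) := fun h =>
        absurd (hxv.trans_le (Finset.mem_filter.1 h).2) (lt_irrefl _)
      have : ∑ y ∈ insert v (A.filter (· ≤ x)), w y ≤ weightBelow A w v := by
        apply Finset.sum_le_sum_of_subset
        intro y hy
        rcases Finset.mem_insert.1 hy with rfl | h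
        · exact Finset.mem_filter.2 ⟨hv, le_rfl⟩
        · exact Finset.mem_filter.2
            ⟨(Finset.mem_filter.1 h).1, (Finset.mem_filter.1 h).2.trans hxv.le⟩
      rw [Finset.sum_insert hnot] at this
      unfold weightBelow at this ⊢
      omega
    refine Finset.mem_filter.2 ⟨hv, ?_, fun x hx hxv => ?_⟩
    · rw [Nat.le_div_iff_mul_le hl, one_mul]
      exact hw.trans (Finset.single_le_sum (f := w) (fun _ _ => Nat.zero_le _)
        (Finset.mem_filter.2 ⟨hv, le_rfl⟩))
    · have := Nat.div_le_div_right (c := l) (hself x hx hxv)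
      rw [Nat.add_div_right _ hl] at this
      omega

theorem notMem_of_mem_comp {A S : Finset X} {r v : X} (h : v ∈ comp A S r) : v ∉ S := fun hv =>
  (mem_comp.1 h).2.2 v hv le_rfl (mem_comp.1 h).2.1

theorem comp_subset (A S : Finset X) (r : X) : comp A S r ⊆ A := Finset.filter_subset _ _

theorem mem_roots {A S : Finset X} {r : X} :
    r ∈ roots A S ↔ r ∈ A ∧ r ∉ S ∧ ∀ u ∈ A, r < u → ∃ s ∈ S, r ≤ s ∧ s ≤ u := by
  simp [roots]

theorem self_mem_comp {A S : Finset X} {r : X} (hr : r ∈ roots A S) : r ∈ comp A S r := by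
  obtain ⟨hA, hS, -⟩ := mem_roots.1 hr
  refine mem_comp.2 ⟨hA, le_rfl, fun s hs h h' => hS ?_⟩
  rwa [le_antisymm h h']

theorem exists_root (hX : IsForest X) {A S : Finset X} {v : X} (hv : v ∈ A) (hvS : v ∉ S) :
    ∃ r ∈ roots A S, v ∈ comp A S r := by
  obtain ⟨r, hr⟩ := (A.filter fun u => v ≤ u ∧ ∀ s ∈ S, v ≤ s → ¬ s ≤ u).exists_maximal
    ⟨v, Finset.mem_filter.2 ⟨hv, le_rfl, fun s hs h h' => hvS (by rwa [le_antisymm h h'])⟩⟩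
  obtain ⟨hrA, hvr, hrS⟩ := Finset.mem_filter.1 hr.1
  refine ⟨r, mem_roots.2 ⟨hrA, fun h => hrS r h hvr le_rfl, fun u hu hru => ?_⟩,
    mem_comp.2 ⟨hv, hvr, hrS⟩⟩
  by_contra hcon
  push Not at hcon
  have hmem : u ∈ A.filter fun u => v ≤ u ∧ ∀ s ∈ S, v ≤ s → ¬ s ≤ u := by
    refine Finset.mem_filter.2 ⟨hu, hvr.trans hru.le, fun s hs hvs hsu => ?_⟩
    rcases hX v s r hvs hvr with h | h
    · exact hrS s hs hvs h
    · exact hcon s hs h hsu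
  exact absurd (hru.trans_le (hr.2 hmem hru.le)) (lt_irrefl _)

theorem eq_of_mem_comp (hX : IsForest X) {A S : Finset X} {r r' v : X} (hr : r ∈ roots A S)
    (hr' : r' ∈ roots A S) (h : v ∈ comp A S r) (h' : v ∈ comp A S r') : r = r' := by
  have key : ∀ {r r' : X}, r ∈ roots A S → r' ∈ roots A S → v ∈ comp A S r →
      v ∈ comp A S r' → r ≤ r' → r = r' := by
    intro r r' hr hr' h h' hle
    by_contra hne
    obtain ⟨s, hs, hrs, hsr⟩ := (mem_roots.1 hr).2.2 r' (mem_roots.1 hr').1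
      (lt_of_le_of_ne hle hne)
    exact (mem_comp.1 h').2.2 s hs ((mem_comp.1 h).2.1.trans hrs) hsr
  rcases hX v r r' (mem_comp.1 h).2.1 (mem_comp.1 h').2.1 with hle | hle
  · exact key hr hr' h h' hle
  · exact (key hr' hr h' h hle).symm

theorem pairwiseDisjoint_comp (hX : IsForest X) (A S : Finset X) :
    (roots A S : Set X).PairwiseDisjoint (comp A S) := by
  intro r hr r' hr' hne
  rw [Function.onFun, Finset.disjoint_left]
  intro v hv hv'
  exact hne (eq_of_mem_comp hX hr hr' hv hv')

theorem sum_card_comp_le (hX : IsForest X) (A S : Finset X) :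
    ∑ r ∈ roots A S, (comp A S r).card ≤ A.card := by
  rw [← Finset.card_biUnion (pairwiseDisjoint_comp hX A S)]
  exact Finset.card_le_card (Finset.biUnion_subset.2 fun r _ => comp_subset A S r)

theorem mem_comp_of_le (hX : IsForest X) {A S : Finset X} {r u v : X} (hu : u ∈ comp A S r)
    (hv : v ∈ A) (hvu : v ≤ u) (hS : ∀ s ∈ S, v ≤ s → ¬ s ≤ u) : v ∈ comp A S r := by
  obtain ⟨-, hur, huS⟩ := mem_comp.1 hu
  refine mem_comp.2 ⟨hv, hvu.trans hur, fun s hs hvs hsr => ?_⟩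
  rcases hX v s u hvs hvu with h | h
  · exact hS s hs hvs h
  · exact huS s hs h hsr

theorem mem_comp_of_le_of_le {A S : Finset X} {r a b x : X} (ha : a ∈ comp A S r)
    (hb : b ∈ comp A S r) (hx : x ∈ A) (hax : a ≤ x) (hxb : x ≤ b) : x ∈ comp A S r :=
  mem_comp.2 ⟨hx, hxb.trans (mem_comp.1 hb).2.1, fun s hs hxs =>
    (mem_comp.1 ha).2.2 s hs (hax.trans hxs)⟩

theorem exists_least_above (hX : IsForest X) (S : Finset X) {v : X} (h : ∃ s ∈ S, v ≤ s) :
    ∃ t ∈ S, v ≤ t ∧ ∀ s ∈ S, v ≤ s → t ≤ s := by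
  obtain ⟨s, hs, hvs⟩ := h
  obtain ⟨t, ht⟩ := (S.filter (v ≤ ·)).exists_minimal ⟨s, Finset.mem_filter.2 ⟨hs, hvs⟩⟩
  obtain ⟨htS, hvt⟩ := Finset.mem_filter.1 ht.1
  refine ⟨t, htS, hvt, fun s hs hvs => ?_⟩
  rcases hX v t s hvt hvs with h | h
  · exact h
  · exact ht.2 (Finset.mem_filter.2 ⟨hs, hvs⟩) h

theorem IsSeparator.same_comp_or (hX : IsForest X) {A S : Finset X} {w : X → ℕ} {l : ℕ}
    (hS : IsSeparator A S w l) {v u : X} (hv : v ∈ A) (hu : u ∈ A) (hvu : v ≤ u) :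
    (∃ r ∈ roots A S, v ∈ comp A S r ∧ u ∈ comp A S r) ∨
      ∃ s ∈ S, ∃ t ∈ S, v ≤ s ∧ s ≤ t ∧ t ≤ u ∧ (∀ x ∈ S, v ≤ x → s ≤ x) ∧
        ∀ x ∈ S, x ≤ u → x ≤ t := by
  by_cases h : ∃ x ∈ S, v ≤ x ∧ x ≤ u
  · obtain ⟨x, hx, hvx, hxu⟩ := h
    obtain ⟨s, hs, hvs, hsl⟩ := exists_least_above hX S ⟨x, hx, hvx⟩
    obtain ⟨t, ht, htu, htg⟩ := hS.exists_greatest u hu ⟨x, hx, hxu⟩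
    exact Or.inr ⟨s, hs, t, ht, hvs, (hsl x hx hvx).trans (htg x hx hxu), htu, hsl, htg⟩
  · push Not at h
    have huS : u ∉ S := fun hm => h u hm hvu le_rfl
    obtain ⟨r, hr, hur⟩ := exists_root hX hu huS
    exact Or.inl ⟨r, hr, mem_comp_of_le hX hur hv hvu h, hur⟩

/-- The pairs consisting of an element of `A` and its parent, the least element of `A` strictly
above it. -/
noncomputable def parentPairs (A : Finset X) : Finset (X × X) :=
  (A ×ˢ A).filter fun e => e.1 < e.2 ∧ ∀ x ∈ A, e.1 < x → e.2 ≤ x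

theorem mem_parentPairs {A : Finset X} {a b : X} :
    (a, b) ∈ parentPairs A ↔ a ∈ A ∧ b ∈ A ∧ a < b ∧ ∀ x ∈ A, a < x → b ≤ x := by
  simp [parentPairs, and_assoc]

theorem parentPairs_subset_ltPairs (A : Finset X) : parentPairs A ⊆ ltPairs A := by
  rintro ⟨a, b⟩ h
  obtain ⟨ha, hb, hab, -⟩ := mem_parentPairs.1 h
  exact mem_ltPairs.2 ⟨ha, hb, hab⟩

theorem parentPairs_unique {A : Finset X} {a b c : X} (hb : (a, b) ∈ parentPairs A)
    (hc : (a, c) ∈ parentPairs A) : b = c := by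
  obtain ⟨-, hbA, hab, hbl⟩ := mem_parentPairs.1 hb
  obtain ⟨-, hcA, hac, hcl⟩ := mem_parentPairs.1 hc
  exact le_antisymm (hbl c hcA hac) (hcl b hbA hab)

theorem card_parentPairs_le (A : Finset X) : (parentPairs A).card ≤ A.card := by
  refine Finset.card_le_card_of_injOn Prod.fst ?_ ?_
  · rintro ⟨a, b⟩ h
    exact (mem_parentPairs.1 h).1
  · rintro ⟨a, b⟩ h ⟨a', b'⟩ h' (rfl : a = a')
    rw [parentPairs_unique h h']

theorem exists_parent (hX : IsForest X) {A : Finset X} {a b : X} (ha : a ∈ A) (hb : b ∈ A)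
    (hab : a < b) : ∃ c, (a, c) ∈ parentPairs A ∧ c ≤ b := by
  obtain ⟨c, hc, hac, hcl⟩ := exists_least_above hX (A.filter (a < ·))
    ⟨b, Finset.mem_filter.2 ⟨hb, hab⟩, hab.le⟩
  obtain ⟨hcA, hac'⟩ := Finset.mem_filter.1 hc
  exact ⟨c, mem_parentPairs.2 ⟨ha, hcA, hac', fun x hx hax =>
    hcl x (Finset.mem_filter.2 ⟨hx, hax⟩) hax.le⟩, hcl b (Finset.mem_filter.2 ⟨hb, hab⟩) hab.le⟩

theorem parentPairs_comp_subset (hX : IsForest X) (A S : Finset X) (r : X) :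
    parentPairs (comp A S r) ⊆ parentPairs A := by
  rintro ⟨a, c⟩ h
  obtain ⟨ha, hc, hac, hl⟩ := mem_parentPairs.1 h
  refine mem_parentPairs.2 ⟨comp_subset _ _ _ ha, comp_subset _ _ _ hc, hac, fun x hx hax => ?_⟩
  rcases hX a c x hac.le hax.le with h | h
  · exact h
  · exact hl x (mem_comp_of_le_of_le ha hc hx hax.le h) hax

theorem root_parent (hX : IsForest X) {A S : Finset X} (hSA : S ⊆ A) {r v s : X}
    (hr : r ∈ roots A S) (hv : v ∈ comp A S r) (hs : s ∈ S) (hvs : v ≤ s)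
    (hsl : ∀ x ∈ S, v ≤ x → s ≤ x) : (r, s) ∈ parentPairs A := by
  obtain ⟨hrA, hrS, hru⟩ := mem_roots.1 hr
  obtain ⟨-, hvr, hvS⟩ := mem_comp.1 hv
  have hrs : r ≤ s := (hX v r s hvr hvs).resolve_right (hvS s hs hvs)
  refine mem_parentPairs.2 ⟨hrA, hSA hs, lt_of_le_of_ne hrs fun h => hrS (h ▸ hs), ?_⟩
  intro x hx hrx
  obtain ⟨s', hs', hrs', hsx⟩ := hru x hx hrx
  exact (hsl s' hs' (hvr.trans hrs')).trans hsx

theorem exists_bottom (hX : IsForest X) {A S : Finset X} (hSA : S ⊆ A) {r u t : X}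
    (hu : u ∈ comp A S r) (ht : t ∈ S) (htu : t ≤ u) (htg : ∀ x ∈ S, x ≤ u → x ≤ t) :
    ∃ y ∈ comp A S r, (t, y) ∈ parentPairs A ∧ y ≤ u := by
  have hlt : t < u := lt_of_le_of_ne htu fun h => notMem_of_mem_comp hu (h ▸ ht)
  obtain ⟨y, hy, hyu⟩ := exists_parent hX (hSA ht) (comp_subset _ _ _ hu) hlt
  obtain ⟨-, hyA, hty, -⟩ := mem_parentPairs.1 hy
  refine ⟨y, mem_comp_of_le hX hu hyA hyu fun s hs hys hsu => ?_, hy, hyu⟩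
  exact absurd (hty.trans_le (hys.trans (htg s hs hsu))) (lt_irrefl _)

theorem IsSeparator.bottom_unique {A S : Finset X} {w : X → ℕ} {l : ℕ}
    (hS : IsSeparator A S w l) {r y y' t t' : X} (hr : r ∈ A)
    (hy : y ∈ comp A S r) (hy' : y' ∈ comp A S r) (ht : t ∈ S) (ht' : t' ∈ S)
    (hty : (t, y) ∈ parentPairs A) (hty' : (t', y') ∈ parentPairs A) : y = y' := by
  have htr : t ≤ r := (mem_parentPairs.1 hty).2.2.1.le.trans (mem_comp.1 hy).2.1
  obtain ⟨T, hT, hTr, hTg⟩ := hS.exists_greatest r hr ⟨t, ht, htr⟩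
  have key : ∀ {t y : X}, y ∈ comp A S r → t ∈ S → (t, y) ∈ parentPairs A → t = T := by
    intro t y hy ht hty
    obtain ⟨-, -, hlt, hl⟩ := mem_parentPairs.1 hty
    by_contra hne
    have htT := hTg t ht (hlt.le.trans (mem_comp.1 hy).2.1)
    exact (mem_comp.1 hy).2.2 T hT (hl T (hS.subset hT) (lt_of_le_of_ne htT hne)) hTr
  rw [key hy ht hty] at hty
  rw [key hy' ht' hty'] at hty'
  exact parentPairs_unique hty hty'

theorem hop_parentPairs (hX : IsForest X) {A : Finset X} {a b : X} (ha : a ∈ A) (hb : b ∈ A)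
    (hab : a ≤ b) :
    Hop (parentPairs A) (A.filter fun x => a ≤ x ∧ x < b).card a b := by
  induction hn : (A.filter fun x => a ≤ x ∧ x < b).card using Nat.strong_induction_on
    generalizing a with
  | _ n ih =>
  subst hn
  rcases hab.eq_or_lt with rfl | hlt
  · exact Hop.refl _ _
  · obtain ⟨c, hc, hcb⟩ := exists_parent hX ha hb hlt
    obtain ⟨-, hcA, hac, -⟩ := mem_parentPairs.1 hc
    have hcard : (A.filter fun x => c ≤ x ∧ x < b).card <
        (A.filter fun x => a ≤ x ∧ x < b).card := by
      apply Finset.card_lt_card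
      rw [Finset.ssubset_iff_of_subset]
      · refine ⟨a, Finset.mem_filter.2 ⟨ha, le_rfl, hlt⟩, fun h => ?_⟩
        exact absurd (hac.trans_le (Finset.mem_filter.1 h).2.1) (lt_irrefl _)
      · intro x hx
        rw [Finset.mem_filter] at hx ⊢
        exact ⟨hx.1, hac.le.trans hx.2.1, hx.2.2⟩
    exact (Hop.step hc (ih _ hcard hcA hcb rfl)).mono (Finset.Subset.refl _) hcard

/-- Shortcuts for a separator and for the components combine to shortcuts for the whole set. -/
theorem exists_shortcut_of_separator (hX : IsForest X) {A S : Finset X} {w : X → ℕ} {l : ℕ}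
    (hS : IsSeparator A S w l) {c h : ℕ} {F : Finset (X × X)} (hF : F ⊆ ltPairs S)
    (hFhop : ∀ a ∈ S, ∀ b ∈ S, a ≤ b → Hop F h a b)
    (hcomp : ∀ r ∈ roots A S, ∃ G : Finset (X × X), G ⊆ ltPairs (comp A S r) ∧
      G.card ≤ c * (comp A S r).card ∧
      ∀ a ∈ comp A S r, ∀ b ∈ comp A S r, a ≤ b → Hop G (h + 2) a b) :
    ∃ G : Finset (X × X), G ⊆ ltPairs A ∧ G.card ≤ F.card + (c + 2) * A.card ∧
      ∀ a ∈ A, ∀ b ∈ A, a ≤ b → Hop G (h + 2) a b := by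
  choose! G hG hGcard hGhop using hcomp
  set U := (A ×ˢ S).filter fun e => e.1 < e.2 ∧ ∀ s ∈ S, e.1 ≤ s → e.2 ≤ s with hU
  set D := (S ×ˢ A).filter fun e => e.1 < e.2 ∧ ∀ s ∈ S, s ≤ e.2 → s ≤ e.1 with hD
  set B := (roots A S).biUnion G with hB
  have hUcard : U.card ≤ A.card := by
    refine Finset.card_le_card_of_injOn Prod.fst ?_ ?_
    · intro e he
      exact (Finset.mem_product.1 (Finset.mem_filter.1 he).1).1
    · rintro ⟨a, b⟩ he ⟨a', b'⟩ he' (rfl : a = a')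
      simp only [hU, Finset.coe_filter, Finset.mem_product, Set.mem_ofPred_eq] at he he'
      rw [le_antisymm (he.2.2 b' he'.1.2 he'.2.1.le) (he'.2.2 b he.1.2 he.2.1.le)]
  have hDcard : D.card ≤ A.card := by
    refine Finset.card_le_card_of_injOn Prod.snd ?_ ?_
    · intro e he
      exact (Finset.mem_product.1 (Finset.mem_filter.1 he).1).2
    · rintro ⟨a, b⟩ he ⟨a', b'⟩ he' (rfl : b = b')
      simp only [hD, Finset.coe_filter, Finset.mem_product, Set.mem_ofPred_eq] at he he'
      rw [le_antisymm (he'.2.2 a he.1.1 he.2.1.le) (he.2.2 a' he'.1.1 he'.2.1.le)]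
  have hBcard : B.card ≤ c * A.card := by
    refine Finset.card_biUnion_le.trans ((Finset.sum_le_sum hGcard).trans ?_)
    rw [← Finset.mul_sum]
    exact Nat.mul_le_mul_left _ (sum_card_comp_le hX A S)
  refine ⟨F ∪ B ∪ (U ∪ D), ?_, ?_, ?_⟩
  · refine Finset.union_subset (Finset.union_subset (hF.trans (ltPairs_mono hS.subset)) ?_)
      (Finset.union_subset ?_ ?_)
    · exact Finset.biUnion_subset.2 fun r hr =>
        (hG r hr).trans (ltPairs_mono (comp_subset _ _ _))
    · intro e he
      obtain ⟨he1, he2, -⟩ := Finset.mem_filter.1 he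
      rw [Finset.mem_product] at he1
      exact mem_ltPairs.2 ⟨he1.1, hS.subset he1.2, he2⟩
    · intro e he
      obtain ⟨he1, he2, -⟩ := Finset.mem_filter.1 he
      rw [Finset.mem_product] at he1
      exact mem_ltPairs.2 ⟨hS.subset he1.1, he1.2, he2⟩
  · have h1 := Finset.card_union_le (F ∪ B) (U ∪ D)
    have h2 := Finset.card_union_le F B
    have h3 := Finset.card_union_le U D
    nlinarith
  · intro a ha b hb hab
    rcases hS.same_comp_or hX ha hb hab with
      ⟨r, hr, har, hbr⟩ | ⟨s, hs, t, ht, has, hst, htb, hsl, htg⟩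
    · refine (hGhop r hr a har b hbr hab).mono (fun e he => ?_) le_rfl
      have : e ∈ B := Finset.mem_biUnion.2 ⟨r, hr, he⟩
      simp [this]
    · have h1 : Hop U 1 a s := by
        rcases has.eq_or_lt with rfl | hlt
        · exact Hop.refl _ _
        · exact Hop.single (Finset.mem_filter.2 ⟨Finset.mem_product.2 ⟨ha, hs⟩, hlt, hsl⟩)
      have h2 : Hop D 1 t b := by
        rcases htb.eq_or_lt with rfl | hlt
        · exact Hop.refl _ _
        · exact Hop.single (Finset.mem_filter.2 ⟨Finset.mem_product.2 ⟨ht, hb⟩, hlt, htg⟩)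
      have hsU : U ⊆ F ∪ B ∪ (U ∪ D) := fun e he => by simp [he]
      have hsD : D ⊆ F ∪ B ∪ (U ∪ D) := fun e he => by simp [he]
      have hsF : F ⊆ F ∪ B ∪ (U ∪ D) := fun e he => by simp [he]
      exact ((h1.mono hsU le_rfl).trans (((hFhop s hs t ht hst).mono hsF le_rfl).trans
        (h2.mono hsD le_rfl))).mono (Finset.Subset.refl _) (by omega)

theorem card_ltPairs_le {A : Finset X} {m : ℕ} (h : A.card ≤ m) :
    (ltPairs A).card ≤ m * A.card := by
  have := Finset.card_le_card (ltPairs_subset_product A)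
  rw [Finset.card_product] at this
  exact this.trans (Nat.mul_le_mul_right _ h)

/-- Shortcuts with a linear number of pairs for sets of Ackermann size. -/
theorem exists_shortcut_ack (hX : IsForest X) (k : ℕ) : ∀ (x : ℕ) (A : Finset X),
    A.card ≤ 2 * (ack k x + 1) → ∃ F : Finset (X × X), F ⊆ ltPairs A ∧
      F.card ≤ (6 * k + 4) * (x + 1) * A.card ∧
      ∀ a ∈ A, ∀ b ∈ A, a ≤ b → Hop F (2 * k + 1) a b := by
  induction k with
  | zero =>
    intro x A hA
    rw [ack_zero] at hA
    refine ⟨ltPairs A, Finset.Subset.refl _, card_ltPairs_le (by omega), fun a ha b hb hab => ?_⟩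
    exact hop_ltPairs ha hb hab
  | succ k ihk =>
    intro x
    induction x with
    | zero =>
      intro A hA
      rw [ack_succ_zero] at hA
      have hS := isSeparator_jumps hX A (fun _ => 1) (l := 4) (by norm_num)
      set S := jumps A (fun _ => 1) 4
      have hScard := hS.mul_card_le
      simp only [Finset.sum_const, smul_eq_mul, mul_one] at hScard
      obtain ⟨F, hF, hFcard, hFhop⟩ := ihk 1 S ((Finset.card_le_card hS.subset).trans hA)
      obtain ⟨G, hG, hGcard, hGhop⟩ := exists_shortcut_of_separator hX hS (c := 4) hF hFhop
        (fun r hr => ⟨ltPairs (comp A S r), Finset.Subset.refl _, by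
          have := hS.weight_lt r (mem_roots.1 hr).1 (mem_roots.1 hr).2.1
          simp only [Finset.sum_const, smul_eq_mul, mul_one] at this
          exact card_ltPairs_le this.le, fun a ha b hb hab =>
            (hop_ltPairs ha hb hab).mono (Finset.Subset.refl _) (by omega)⟩)
      refine ⟨G, hG, hGcard.trans ?_, fun a ha b hb hab =>
        (hGhop a ha b hb hab).mono (Finset.Subset.refl _) (by omega)⟩
      nlinarith [Nat.mul_le_mul_left (6 * k + 4) hScard]
    | succ x ihx =>
      intro A hA
      rw [ack_succ_succ] at hA
      set y := ack (k + 1) x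
      have hS := isSeparator_jumps hX A (fun _ => 1) (l := 2 * (y + 1)) (by omega)
      set S := jumps A (fun _ => 1) (2 * (y + 1))
      have hScard := hS.mul_card_le
      simp only [Finset.sum_const, smul_eq_mul, mul_one] at hScard
      obtain ⟨F, hF, hFcard, hFhop⟩ := ihk y S ((Finset.card_le_card hS.subset).trans hA)
      obtain ⟨G, hG, hGcard, hGhop⟩ := exists_shortcut_of_separator hX hS
        (c := (6 * (k + 1) + 4) * (x + 1)) hF hFhop
        (fun r hr => by
          have := hS.weight_lt r (mem_roots.1 hr).1 (mem_roots.1 hr).2.1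
          simp only [Finset.sum_const, smul_eq_mul, mul_one] at this
          exact ihx (comp A S r) this.le)
      refine ⟨G, hG, hGcard.trans ?_, hGhop⟩
      nlinarith [Nat.mul_le_mul_left (6 * k + 4) hScard]

theorem hop_comp_of_card_le (hX : IsForest X) {A S : Finset X} {r a b : X} {n : ℕ}
    (hn : (comp A S r).card ≤ n) (ha : a ∈ comp A S r) (hb : b ∈ comp A S r) (hab : a ≤ b) :
    Hop (parentPairs A) n a b := by
  refine (hop_parentPairs hX (comp_subset _ _ _ ha) (comp_subset _ _ _ hb) hab).mono
    (Finset.Subset.refl _) ((Finset.card_le_card ?_).trans hn)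
  intro x hx
  obtain ⟨hxA, hax, hxb⟩ := Finset.mem_filter.1 hx
  exact mem_comp_of_le_of_le ha hb hxA hax hxb.le

theorem hop_up (hX : IsForest X) {A S : Finset X} (hSA : S ⊆ A) {G : Finset (X × X)} {h : ℕ}
    (hG : parentPairs A ⊆ G) (hcomp : ∀ r ∈ roots A S, ∀ a ∈ comp A S r, Hop G h a r)
    {v s : X} (hv : v ∈ A) (hs : s ∈ S) (hvs : v ≤ s) (hsl : ∀ x ∈ S, v ≤ x → s ≤ x) :
    Hop G (h + 1) v s := by
  by_cases hvS : v ∈ S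
  · rw [le_antisymm hvs (hsl v hvS le_rfl)]
    exact Hop.refl _ _
  · obtain ⟨r, hr, hvr⟩ := exists_root hX hv hvS
    exact (hcomp r hr v hvr).trans (Hop.single (hG (root_parent hX hSA hr hvr hs hvs hsl)))

theorem hop_down (hX : IsForest X) {A S : Finset X} (hSA : S ⊆ A) {G : Finset (X × X)} {h : ℕ}
    (hG : parentPairs A ⊆ G)
    (hcomp : ∀ r ∈ roots A S, ∀ u ∈ comp A S r, ∀ y ∈ comp A S r, ∀ t ∈ S,
      (t, y) ∈ parentPairs A → y ≤ u → Hop G h y u)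
    {u t : X} (hu : u ∈ A) (ht : t ∈ S) (htu : t ≤ u) (htg : ∀ x ∈ S, x ≤ u → x ≤ t) :
    Hop G (h + 1) t u := by
  by_cases huS : u ∈ S
  · rw [le_antisymm (htg u huS le_rfl) htu]
    exact Hop.refl _ _
  · obtain ⟨r, hr, hur⟩ := exists_root hX hu huS
    obtain ⟨y, hy, hty, hyu⟩ := exists_bottom hX hSA hur ht htu htg
    exact ((Hop.single (hG hty)).trans (hcomp r hr u hur y hy t ht hty hyu)).mono
      (Finset.Subset.refl _) (by omega)

theorem IsSeparator.hop (hX : IsForest X) {A S : Finset X} {w : X → ℕ} {l : ℕ}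
    (hS : IsSeparator A S w l) {G : Finset (X × X)} {h k : ℕ} (hG : parentPairs A ⊆ G)
    (hSG : ∀ a ∈ S, ∀ b ∈ S, a ≤ b → Hop G k a b)
    (hcomp : ∀ r ∈ roots A S, ∀ a ∈ comp A S r, ∀ b ∈ comp A S r, a ≤ b → Hop G h a b)
    {a b : X} (ha : a ∈ A) (hb : b ∈ A) (hab : a ≤ b) : Hop G (2 * h + k + 2) a b := by
  rcases hS.same_comp_or hX ha hb hab with
    ⟨r, hr, har, hbr⟩ | ⟨s, hs, t, ht, has, hst, htb, hsl, htg⟩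
  · exact (hcomp r hr a har b hbr hab).mono (Finset.Subset.refl _) (by omega)
  · have h1 := hop_up hX hS.subset hG (fun r hr a ha =>
      hcomp r hr a ha r (self_mem_comp hr) (mem_comp.1 ha).2.1) ha hs has hsl
    have h2 := hop_down hX hS.subset hG (fun r hr u hu y hy t _ _ hyu =>
      hcomp r hr y hy u hu hyu) hb ht htb htg
    exact (h1.trans ((hSG s hs t ht hst).trans h2)).mono (Finset.Subset.refl _) (by omega)

/-- Shortcuts with linearly many pairs, independently of `k`, for sets of size about
`ack k k`. -/
theorem exists_shortcut_linear (hX : IsForest X) {k R : ℕ} (hk : 1 ≤ k) (hR : R ≤ ack k k)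
    (A : Finset X) (hA : A.card ≤ 2 * R) :
    ∃ F : Finset (X × X), F ⊆ ltPairs A ∧ F.card ≤ 33 * A.card ∧
      ∀ a ∈ A, ∀ b ∈ A, a ≤ b → Hop F (6 * k + 5) a b := by
  have hS := isSeparator_jumps hX A (fun _ => 1) (l := 2 * k) (by omega)
  set S := jumps A (fun _ => 1) (2 * k)
  have hScard := hS.mul_card_le
  simp only [Finset.sum_const, smul_eq_mul, mul_one] at hScard
  have hack : ack k k ≤ ack (k + 1) 1 := by
    have h1 : ack (k + 1) 1 = ack k (ack (k + 1) 0) := ack_succ_succ k 0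
    rw [h1, ack_succ_zero]
    apply ack_mono_right
    have := add_add_one_le_ack k 1
    omega
  obtain ⟨F, hF, hFcard, hFhop⟩ := exists_shortcut_ack hX (k + 1) 1 S (by
    have := Finset.card_le_card hS.subset
    omega)
  refine ⟨F ∪ parentPairs A, Finset.union_subset (hF.trans (ltPairs_mono hS.subset))
    (parentPairs_subset_ltPairs A), ?_, ?_⟩
  · have h1 := Finset.card_union_le F (parentPairs A)
    have h2 := card_parentPairs_le A
    have h3 : S.card ≤ k * S.card := Nat.le_mul_of_pos_left _ hk
    nlinarith
  · intro a ha b hb hab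
    refine (hS.hop hX (h := 2 * k) (k := 2 * (k + 1) + 1) Finset.subset_union_right
      (fun a ha b hb hab => (hFhop a ha b hb hab).mono Finset.subset_union_left le_rfl)
      (fun r hr a ha b hb hab => (hop_comp_of_card_le hX ?_ ha hb hab).mono
        Finset.subset_union_right le_rfl) ha hb hab).mono (Finset.Subset.refl _) (by omega)
    have := hS.weight_lt r (mem_roots.1 hr).1 (mem_roots.1 hr).2.1
    simp only [Finset.sum_const, smul_eq_mul, mul_one] at this
    exact this.le

theorem pairDegree_ltPairs_le (A : Finset X) (a : X) : pairDegree (ltPairs A) a ≤ 2 * A.card := by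
  have : (ltPairs A).filter (fun e => e.1 = a ∨ e.2 = a) ⊆
      A.image (fun x => (a, x)) ∪ A.image (fun x => (x, a)) := by
    rintro ⟨x, y⟩ he
    obtain ⟨he, hea⟩ := Finset.mem_filter.1 he
    obtain ⟨hx, hy, -⟩ := mem_ltPairs.1 he
    rw [Finset.mem_union, Finset.mem_image, Finset.mem_image]
    rcases hea with rfl | rfl
    · exact Or.inl ⟨y, hy, rfl⟩
    · exact Or.inr ⟨x, hx, rfl⟩
  refine (Finset.card_le_card this).trans ((Finset.card_union_le _ _).trans ?_)
  have h1 := Finset.card_image_le (s := A) (f := fun x => (a, x))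
  have h2 := Finset.card_image_le (s := A) (f := fun x => (x, a))
  omega

/-- Shortcuts for the separator and for the components have degrees that do not add up. -/
theorem pairDegree_separator_le (hX : IsForest X) {A S : Finset X} {D : ℕ} {F : Finset (X × X)}
    {G : X → Finset (X × X)} (hF : F ⊆ ltPairs S)
    (hG : ∀ r ∈ roots A S, G r ⊆ ltPairs (comp A S r))
    (hFD : ∀ a, pairDegree F a ≤ D) (hGD : ∀ r ∈ roots A S, ∀ a, pairDegree (G r) a ≤ D) (a : X) :
    pairDegree (F ∪ (roots A S).biUnion G) a ≤ D := by
  by_cases haS : a ∈ S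
  · refine (pairDegree_mono fun e he hea => ?_).trans (hFD a)
    rcases Finset.mem_union.1 he with he | he
    · exact he
    · obtain ⟨r, hr, he⟩ := Finset.mem_biUnion.1 he
      obtain ⟨h1, h2, -⟩ := mem_ltPairs.1 (hG r hr he)
      rcases hea with rfl | rfl
      · exact absurd haS (notMem_of_mem_comp h1)
      · exact absurd haS (notMem_of_mem_comp h2)
  · have hnF : ∀ e ∈ F, ¬ (e.1 = a ∨ e.2 = a) := by
      intro e he hea
      obtain ⟨h1, h2, -⟩ := mem_ltPairs.1 (hF he)
      rcases hea with rfl | rfl <;> contradiction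
    by_cases haA : a ∈ A
    · obtain ⟨r, hr, har⟩ := exists_root hX haA haS
      refine (pairDegree_mono fun e he hea => ?_).trans (hGD r hr a)
      rcases Finset.mem_union.1 he with he | he
      · exact absurd hea (hnF e he)
      · obtain ⟨r', hr', he⟩ := Finset.mem_biUnion.1 he
        obtain ⟨h1, h2, -⟩ := mem_ltPairs.1 (hG r' hr' he)
        have : r' = r := by
          rcases hea with rfl | rfl
          · exact eq_of_mem_comp hX hr' hr h1 har
          · exact eq_of_mem_comp hX hr' hr h2 har
        rwa [← this]
    · refine (pairDegree_mono (G := ∅) fun e he hea => ?_).trans (by simp [pairDegree])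
      rcases Finset.mem_union.1 he with he | he
      · exact absurd hea (hnF e he)
      · obtain ⟨r', hr', he⟩ := Finset.mem_biUnion.1 he
        obtain ⟨h1, h2, -⟩ := mem_ltPairs.1 (hG r' hr' he)
        rcases hea with rfl | rfl
        · exact absurd (comp_subset _ _ _ h1) haA
        · exact absurd (comp_subset _ _ _ h2) haA

/-- Shortcuts of bounded degree and logarithmic hop-diameter. The elements of `Z`, at most two,
are reached with half the number of hops. -/
theorem exists_shortcut_degree (hX : IsForest X) {R : ℕ} (hR : 2 ≤ R) (m : ℕ) :
    ∀ (A Z : Finset X), A.card < R ^ m → Z ⊆ A → Z.card ≤ 2 →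
    ∃ F : Finset (X × X), F ⊆ ltPairs A ∧ (∀ a, pairDegree F a ≤ 8 * R) ∧
      (∀ z ∈ Z, ∀ v ∈ A, (v ≤ z → Hop (F ∪ parentPairs A) (2 * m) v z) ∧
        (z ≤ v → Hop (F ∪ parentPairs A) (2 * m) z v)) ∧
      ∀ a ∈ A, ∀ b ∈ A, a ≤ b → Hop (F ∪ parentPairs A) (4 * m) a b := by
  induction m with
  | zero =>
    intro A Z hA hZ _
    rw [pow_zero, Nat.lt_one_iff, Finset.card_eq_zero] at hA
    subst hA
    rw [Finset.subset_empty] at hZ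
    subst hZ
    exact ⟨∅, by simp, by simp [pairDegree], by simp, by simp⟩
  | succ m ih =>
    intro A Z hA hZ hZcard
    have hpos : 0 < R ^ m := by positivity
    have hS := isSeparator_jumps hX A (fun x => 1 + if x ∈ Z then R ^ m else 0) hpos
    set S := jumps A (fun x => 1 + if x ∈ Z then R ^ m else 0) (R ^ m)
    have hZS : Z ⊆ S := fun z hz => hS.mem_of_le z (hZ hz) (by simp [hz])
    have hScard : S.card ≤ 4 * R := by
      have h1 := hS.mul_card_le
      rw [Finset.sum_add_distrib, ← Finset.sum_filter, Finset.sum_const, Finset.sum_const,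
        Finset.filter_mem_eq_inter, Finset.inter_eq_right.2 hZ] at h1
      simp only [smul_eq_mul, mul_one] at h1
      have h2 : Z.card * R ^ m ≤ 2 * R ^ m := Nat.mul_le_mul_right _ hZcard
      rw [pow_succ] at hA
      have h3 : R ^ m * S.card ≤ R ^ m * (4 * R) := by nlinarith
      exact Nat.le_of_mul_le_mul_left h3 hpos
    set bot : X → Finset X := fun r => (comp A S r).filter fun y => ∃ t ∈ S, (t, y) ∈ parentPairs A
      with hbot
    have hcompF : ∀ r ∈ roots A S, ∃ F : Finset (X × X), F ⊆ ltPairs (comp A S r) ∧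
        (∀ a, pairDegree F a ≤ 8 * R) ∧
        (∀ z ∈ insert r (bot r), ∀ v ∈ comp A S r,
          (v ≤ z → Hop (F ∪ parentPairs (comp A S r)) (2 * m) v z) ∧
          (z ≤ v → Hop (F ∪ parentPairs (comp A S r)) (2 * m) z v)) ∧
        ∀ a ∈ comp A S r, ∀ b ∈ comp A S r, a ≤ b →
          Hop (F ∪ parentPairs (comp A S r)) (4 * m) a b := by
      intro r hr
      apply ih
      · have h1 := hS.weight_lt r (mem_roots.1 hr).1 (mem_roots.1 hr).2.1
        rw [Finset.sum_add_distrib, Finset.sum_const] at h1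
        simp only [smul_eq_mul, mul_one] at h1
        omega
      · exact Finset.insert_subset (self_mem_comp hr) (Finset.filter_subset _ _)
      · have h1 : (bot r).card ≤ 1 := by
          rw [Finset.card_le_one]
          intro y hy y' hy'
          obtain ⟨hy, t, ht, hty⟩ := Finset.mem_filter.1 hy
          obtain ⟨hy', t', ht', hty'⟩ := Finset.mem_filter.1 hy'
          exact hS.bottom_unique (mem_roots.1 hr).1 hy hy' ht ht' hty hty'
        exact (Finset.card_insert_le _ _).trans (by omega)
    choose! G hG hGD hGZ hGhop using hcompF
    set F := ltPairs S ∪ (roots A S).biUnion G with hF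
    have hGF : ∀ r ∈ roots A S, G r ∪ parentPairs (comp A S r) ⊆ F ∪ parentPairs A := by
      intro r hr
      refine Finset.union_subset_union (fun e he => ?_) (parentPairs_comp_subset hX A S r)
      exact Finset.mem_union_right _ (Finset.mem_biUnion.2 ⟨r, hr, he⟩)
    have hSF : ∀ a ∈ S, ∀ b ∈ S, a ≤ b → Hop (F ∪ parentPairs A) 1 a b := fun a ha b hb hab =>
      (hop_ltPairs ha hb hab).mono
        (Finset.subset_union_left.trans Finset.subset_union_left) le_rfl
    have hup : ∀ {v s : X}, v ∈ A → s ∈ S → v ≤ s → (∀ x ∈ S, v ≤ x → s ≤ x) →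
        Hop (F ∪ parentPairs A) (2 * m + 1) v s := fun hv hs hvs hsl =>
      hop_up hX hS.subset Finset.subset_union_right (fun r hr a ha =>
        ((hGZ r hr r (Finset.mem_insert_self _ _) a ha).1 (mem_comp.1 ha).2.1).mono
          (hGF r hr) le_rfl) hv hs hvs hsl
    have hdown : ∀ {u t : X}, u ∈ A → t ∈ S → t ≤ u → (∀ x ∈ S, x ≤ u → x ≤ t) →
        Hop (F ∪ parentPairs A) (2 * m + 1) t u := fun hu ht htu htg =>
      hop_down hX hS.subset Finset.subset_union_right (fun r hr u hu y hy t ht hty hyu =>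
        ((hGZ r hr y (Finset.mem_insert_of_mem (Finset.mem_filter.2 ⟨hy, t, ht, hty⟩)) u hu).2
          hyu).mono (hGF r hr) le_rfl) hu ht htu htg
    refine ⟨F, ?_, ?_, ?_, ?_⟩
    · exact Finset.union_subset (ltPairs_mono hS.subset) (Finset.biUnion_subset.2 fun r hr =>
        (hG r hr).trans (ltPairs_mono (comp_subset _ _ _)))
    · refine pairDegree_separator_le hX (Finset.Subset.refl _) hG (fun a => ?_) hGD
      exact (pairDegree_ltPairs_le S a).trans (by omega)
    · intro z hz v hv
      have hzS := hZS hz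
      constructor
      · intro hvz
        obtain ⟨s, hs, hvs, hsl⟩ := exists_least_above hX S ⟨z, hzS, hvz⟩
        exact (hup hv hs hvs hsl).trans (hSF s hs z hzS (hsl z hzS hvz))
      · intro hzv
        obtain ⟨t, ht, htv, htg⟩ := hS.exists_greatest v hv ⟨z, hzS, hzv⟩
        exact ((hSF z hzS t ht (htg z hzS hzv)).trans (hdown hv ht htv htg)).mono
          (Finset.Subset.refl _) (by omega)
    · intro a ha b hb hab
      rcases hS.same_comp_or hX ha hb hab with
        ⟨r, hr, har, hbr⟩ | ⟨s, hs, t, ht, has, hst, htb, hsl, htg⟩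
      · exact (hGhop r hr a har b hbr hab).mono (hGF r hr) (by omega)
      · exact ((hup ha hs has hsl).trans ((hSF s hs t ht hst).trans (hdown hb ht htb htg))).mono
          (Finset.Subset.refl _) (by omega)

/-- The branching of a separator is at most the branching of the whole set. -/
theorem IsSeparator.card_children_le (hX : IsForest X) {A S : Finset X} {w : X → ℕ} {l b : ℕ}
    (hS : IsSeparator A S w l) {a : X}
    (hb : (A.filter fun x => (x, a) ∈ parentPairs A).card ≤ b) :
    (S.filter fun x => (x, a) ∈ parentPairs S).card ≤ b := by
  have hex : ∀ s ∈ S.filter fun x => (x, a) ∈ parentPairs S,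
      ∃ c ∈ A.filter fun x => (x, a) ∈ parentPairs A, s ≤ c := by
    intro s hs
    obtain ⟨hs, hsa⟩ := Finset.mem_filter.1 hs
    obtain ⟨-, haS, hlt, -⟩ := mem_parentPairs.1 hsa
    obtain ⟨c, hc⟩ := (A.filter fun x => s ≤ x ∧ x < a).exists_maximal
      ⟨s, Finset.mem_filter.2 ⟨hS.subset hs, le_rfl, hlt⟩⟩
    obtain ⟨hcA, hsc, hca⟩ := Finset.mem_filter.1 hc.1
    refine ⟨c, Finset.mem_filter.2 ⟨hcA, mem_parentPairs.2 ⟨hcA, hS.subset haS, hca, ?_⟩⟩, hsc⟩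
    intro x hx hcx
    rcases hX c a x hca.le hcx.le with h | h
    · exact h
    · rcases h.eq_or_lt with rfl | h
      · exact le_rfl
      · exact absurd (hcx.trans_le (hc.2 (Finset.mem_filter.2 ⟨hx, hsc.trans hcx.le, h⟩) hcx.le))
          (lt_irrefl _)
  choose! f hf hsf using hex
  refine (Finset.card_le_card_of_injOn f hf ?_).trans hb
  intro s hs s' hs' heq
  have hcA := (Finset.mem_filter.1 (hf s hs)).1
  have hca := (mem_parentPairs.1 (Finset.mem_filter.1 (hf s hs)).2).2.2.1
  obtain ⟨t, ht, htc, htg⟩ := hS.exists_greatest (f s) hcA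
    ⟨s, (Finset.mem_filter.1 hs).1, hsf s hs⟩
  have key : ∀ {s}, (s, a) ∈ parentPairs S → s ∈ S → s ≤ f s' → s = t := by
    intro s hsa hsS hsc
    by_contra hne
    have hst := htg s hsS (heq ▸ hsc)
    have := (mem_parentPairs.1 hsa).2.2.2 t ht (lt_of_le_of_ne hst hne)
    exact absurd ((this.trans htc).trans_lt hca) (lt_irrefl _)
  rw [key (Finset.mem_filter.1 hs).2 (Finset.mem_filter.1 hs).1 (heq ▸ hsf s hs),
    key (Finset.mem_filter.1 hs').2 (Finset.mem_filter.1 hs').1 (hsf s' hs')]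

theorem pairDegree_parentPairs_le {A : Finset X} {b : ℕ}
    (hb : ∀ a ∈ A, (A.filter fun x => (x, a) ∈ parentPairs A).card ≤ b) (a : X) :
    pairDegree (parentPairs A) a ≤ b + 1 := by
  by_cases ha : a ∈ A
  · have h1 : ((parentPairs A).filter fun e => e.1 = a).card ≤ 1 := by
      rw [Finset.card_le_one]
      rintro ⟨x, y⟩ h ⟨x', y'⟩ h'
      simp only [Finset.mem_filter] at h h'
      obtain ⟨h, rfl⟩ := h
      obtain ⟨h', rfl⟩ := h'
      rw [parentPairs_unique h h']
    have h2 : ((parentPairs A).filter fun e => e.2 = a).card ≤ b := by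
      refine (Finset.card_le_card_of_injOn Prod.fst ?_ ?_).trans (hb a ha)
      · rintro ⟨x, y⟩ h
        simp only [Finset.coe_filter, Set.mem_ofPred_eq] at h ⊢
        obtain ⟨h, rfl⟩ := h
        exact ⟨(mem_parentPairs.1 h).1, h⟩
      · rintro ⟨x, y⟩ h ⟨x', y'⟩ h' (rfl : x = x')
        simp only [Finset.coe_filter, Set.mem_ofPred_eq] at h h'
        rw [h.2, h'.2]
    have h3 := Finset.card_union_le ((parentPairs A).filter fun e => e.1 = a)
      ((parentPairs A).filter fun e => e.2 = a)
    rw [← Finset.filter_or] at h3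
    unfold pairDegree
    omega
  · refine (pairDegree_mono (G := ∅) fun e he hea => ?_).trans (by simp [pairDegree])
    obtain ⟨h1, h2, -⟩ := mem_ltPairs.1 (parentPairs_subset_ltPairs A he)
    rcases hea with rfl | rfl <;> contradiction

/-- Shortcuts for a forest of bounded branching, with linearly many pairs, degree linear in `R`
and hop-diameter of order `log_R |A| + k` where `R ≤ ack k k`. -/
theorem exists_shortcut (hX : IsForest X) {k R b : ℕ} (hk : 1 ≤ k) (hR2 : 2 ≤ R)
    (hR : R ≤ ack k k) (A : Finset X)
    (hb : ∀ a ∈ A, (A.filter fun x => (x, a) ∈ parentPairs A).card ≤ b) :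
    ∃ F : Finset (X × X), F ⊆ ltPairs A ∧ F.card ≤ 43 * A.card ∧
      (∀ a, pairDegree F a ≤ 8 * R + 2 * (b + 1)) ∧
      ∀ a ∈ A, ∀ b ∈ A, a ≤ b → Hop F (4 * Nat.log R A.card + 12 * k + 16) a b := by
  have hS := isSeparator_jumps hX A (fun _ => 1) (l := 2 * R) (by omega)
  set S := jumps A (fun _ => 1) (2 * R)
  have hScard := hS.mul_card_le
  simp only [Finset.sum_const, smul_eq_mul, mul_one] at hScard
  have hcompcard : ∀ r ∈ roots A S, (comp A S r).card ≤ 2 * R := by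
    intro r hr
    have := hS.weight_lt r (mem_roots.1 hr).1 (mem_roots.1 hr).2.1
    simp only [Finset.sum_const, smul_eq_mul, mul_one] at this
    exact this.le
  obtain ⟨F, hF, hFD, -, hFhop⟩ := exists_shortcut_degree hX hR2 (Nat.log R A.card + 1) S ∅
    ((Finset.card_le_card hS.subset).trans_lt (Nat.lt_pow_succ_log_self (by omega) _))
    (by simp) (by simp)
  have hcompF := fun r hr => exists_shortcut_linear hX hk hR (comp A S r) (hcompcard r hr)
  choose! G hG hGcard hGhop using hcompF
  set B := (roots A S).biUnion G with hB
  have hBcard : B.card ≤ 33 * A.card := by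
    refine Finset.card_biUnion_le.trans ((Finset.sum_le_sum hGcard).trans ?_)
    rw [← Finset.mul_sum]
    exact Nat.mul_le_mul_left _ (sum_card_comp_le hX A S)
  refine ⟨F ∪ B ∪ (parentPairs S ∪ parentPairs A), ?_, ?_, ?_, ?_⟩
  · refine Finset.union_subset (Finset.union_subset (hF.trans (ltPairs_mono hS.subset)) ?_)
      (Finset.union_subset ((parentPairs_subset_ltPairs S).trans (ltPairs_mono hS.subset))
        (parentPairs_subset_ltPairs A))
    exact Finset.biUnion_subset.2 fun r hr => (hG r hr).trans (ltPairs_mono (comp_subset _ _ _))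
  · have h1 := Finset.card_union_le (F ∪ B) (parentPairs S ∪ parentPairs A)
    have h2 := Finset.card_union_le F B
    have h3 := Finset.card_union_le (parentPairs S) (parentPairs A)
    have h4 := card_parentPairs_le A
    have h5 := (card_parentPairs_le S).trans (Finset.card_le_card hS.subset)
    have h6 := card_le_of_pairDegree_le (hF.trans (ltPairs_subset_product S)) hFD
    nlinarith
  · intro a
    have h1 := pairDegree_union_le (F ∪ B) (parentPairs S ∪ parentPairs A) a
    have h2 := pairDegree_union_le (parentPairs S) (parentPairs A) a
    have h3 := pairDegree_separator_le hX hF hG hFD (fun r hr a =>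
      (pairDegree_mono fun e he _ => hG r hr he).trans ((pairDegree_ltPairs_le _ a).trans
        (by have := hcompcard r hr; omega))) a
    rw [← hB] at h3
    have h4 := pairDegree_parentPairs_le hb a
    have h5 := pairDegree_parentPairs_le (A := S) (b := b)
      (fun s hs => hS.card_children_le hX (hb s (hS.subset hs))) a
    omega
  · intro a ha b hb hab
    refine (hS.hop hX (h := 6 * k + 5) (k := 4 * (Nat.log R A.card + 1))
      (Finset.subset_union_right.trans Finset.subset_union_right)
      (fun a ha b hb hab => (hFhop a ha b hb hab).mono ?_ le_rfl)
      (fun r hr a ha b hb hab => (hGhop r hr a ha b hb hab).mono ?_ le_rfl)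
      ha hb hab).mono (Finset.Subset.refl _) (by omega)
    · exact Finset.union_subset_union Finset.subset_union_left Finset.subset_union_left
    · intro e he
      exact Finset.mem_union_left _ (Finset.mem_union_right _ (Finset.mem_biUnion.2 ⟨r, hr, he⟩))

end Forest

section Doubling

open Classical

theorem DoublingDimLE.exists_cover {d : ℕ} (hP : DoublingDimLE P d) (m : ℕ) (x : P) (r : ℝ) :
    ∃ S : Finset P, S.card ≤ 2 ^ (d * m) ∧
      Metric.ball x r ⊆ ⋃ y ∈ S, Metric.ball y (r / 2 ^ m) := by
  induction m with
  | zero => exact ⟨{x}, by simp, by simp⟩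
  | succ m ih =>
    obtain ⟨S, hS, hcov⟩ := ih
    choose T hT hTcov using fun y => hP y (r / 2 ^ m)
    refine ⟨S.biUnion T, ?_, fun p hp => ?_⟩
    · refine Finset.card_biUnion_le.trans
        ((Finset.sum_le_card_nsmul _ _ _ fun y _ => hT y).trans ?_)
      rw [smul_eq_mul, mul_add, mul_one, pow_add]
      exact Nat.mul_le_mul_right _ hS
    · have h1 := hcov hp
      simp only [Set.mem_iUnion] at h1
      obtain ⟨y, hy, hpy⟩ := h1
      have h2 := hTcov y hpy
      simp only [Set.mem_iUnion] at h2 ⊢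
      obtain ⟨z, hz, hpz⟩ := h2
      refine ⟨z, Finset.mem_biUnion.2 ⟨y, hy, hz⟩, ?_⟩
      rwa [pow_succ, ← div_div]

/-- A separated set of bounded diameter in a doubling space is small. -/
theorem DoublingDimLE.card_le {d : ℕ} (hP : DoublingDimLE P d) {m : ℕ} {x : P} {r t : ℝ}
    {T : Finset P} (hr : 0 < r) (hT : ∀ p ∈ T, dist p x ≤ r)
    (hsep : ∀ p ∈ T, ∀ q ∈ T, p ≠ q → t ≤ dist p q) (hrt : 4 * r ≤ t * 2 ^ m) :
    T.card ≤ 2 ^ (d * m) := by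
  obtain ⟨S, hS, hcov⟩ := hP.exists_cover m x (2 * r)
  have hex : ∀ p ∈ T, ∃ y ∈ S, dist p y < 2 * r / 2 ^ m := by
    intro p hp
    have := hcov (Metric.mem_ball.2 ((hT p hp).trans_lt (by linarith : r < 2 * r)))
    simpa only [Set.mem_iUnion, Metric.mem_ball, exists_prop] using this
  choose! f hf hdist using hex
  refine (Finset.card_le_card_of_injOn f hf ?_).trans hS
  intro p hp q hq heq
  by_contra hne
  have h1 := hdist p hp
  have h2 := hdist q hq
  rw [heq] at h1
  have h3 := dist_triangle_right p q (f q)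
  have h4 := hsep p hp q hq hne
  have h5 : t < 2 * (2 * r / 2 ^ m) := by linarith
  have h6 : 2 * (2 * r / 2 ^ m) = 4 * r / 2 ^ m := by ring
  rw [h6, lt_div_iff₀ (by positivity)] at h5
  linarith

/-- A hierarchy of nets of `P` at the scales `s * 2 ^ i`, with a choice of parents. -/
structure NetHierarchy (P : Type) [MetricSpace P] (s : ℝ) where
  /-- The net at each level. -/
  net : ℕ → Set P
  /-- The parent, in the next net, of a net point. -/
  par : ℕ → P → P
  net_zero : net 0 = Set.univ
  net_succ_subset : ∀ i, net (i + 1) ⊆ net i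
  separated : ∀ i, ∀ p ∈ net i, ∀ q ∈ net i, p ≠ q → s * 2 ^ i ≤ dist p q
  par_mem : ∀ i, ∀ p ∈ net i, par i p ∈ net (i + 1)
  dist_par : ∀ i, ∀ p ∈ net i, dist p (par i p) ≤ s * 2 ^ (i + 1)
  par_eq : ∀ i, ∀ p ∈ net (i + 1), par i p = p

theorem exists_net [Finite P] (N : Set P) {r : ℝ} (hr : 0 ≤ r) :
    ∃ N' ⊆ N, (∀ p ∈ N', ∀ q ∈ N', p ≠ q → r ≤ dist p q) ∧ ∀ p ∈ N, ∃ q ∈ N', dist p q ≤ r := by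
  obtain ⟨N', hN'⟩ := (Set.toFinite {T : Set P | T ⊆ N ∧
    ∀ p ∈ T, ∀ q ∈ T, p ≠ q → r ≤ dist p q}).exists_maximal ⟨∅, by simp⟩
  refine ⟨N', hN'.1.1, hN'.1.2, fun p hp => ?_⟩
  by_contra hcon
  push Not at hcon
  have hmem : insert p N' ∈ {T : Set P | T ⊆ N ∧ ∀ p ∈ T, ∀ q ∈ T, p ≠ q → r ≤ dist p q} := by
    refine ⟨Set.insert_subset hp hN'.1.1, ?_⟩
    rintro a (rfl | ha) b (rfl | hb) hab
    · exact absurd rfl hab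
    · exact (hcon b hb).le
    · rw [dist_comm]
      exact (hcon a ha).le
    · exact hN'.1.2 a ha b hb hab
  have hpN : p ∈ N' := hN'.2 hmem (Set.subset_insert _ _) (Set.mem_insert _ _)
  have := hcon p hpN
  rw [dist_self] at this
  linarith

theorem exists_netHierarchy [Finite P] {s : ℝ} (hs : 0 ≤ s)
    (hmin : ∀ p q : P, p ≠ q → s ≤ dist p q) : Nonempty (NetHierarchy P s) := by
  choose g hgsub hgsep hgcov using fun (N : Set P) (i : ℕ) =>
    exists_net N (r := s * 2 ^ i) (by positivity)
  let net : ℕ → Set P := fun i => Nat.rec Set.univ (fun i N => g N (i + 1)) i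
  choose! f hf hfdist using hgcov
  refine ⟨⟨net, fun i p => if p ∈ net (i + 1) then p else f (net i) (i + 1) p, rfl,
    fun i => hgsub _ _, ?_, ?_, ?_, ?_⟩⟩
  · rintro (_ | i) p hp q hq hpq
    · simpa using hmin p q hpq
    · exact hgsep _ _ p hp q hq hpq
  · intro i p hp
    split_ifs with h
    · exact h
    · exact hf _ _ p hp
  · intro i p hp
    split_ifs with h
    · rw [dist_self]
      positivity
    · exact hfdist _ _ p hp
  · intro i p hp
    simp [hp]

variable {s : ℝ}

theorem NetHierarchy.net_antitone (T : NetHierarchy P s) : Antitone T.net :=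
  antitone_nat_of_succ_le T.net_succ_subset

theorem NetHierarchy.card_le {d : ℕ} (hP : DoublingDimLE P d) (T : NetHierarchy P s) (hs : 0 < s)
    {m : ℕ} {K : ℝ} (hK : 0 < K) (hm : 4 * K ≤ 2 ^ m) {i : ℕ} {x : P} {B : Finset P}
    (hB : ∀ p ∈ B, p ∈ T.net i) (hBx : ∀ p ∈ B, dist p x ≤ K * (s * 2 ^ i)) :
    B.card ≤ 2 ^ (d * m) := by
  have h0 : 0 < s * 2 ^ i := by positivity
  refine hP.card_le (by positivity) hBx
    (fun p hp q hq => T.separated i p (hB p hp) q (hB q hq)) ?_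
  nlinarith

/-- A net point together with its level. -/
@[ext]
structure Node (T : NetHierarchy P s) where
  /-- The underlying point. -/
  pt : P
  /-- The level. -/
  lvl : ℕ
  mem : pt ∈ T.net lvl

namespace Node

variable {T : NetHierarchy P s}

/-- The parent of a node, one level up. -/
def up (a : Node T) : Node T := ⟨T.par a.lvl a.pt, a.lvl + 1, T.par_mem _ _ a.mem⟩

theorem lvl_iterate_up (a : Node T) (k : ℕ) : (up^[k] a).lvl = a.lvl + k := by
  induction k with
  | zero => rfl
  | succ k ih =>
    rw [Function.iterate_succ_apply']
    exact congrArg (· + 1) ih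

instance : PartialOrder (Node T) where
  le a b := ∃ k, up^[k] a = b
  le_refl a := ⟨0, rfl⟩
  le_trans := by
    rintro a _ _ ⟨k, rfl⟩ ⟨l, rfl⟩
    exact ⟨l + k, Function.iterate_add_apply _ _ _ _⟩
  le_antisymm := by
    rintro a _ ⟨k, rfl⟩ ⟨l, hl⟩
    have h := congrArg Node.lvl hl
    rw [lvl_iterate_up, lvl_iterate_up] at h
    obtain rfl : k = 0 := by omega
    rfl

theorem iterate_up_le (a : Node T) (k : ℕ) : a ≤ up^[k] a := ⟨k, rfl⟩

theorem isForest : IsForest (Node T) := by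
  have key : ∀ (a : Node T) {i j : ℕ}, i ≤ j → up^[i] a ≤ up^[j] a := by
    intro a i j hij
    refine ⟨j - i, ?_⟩
    rw [← Function.iterate_add_apply, Nat.sub_add_cancel hij]
  rintro a _ _ ⟨i, rfl⟩ ⟨j, rfl⟩
  rcases le_total i j with h | h
  · exact Or.inl (key a h)
  · exact Or.inr (key a h)

theorem eq_iterate_up_of_le {a b : Node T} (h : a ≤ b) :
    a.lvl ≤ b.lvl ∧ b = up^[b.lvl - a.lvl] a := by
  obtain ⟨k, rfl⟩ := h
  rw [lvl_iterate_up]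
  exact ⟨by omega, by rw [Nat.add_sub_cancel_left]⟩

theorem lvl_lt_of_lt {a b : Node T} (h : a < b) : a.lvl < b.lvl := by
  obtain ⟨h1, h2⟩ := eq_iterate_up_of_le h.le
  refine lt_of_le_of_ne h1 fun heq => h.ne ?_
  rw [heq, Nat.sub_self] at h2
  exact h2.symm

theorem dist_le_of_le {a b : Node T} (h : a ≤ b) :
    dist a.pt b.pt ≤ 2 * (s * 2 ^ b.lvl) - 2 * (s * 2 ^ a.lvl) := by
  obtain ⟨k, rfl⟩ := h
  induction k with
  | zero => simp
  | succ k ih =>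
    rw [Function.iterate_succ_apply']
    have h1 := T.dist_par _ _ (up^[k] a).mem
    have h2 := dist_triangle a.pt (up^[k] a).pt (up (up^[k] a)).pt
    change _ ≤ 2 * (s * 2 ^ ((up^[k] a).lvl + 1)) - _
    change dist _ (up (up^[k] a)).pt ≤ _ at h1
    rw [pow_succ] at h1 ⊢
    linarith

end Node

/-- A point is significant at a level if another net point of that level is close to it. -/
def NetHierarchy.Significant (T : NetHierarchy P s) (K : ℝ) (u : P) (i : ℕ) : Prop :=
  ∃ v ∈ T.net i, v ≠ u ∧ dist u v ≤ K * (s * 2 ^ i)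

namespace Node

variable {T : NetHierarchy P s}

theorem pt_up_eq {K : ℝ} (hs : 0 ≤ s) (hK : 2 ≤ K) {a : Node T}
    (h : ¬ T.Significant K a.pt a.lvl) : (up a).pt = a.pt := by
  by_contra hne
  refine h ⟨(up a).pt, T.net_succ_subset _ (up a).mem, hne, ?_⟩
  have h1 : dist a.pt (up a).pt ≤ s * 2 ^ (a.lvl + 1) := T.dist_par _ _ a.mem
  have h2 : 0 ≤ s * 2 ^ a.lvl := by positivity
  rw [pow_succ] at h1
  nlinarith

end Node

/-- A set of nodes is `K`-full if it consists of the significant nodes and of the nodes of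
level `0`. -/
def IsFull (T : NetHierarchy P s) (K : ℝ) (A : Finset (Node T)) : Prop :=
  ∀ a, a ∈ A ↔ T.Significant K a.pt a.lvl ∨ a.lvl = 0

theorem exists_isFull [Finite P] (hs : 0 < s) (T : NetHierarchy P s) (K : ℝ) :
    ∃ A : Finset (Node T), IsFull T K A := by
  obtain ⟨n, hn⟩ : ∃ n : ℕ, ∀ a : Node T, T.Significant K a.pt a.lvl → a.lvl ≤ n := by
    obtain ⟨D, hD⟩ := (Set.toFinite (Set.range fun x : P × P => dist x.1 x.2)).bddAbove
    obtain ⟨n, hn⟩ := pow_unbounded_of_one_lt (D / s) (one_lt_two : (1 : ℝ) < 2)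
    refine ⟨n, fun a ⟨v, hv, hne, _⟩ => ?_⟩
    have h1 := T.separated _ v hv a.pt a.mem hne
    have h2 : dist v a.pt ≤ D := hD ⟨(v, a.pt), rfl⟩
    rw [div_lt_iff₀ hs] at hn
    have h3 : (2 : ℝ) ^ a.lvl < 2 ^ n := by
      by_contra hcon
      nlinarith
    exact ((pow_lt_pow_iff_right₀ one_lt_two).1 h3).le
  have hfin : {a : Node T | T.Significant K a.pt a.lvl ∨ a.lvl = 0}.Finite := by
    refine Set.Finite.of_injOn (f := fun a => (a.pt, a.lvl)) (t := Set.univ ×ˢ Set.Iic n) ?_ ?_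
      (Set.finite_univ.prod (Set.finite_Iic n))
    · rintro a (h | h)
      · exact ⟨trivial, hn _ h⟩
      · exact ⟨trivial, h.le.trans (Nat.zero_le _)⟩
    · intro a _ b _ h
      simp only [Prod.mk.injEq] at h
      exact Node.ext h.1 h.2
  exact ⟨hfin.toFinset, fun a => by simp⟩

/-- The set of significant nodes has bounded branching. -/
theorem IsFull.card_children_le {d : ℕ} (hP : DoublingDimLE P d) (hs : 0 < s)
    {T : NetHierarchy P s} {K : ℝ} (hK : 2 ≤ K) {m : ℕ} (hm : 4 * K ≤ 2 ^ m)
    {A : Finset (Node T)} (hA : IsFull T K A) (a : Node T) :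
    (A.filter fun x => (x, a) ∈ parentPairs A).card ≤ 2 ^ (d * m) := by
  have hpt : ∀ x, (x, a) ∈ parentPairs A → ∀ j, x.lvl + (j + 1) ≤ a.lvl →
      (Node.up^[j + 1] x).pt = a.pt := by
    intro x hx
    obtain ⟨hxA, -, hlt, hmin⟩ := mem_parentPairs.1 hx
    obtain ⟨-, heq⟩ := Node.eq_iterate_up_of_le hlt.le
    suffices h : ∀ n j, x.lvl + (j + 1) + n = a.lvl → (Node.up^[j + 1] x).pt = a.pt from
      fun j hj => h (a.lvl - (x.lvl + (j + 1))) j (by omega)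
    intro n
    induction n with
    | zero =>
      intro j hj
      rw [show j + 1 = a.lvl - x.lvl by omega, ← heq]
    | succ n ih =>
      intro j hj
      rw [← ih (j + 1) (by omega), Function.iterate_succ_apply' Node.up (j + 1)]
      refine (Node.pt_up_eq hs.le hK fun hsig => ?_).symm
      have hmem : Node.up^[j + 1] x ∈ A := (hA _).2 (Or.inl hsig)
      have hlt' : x < Node.up^[j + 1] x := by
        refine lt_of_le_of_ne (Node.iterate_up_le _ _) fun h => ?_
        have := congrArg Node.lvl h
        rw [Node.lvl_iterate_up] at this
        omega
      have := (Node.eq_iterate_up_of_le (hmin _ hmem hlt')).1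
      rw [Node.lvl_iterate_up] at this
      omega
  have hdist : ∀ x, (x, a) ∈ parentPairs A → dist x.pt a.pt ≤ K * (s * 2 ^ x.lvl) := by
    intro x hx
    have hlt := Node.lvl_lt_of_lt (mem_parentPairs.1 hx).2.2.1
    have h1 : dist x.pt (Node.up^[0 + 1] x).pt ≤ s * 2 ^ (x.lvl + 1) := T.dist_par _ _ x.mem
    rw [hpt x hx 0 (by omega), pow_succ] at h1
    have h2 : 0 ≤ s * 2 ^ x.lvl := by positivity
    nlinarith
  have hlvl : ∀ x, (x, a) ∈ parentPairs A → ∀ y, (y, a) ∈ parentPairs A → y.lvl ≤ x.lvl := by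
    intro x hx y hy
    by_contra! hlt
    obtain ⟨hxA, -, hxa, hmin⟩ := mem_parentPairs.1 hx
    have hya := Node.lvl_lt_of_lt (mem_parentPairs.1 hy).2.2.1
    obtain ⟨j, hj⟩ : ∃ j, y.lvl = x.lvl + (j + 1) := ⟨y.lvl - x.lvl - 1, by omega⟩
    set z := Node.up^[j + 1] x with hz
    have hzpt : z.pt = a.pt := hpt x hx j (by omega)
    have hzlvl : z.lvl = y.lvl := by rw [hz, Node.lvl_iterate_up, hj]
    have hzA : z ∈ A := by
      by_cases hyz : y.pt = a.pt
      · rw [show z = y from Node.ext (hzpt.trans hyz.symm) hzlvl]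
        exact (mem_parentPairs.1 hy).1
      · refine (hA z).2 (Or.inl ⟨y.pt, hzlvl ▸ y.mem, hzpt ▸ hyz, ?_⟩)
        rw [hzpt, hzlvl, dist_comm]
        exact hdist y hy
    have hxz : x < z := by
      refine lt_of_le_of_ne (Node.iterate_up_le _ _) fun h => ?_
      have := congrArg Node.lvl h
      omega
    have := (Node.eq_iterate_up_of_le (hmin z hzA hxz)).1
    omega
  set B := A.filter fun x => (x, a) ∈ parentPairs A with hB
  have hBmem : ∀ x ∈ B, (x, a) ∈ parentPairs A := fun x hx => (Finset.mem_filter.1 hx).2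
  rcases B.eq_empty_or_nonempty with h0 | ⟨x, hx⟩
  · rw [h0]
    simp
  have hlvl' : ∀ y ∈ B, y.lvl = x.lvl := fun y hy =>
    le_antisymm (hlvl x (hBmem x hx) y (hBmem y hy)) (hlvl y (hBmem y hy) x (hBmem x hx))
  have hinj : Set.InjOn Node.pt (B : Set (Node T)) := fun y hy z hz h =>
    Node.ext h ((hlvl' y hy).trans (hlvl' z hz).symm)
  rw [← Finset.card_image_of_injOn hinj]
  refine T.card_le hP hs (by linarith : 0 < K) hm (i := x.lvl) (x := a.pt) ?_ ?_
  · intro p hp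
    obtain ⟨y, hy, rfl⟩ := Finset.mem_image.1 hp
    rw [← hlvl' y hy]
    exact y.mem
  · intro p hp
    obtain ⟨y, hy, rfl⟩ := Finset.mem_image.1 hp
    rw [← hlvl' y hy]
    exact hdist y (hBmem y hy)

theorem card_le_of_lt_add {S : Finset ℕ} {L : ℕ} (h : ∀ i ∈ S, ∀ j ∈ S, j < i + L) :
    S.card ≤ L := by
  rcases S.eq_empty_or_nonempty with rfl | hne
  · simp
  · have : S ⊆ Finset.Ico (S.min' hne) (S.min' hne + L) := fun j hj =>
      Finset.mem_Ico.2 ⟨S.min'_le j hj, h _ (S.min'_mem hne) j hj⟩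
    simpa using Finset.card_le_card this

/-- Every node has a representative close to it, such that every point represents boundedly
many nodes. -/
theorem IsFull.exists_rep {d : ℕ} (hP : DoublingDimLE P d) (hs : 0 < s)
    {T : NetHierarchy P s} {K : ℝ} (hK : 2 ≤ K) {m L : ℕ} (hm : 4 * K ≤ 2 ^ m)
    (hL : 2 * K ≤ 2 ^ L) {A : Finset (Node T)} (hA : IsFull T K A) :
    ∃ rep : Node T → P, (∀ a, dist a.pt (rep a) ≤ s * 2 ^ a.lvl / 2) ∧
      (∀ a, a.lvl = 0 → rep a = a.pt) ∧
      ∀ (p : P) (B : Finset (Node T)), B ⊆ A → (∀ a ∈ B, rep a = p) →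
        B.card ≤ L + 1 + L * 2 ^ (d * m) * L := by
  have hL1 : 1 ≤ L := by
    by_contra hcon
    obtain rfl : L = 0 := by omega
    norm_num at hL
    linarith
  have hex : ∀ a : Node T, ∃ (q : P) (j : ℕ),
      (q = a.pt ∧ ∀ i, i + L ≤ a.lvl → ¬ T.Significant K a.pt i) ∨
      (j + L ≤ a.lvl ∧ q ∈ T.net j ∧ q ≠ a.pt ∧ dist a.pt q ≤ K * (s * 2 ^ j) ∧
        ∀ i, i + L ≤ a.lvl → T.Significant K a.pt i → i ≤ j) := by
    intro a
    by_cases h : ∃ i, i + L ≤ a.lvl ∧ T.Significant K a.pt i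
    · have hne : ((Finset.range (a.lvl + 1)).filter fun i =>
          i + L ≤ a.lvl ∧ T.Significant K a.pt i).Nonempty := by
        obtain ⟨i, hi⟩ := h
        exact ⟨i, Finset.mem_filter.2 ⟨Finset.mem_range.2 (by omega), hi⟩⟩
      obtain ⟨-, hj, q, hq⟩ := Finset.mem_filter.1 (Finset.max'_mem _ hne)
      refine ⟨q, _, Or.inr ⟨hj, hq.1, hq.2.1, hq.2.2, fun i hi hsig => ?_⟩⟩
      exact Finset.le_max' _ _ (Finset.mem_filter.2 ⟨Finset.mem_range.2 (by omega), hi, hsig⟩)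
    · push Not at h
      exact ⟨a.pt, 0, Or.inl ⟨rfl, h⟩⟩
  choose rep j hrep using hex
  have hscale : ∀ {i n : ℕ}, i + L ≤ n → K * (s * 2 ^ i) ≤ s * 2 ^ n / 2 := by
    intro i n hin
    have h1 : (2 : ℝ) ^ (i + L) ≤ 2 ^ n := pow_le_pow_right₀ one_le_two hin
    rw [pow_add] at h1
    have h2 : 2 * K * 2 ^ i ≤ (2 : ℝ) ^ n := by
      have : (0 : ℝ) < 2 ^ i := by positivity
      nlinarith
    nlinarith
  refine ⟨rep, fun a => ?_, fun a ha => ?_, fun p B hBA hBp => ?_⟩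
  · rcases hrep a with ⟨h, -⟩ | ⟨hj, -, -, hd, -⟩
    · rw [h, dist_self]
      positivity
    · exact hd.trans (hscale hj)
  · rcases hrep a with ⟨h, -⟩ | ⟨hj, -⟩
    · exact h
    · omega
  · set B₁ := B.filter fun a => rep a = a.pt ∧ ∀ i, i + L ≤ a.lvl → ¬ T.Significant K a.pt i
      with hB₁
    set B₂ := B.filter fun a => j a + L ≤ a.lvl ∧ rep a ∈ T.net (j a) ∧ rep a ≠ a.pt ∧
      dist a.pt (rep a) ≤ K * (s * 2 ^ j a) ∧
        ∀ i, i + L ≤ a.lvl → T.Significant K a.pt i → i ≤ j a with hB₂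
    have hsub : B ⊆ B₁ ∪ B₂ := by
      intro a ha
      rcases hrep a with h | h
      · exact Finset.mem_union_left _ (Finset.mem_filter.2 ⟨ha, h⟩)
      · exact Finset.mem_union_right _ (Finset.mem_filter.2 ⟨ha, h⟩)
    have h1 : B₁.card ≤ L + 1 := by
      have hinj : Set.InjOn Node.lvl (B₁ : Set (Node T)) := by
        intro a ha b hb hab
        obtain ⟨ha, hra, -⟩ := Finset.mem_filter.1 ha
        obtain ⟨hb, hrb, -⟩ := Finset.mem_filter.1 hb
        exact Node.ext (by rw [← hra, ← hrb, hBp a ha, hBp b hb]) hab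
      rw [← Finset.card_image_of_injOn hinj]
      have hle : ((B₁.image Node.lvl).erase 0).card ≤ L := by
        refine card_le_of_lt_add fun i hi n hn => ?_
        obtain ⟨hi0, hi⟩ := Finset.mem_erase.1 hi
        obtain ⟨a, ha, rfl⟩ := Finset.mem_image.1 hi
        obtain ⟨b, hb, rfl⟩ := Finset.mem_image.1 (Finset.mem_erase.1 hn).2
        obtain ⟨ha, hra, -⟩ := Finset.mem_filter.1 ha
        obtain ⟨hb, hrb, hbs⟩ := Finset.mem_filter.1 hb
        by_contra! hcon
        have hab : a.pt = b.pt := by rw [← hra, ← hrb, hBp a ha, hBp b hb]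
        refine hbs a.lvl hcon ?_
        rw [← hab]
        exact ((hA a).1 (hBA ha)).resolve_right hi0
      have := Finset.pred_card_le_card_erase (s := B₁.image Node.lvl) (a := 0)
      omega
    have h2 : B₂.card ≤ L * 2 ^ (d * m) * L := by
      have hmem : ∀ a ∈ B₂, a ∈ A ∧ j a + L ≤ a.lvl ∧ p ∈ T.net (j a) ∧ p ≠ a.pt ∧
          dist a.pt p ≤ K * (s * 2 ^ j a) ∧
          ∀ i, i + L ≤ a.lvl → T.Significant K a.pt i → i ≤ j a := by
        intro a ha
        obtain ⟨ha, h⟩ := Finset.mem_filter.1 ha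
        rw [hBp a ha] at h
        exact ⟨hBA ha, h⟩
      have hsig : ∀ a ∈ B₂, T.Significant K a.pt a.lvl := by
        intro a ha
        obtain ⟨haA, hj, -⟩ := hmem a ha
        exact ((hA a).1 haA).resolve_right (by omega)
      have hlevels : (B₂.image j).card ≤ L := by
        refine card_le_of_lt_add fun i hi n hn => ?_
        obtain ⟨a, ha, rfl⟩ := Finset.mem_image.1 hi
        obtain ⟨b, hb, rfl⟩ := Finset.mem_image.1 hn
        by_contra! hcon
        obtain ⟨-, haj, hpa, hne, hd, -⟩ := hmem a ha
        have hpb : p ∈ T.net (j a + L) := T.net_antitone hcon (hmem b hb).2.2.1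
        have hsep := T.separated _ a.pt (T.net_antitone haj a.mem) p hpb hne.symm
        have h3 := hscale (le_refl (j a + L))
        have h4 : 0 < s * 2 ^ (j a + L) := by positivity
        linarith
      refine (Finset.card_le_mul_card_image (f := j) B₂ (L * 2 ^ (d * m)) fun n _ => ?_).trans
        (Nat.mul_le_mul_left _ hlevels)
      set B₃ := B₂.filter fun a => j a = n with hB₃
      have hpts : (B₃.image Node.pt).card ≤ 2 ^ (d * m) := by
        refine T.card_le hP hs (by linarith : 0 < K) hm (i := n) (x := p) ?_ ?_
        · intro q hq
          obtain ⟨a, ha, rfl⟩ := Finset.mem_image.1 hq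
          obtain ⟨haB, han⟩ := Finset.mem_filter.1 ha
          exact T.net_antitone (by have := (hmem a haB).2.1; omega) a.mem
        · intro q hq
          obtain ⟨a, ha, rfl⟩ := Finset.mem_image.1 hq
          obtain ⟨haB, han⟩ := Finset.mem_filter.1 ha
          rw [← han]
          exact (hmem a haB).2.2.2.2.1
      refine (Finset.card_le_mul_card_image (f := Node.pt) B₃ L fun u _ => ?_).trans
        (Nat.mul_le_mul_left _ hpts)
      have hinj : Set.InjOn Node.lvl (B₃.filter fun a => a.pt = u : Set (Node T)) := by
        intro a ha b hb hab
        exact Node.ext ((Finset.mem_filter.1 ha).2.trans (Finset.mem_filter.1 hb).2.symm) hab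
      rw [← Finset.card_image_of_injOn hinj]
      refine card_le_of_lt_add fun i hi l hl => ?_
      obtain ⟨a, ha, rfl⟩ := Finset.mem_image.1 hi
      obtain ⟨b, hb, rfl⟩ := Finset.mem_image.1 hl
      obtain ⟨ha, hau⟩ := Finset.mem_filter.1 ha
      obtain ⟨hb, hbu⟩ := Finset.mem_filter.1 hb
      obtain ⟨ha, han⟩ := Finset.mem_filter.1 ha
      obtain ⟨hb, hbn⟩ := Finset.mem_filter.1 hb
      by_contra! hcon
      have h3 := (hmem b hb).2.2.2.2.2 a.lvl hcon (by
        rw [hbu, ← hau]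
        exact hsig a ha)
      have h4 := (hmem a ha).2.1
      omega
    have h3 := (Finset.card_le_card hsub).trans (Finset.card_union_le _ _)
    omega

/-- `Reach H h w p q`: there is a walk in `H` from `p` to `q` with at most `h` edges and of
weight at most `w`. -/
inductive Reach (H : Finset (Sym2 P)) : ℕ → ℝ → P → P → Prop
  | refl {h : ℕ} {w : ℝ} (hw : 0 ≤ w) (p : P) : Reach H h w p p
  | step {h : ℕ} {w v : ℝ} {p c q : P} : s(p, c) ∈ H → dist p c ≤ v → Reach H h w c q →
      Reach H (h + 1) (v + w) p q

namespace Reach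

variable {H : Finset (Sym2 P)} {h k : ℕ} {v w : ℝ} {p q c : P}

theorem mono (hr : Reach H h w p q) (hk : h ≤ k) (hv : w ≤ v) : Reach H k v p q := by
  induction hr generalizing k v with
  | refl hw p => exact refl (hw.trans hv) p
  | @step h w u p c q hmem hd _ ih =>
    obtain ⟨k, rfl⟩ : ∃ n, k = n + 1 := ⟨k - 1, by omega⟩
    have := step hmem hd (ih (k := k) (v := v - u) (by omega) (by linarith))
    rwa [add_sub_cancel] at this

theorem trans (hr : Reach H h w p c) (hr' : Reach H k v c q) : Reach H (h + k) (w + v) p q := by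
  induction hr with
  | refl hw p => exact hr'.mono (by omega) (by linarith)
  | @step h w u p c q hmem hd _ ih =>
    exact (step hmem hd (ih hr')).mono (by omega) (by linarith)

theorem single (hmem : s(p, q) ∈ H) (hd : dist p q ≤ w) : Reach H 1 w p q := by
  simpa using step hmem hd (refl (h := 0) le_rfl q)

theorem symm (hr : Reach H h w p q) : Reach H h w q p := by
  induction hr with
  | refl hw p => exact refl hw p
  | @step h w u p c q hmem hd _ ih =>
    rw [add_comm u w]
    exact ih.trans (single (by rwa [Sym2.eq_swap]) (by rwa [dist_comm]))

theorem exists_path (hr : Reach H h w p q) : ∃ k ≤ h, ∃ x : Fin (k + 1) → P,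
    x 0 = p ∧ x (Fin.last k) = q ∧ (∀ i : Fin k, s(x i.castSucc, x i.succ) ∈ H) ∧
      ∑ i : Fin k, dist (x i.castSucc) (x i.succ) ≤ w := by
  induction hr with
  | refl hw p => exact ⟨0, Nat.zero_le _, fun _ => p, rfl, rfl, fun i => i.elim0, by simpa⟩
  | @step h w u p c q hmem hd _ ih =>
    obtain ⟨k, hk, x, h0, hl, hx, hsum⟩ := ih
    refine ⟨k + 1, by omega, Fin.cons p x, rfl, ?_, ?_, ?_⟩
    · rw [← Fin.succ_last, Fin.cons_succ, hl]
    · intro i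
      refine Fin.cases ?_ (fun i => ?_) i
      · simpa [h0] using hmem
      · rw [← Fin.succ_castSucc, Fin.cons_succ, Fin.cons_succ]
        exact hx i
    · rw [Fin.sum_univ_succ]
      refine add_le_add (by simpa [h0] using hd) (le_of_eq_of_le ?_ hsum)
      refine Finset.sum_congr rfl fun i _ => ?_
      rw [← Fin.succ_castSucc, Fin.cons_succ, Fin.cons_succ]

end Reach

/-- The graph induced by a set of pairs of nodes and a choice of representatives. -/
noncomputable def repGraph {Q : Type} {V : Type*} (rep : V → Q) (G : Finset (V × V)) : Finset (Sym2 Q) :=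
  (G.image fun e => s(rep e.1, rep e.2)).filter fun e => ¬ e.IsDiag

theorem isGraphOn_repGraph {Q : Type} {V : Type*} (rep : V → Q) (G : Finset (V × V)) :
    IsGraphOn (repGraph rep G) := fun _ he => (Finset.mem_filter.1 he).2

theorem card_repGraph_le {Q : Type} {V : Type*} (rep : V → Q) (G : Finset (V × V)) :
    (repGraph rep G).card ≤ G.card :=
  (Finset.card_filter_le _ _).trans Finset.card_image_le

theorem degree_repGraph_le {Q : Type} {V : Type*} (rep : V → Q) {G : Finset (V × V)} {A : Finset V}
    (hG : G ⊆ A ×ˢ A) {D M : ℕ} (hD : ∀ a, pairDegree G a ≤ D) (p : Q)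
    (hM : (A.filter fun a => rep a = p).card ≤ M) : degree (repGraph rep G) p ≤ M * D := by
  have hsub : (repGraph rep G).filter (fun e => p ∈ e) ⊆
      ((A.filter fun a => rep a = p).biUnion fun a => G.filter fun e => e.1 = a ∨ e.2 = a).image
        fun e => s(rep e.1, rep e.2) := by
    intro e he
    obtain ⟨he, hp⟩ := Finset.mem_filter.1 he
    obtain ⟨⟨a, b⟩, hab, rfl⟩ := Finset.mem_image.1 (Finset.mem_filter.1 he).1
    obtain ⟨ha, hb⟩ := Finset.mem_product.1 (hG hab)
    refine Finset.mem_image.2 ⟨(a, b), Finset.mem_biUnion.2 ?_, rfl⟩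
    rcases Sym2.mem_iff.1 hp with h | h
    · exact ⟨a, Finset.mem_filter.2 ⟨ha, h.symm⟩, Finset.mem_filter.2 ⟨hab, Or.inl rfl⟩⟩
    · exact ⟨b, Finset.mem_filter.2 ⟨hb, h.symm⟩, Finset.mem_filter.2 ⟨hab, Or.inr rfl⟩⟩
  refine (Finset.card_le_card hsub).trans (Finset.card_image_le.trans
    (Finset.card_biUnion_le.trans ((Finset.sum_le_card_nsmul _ _ _ fun a _ => hD a).trans ?_)))
  rw [smul_eq_mul]
  exact Nat.mul_le_mul_right _ hM

theorem reach_repGraph_single {V : Type*} {rep : V → P} {G : Finset (V × V)} {a b : V} {w : ℝ}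
    (h : (a, b) ∈ G) (hd : dist (rep a) (rep b) ≤ w) :
    Reach (repGraph rep G) 1 w (rep a) (rep b) := by
  by_cases heq : rep a = rep b
  · rw [heq]
    exact Reach.refl (dist_nonneg.trans hd) _
  · exact Reach.single (Finset.mem_filter.2 ⟨Finset.mem_image.2 ⟨(a, b), h, rfl⟩,
      by simpa using heq⟩) hd

/-- Shortcuts in the net hierarchy give walks whose weight is proportional to the top scale. -/
theorem reach_of_hop (hs : 0 < s) {T : NetHierarchy P s} {rep : Node T → P}
    (hrep : ∀ a, dist a.pt (rep a) ≤ s * 2 ^ a.lvl / 2) {A : Finset (Node T)}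
    {F G : Finset (Node T × Node T)} (hF : F ⊆ ltPairs A) (hFG : F ⊆ G) {h : ℕ} {a b : Node T}
    (hab : Hop F h a b) : Reach (repGraph rep G) h
      (5 * (s * 2 ^ b.lvl) - 5 * (s * 2 ^ a.lvl)) (rep a) (rep b) := by
  induction hab with
  | refl h a => exact Reach.refl (by simp) _
  | @step h a c b hm _ ih =>
    have hlt := (mem_ltPairs.1 (hF hm)).2.2
    have h1 : (2 : ℝ) ^ (a.lvl + 1) ≤ 2 ^ c.lvl :=
      pow_le_pow_right₀ one_le_two (Node.lvl_lt_of_lt hlt)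
    rw [pow_succ] at h1
    have h2 := Node.dist_le_of_le hlt.le
    have h3 := hrep a
    have h4 := hrep c
    have h5 : dist (rep a) (rep c) ≤ dist a.pt (rep a) + dist a.pt c.pt + dist c.pt (rep c) := by
      rw [dist_comm a.pt (rep a)]
      exact dist_triangle4 _ _ _ _
    have h6 : s * 2 ^ a.lvl * 2 ≤ s * 2 ^ c.lvl := by nlinarith
    have h7 : 0 < s * 2 ^ a.lvl := by positivity
    have h8 : dist (rep a) (rep c) ≤ 5 * (s * 2 ^ c.lvl) - 5 * (s * 2 ^ a.lvl) := by linarith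
    exact ((reach_repGraph_single (hFG hm) h8).trans ih).mono (by omega) (by linarith)

/-- The pairs of distinct nearby nodes of the same level. -/
noncomputable def crossPairs {T : NetHierarchy P s} (K : ℝ) (A : Finset (Node T)) :
    Finset (Node T × Node T) :=
  (A ×ˢ A).filter fun e => e.1.lvl = e.2.lvl ∧ e.1.pt ≠ e.2.pt ∧
    dist e.1.pt e.2.pt ≤ K * (s * 2 ^ e.1.lvl)

theorem pairDegree_crossPairs_le {d : ℕ} (hP : DoublingDimLE P d) (hs : 0 < s)
    {T : NetHierarchy P s} {K : ℝ} (hK : 0 < K) {m : ℕ} (hm : 4 * K ≤ 2 ^ m)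
    (A : Finset (Node T)) (a : Node T) :
    pairDegree (crossPairs K A) a ≤ 2 * 2 ^ (d * m) := by
  set B := A.filter fun x => x.lvl = a.lvl ∧ dist x.pt a.pt ≤ K * (s * 2 ^ a.lvl) with hB
  have hBcard : B.card ≤ 2 ^ (d * m) := by
    have hinj : Set.InjOn Node.pt (B : Set (Node T)) := fun x hx y hy h =>
      Node.ext h ((Finset.mem_filter.1 hx).2.1.trans (Finset.mem_filter.1 hy).2.1.symm)
    rw [← Finset.card_image_of_injOn hinj]
    refine T.card_le hP hs hK hm (i := a.lvl) (x := a.pt) ?_ ?_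
    · intro p hp
      obtain ⟨x, hx, rfl⟩ := Finset.mem_image.1 hp
      rw [← (Finset.mem_filter.1 hx).2.1]
      exact x.mem
    · intro p hp
      obtain ⟨x, hx, rfl⟩ := Finset.mem_image.1 hp
      exact (Finset.mem_filter.1 hx).2.2
  have hsub : (crossPairs K A).filter (fun e => e.1 = a ∨ e.2 = a) ⊆
      B.image (fun x => (a, x)) ∪ B.image (fun x => (x, a)) := by
    rintro ⟨x, y⟩ he
    obtain ⟨he, hea⟩ := Finset.mem_filter.1 he
    obtain ⟨hxy, hl, -, hd⟩ := Finset.mem_filter.1 he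
    obtain ⟨hx, hy⟩ := Finset.mem_product.1 hxy
    rw [Finset.mem_union, Finset.mem_image, Finset.mem_image]
    dsimp only at hea hl hd hx hy
    rcases hea with rfl | rfl
    · exact Or.inl ⟨y, Finset.mem_filter.2 ⟨hy, hl.symm, by rwa [dist_comm]⟩, rfl⟩
    · exact Or.inr ⟨x, Finset.mem_filter.2 ⟨hx, hl, by rwa [← hl]⟩, rfl⟩
  refine (Finset.card_le_card hsub).trans ((Finset.card_union_le _ _).trans ?_)
  have h1 := Finset.card_image_le (s := B) (f := fun x => (a, x))
  have h2 := Finset.card_image_le (s := B) (f := fun x => (x, a))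
  omega

theorem exists_scale {s D : ℝ} (hs : 0 < s) (hD : s ≤ D) :
    ∃ i : ℕ, s * 2 ^ i ≤ D ∧ D < 2 * (s * 2 ^ i) := by
  obtain ⟨i, h1, h2⟩ := exists_nat_pow_near ((one_le_div hs).2 hD) (one_lt_two : (1 : ℝ) < 2)
  rw [le_div_iff₀ hs] at h1
  rw [div_lt_iff₀ hs, pow_succ] at h2
  exact ⟨i, by linarith, by linarith⟩

/-- The graph induced by shortcuts and cross pairs contains short paths with few hops. -/
theorem exists_reach {δ : ℝ} (hδ : 0 < δ) (hδ' : δ ≤ 1 / 8) (hs : 0 < s) {T : NetHierarchy P s}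
    (hmin : ∀ p q : P, p ≠ q → s ≤ δ * dist p q)
    {A : Finset (Node T)} (hA : IsFull T (2 / δ + 4) A) {rep : Node T → P}
    (hrep : ∀ a, dist a.pt (rep a) ≤ s * 2 ^ a.lvl / 2) (hrep0 : ∀ a, a.lvl = 0 → rep a = a.pt)
    {F : Finset (Node T × Node T)} (hF : F ⊆ ltPairs A) {h : ℕ}
    (hhop : ∀ a ∈ A, ∀ b ∈ A, a ≤ b → Hop F h a b) (p q : P) :
    Reach (repGraph rep (F ∪ crossPairs (2 / δ + 4) A)) (2 * h + 1)
      ((1 + 15 * δ) * dist p q) p q := by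
  rcases eq_or_ne p q with rfl | hpq
  · exact Reach.refl (by simp) _
  obtain ⟨i, hi1, hi2⟩ := exists_scale hs (hmin p q hpq)
  set t := s * 2 ^ i with ht
  have hDpos : 0 < dist p q := dist_pos.2 hpq
  have ht0 : 0 < t := by positivity
  have hD : dist p q < 2 / δ * t := by
    rw [div_mul_eq_mul_div, lt_div_iff₀ hδ]
    linarith
  let base : P → Node T := fun p => ⟨p, 0, by rw [T.net_zero]; trivial⟩
  let anc : P → Node T := fun p => Node.up^[i] (base p)
  have hlvl : ∀ p, (anc p).lvl = i := fun p => by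
    simp only [anc, Node.lvl_iterate_up, base, zero_add]
  have hanc : ∀ p, dist p (anc p).pt ≤ 2 * t := fun p => by
    have h1 := Node.dist_le_of_le (Node.iterate_up_le (base p) i)
    change dist p (anc p).pt ≤ 2 * (s * 2 ^ (anc p).lvl) - 2 * (s * 2 ^ 0) at h1
    rw [hlvl] at h1
    linarith
  have hbase : ∀ p, base p ∈ A := fun p => (hA _).2 (Or.inr rfl)
  have hup : ∀ p, anc p ∈ A → Reach (repGraph rep (F ∪ crossPairs (2 / δ + 4) A)) h (5 * t) p
      (rep (anc p)) := fun p hp => by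
    have h1 := reach_of_hop hs hrep hF (Finset.subset_union_left (s₂ := crossPairs (2 / δ + 4) A))
      (hhop _ (hbase p) _ hp (Node.iterate_up_le _ _))
    rw [hrep0 (base p) rfl, hlvl] at h1
    refine h1.mono le_rfl ?_
    have : 0 < s * 2 ^ (base p).lvl := by positivity
    linarith
  have h1 := hanc p
  have h2 := hanc q
  have h3 : dist (anc p).pt (anc q).pt ≤ dist p q + 4 * t := by
    have := dist_triangle4 (anc p).pt p q (anc q).pt
    rw [dist_comm (anc p).pt p] at this
    linarith
  have h4 : dist p q ≤ dist (anc p).pt (anc q).pt + 4 * t := by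
    have := dist_triangle4 p (anc p).pt (anc q).pt q
    rw [dist_comm (anc q).pt q] at this
    linarith
  have hne : (anc p).pt ≠ (anc q).pt := by
    intro heq
    rw [heq, dist_self] at h4
    nlinarith
  have h5 : dist (anc p).pt (anc q).pt ≤ (2 / δ + 4) * t := by linarith
  have hpA : anc p ∈ A := (hA _).2 (Or.inl ⟨(anc q).pt, by
    rw [hlvl, ← hlvl q]; exact (anc q).mem, hne.symm, by rwa [hlvl]⟩)
  have hqA : anc q ∈ A := (hA _).2 (Or.inl ⟨(anc p).pt, by
    rw [hlvl, ← hlvl p]; exact (anc p).mem, hne, by rwa [hlvl, dist_comm]⟩)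
  have hcross : (anc p, anc q) ∈ F ∪ crossPairs (2 / δ + 4) A :=
    Finset.mem_union_right _ (Finset.mem_filter.2 ⟨Finset.mem_product.2 ⟨hpA, hqA⟩,
      (hlvl p).trans (hlvl q).symm, hne, by simpa only [hlvl] using h5⟩)
  have h6 : dist (rep (anc p)) (rep (anc q)) ≤ dist p q + 5 * t := by
    have h7 := hrep (anc p)
    have h8 := hrep (anc q)
    rw [hlvl] at h7 h8
    have := dist_triangle4 (rep (anc p)) (anc p).pt (anc q).pt (rep (anc q))
    rw [dist_comm (rep (anc p)) (anc p).pt] at this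
    linarith
  refine (((hup p hpA).trans (reach_repGraph_single hcross h6)).trans (hup q hqA).symm).mono
    (by omega) ?_
  linarith

theorem exists_pos_le_dist [Finite P] : ∃ c : ℝ, 0 < c ∧ ∀ p q : P, p ≠ q → c ≤ dist p q := by
  obtain ⟨B, hB⟩ := (Set.toFinite (Set.range fun x : P × P => (dist x.1 x.2)⁻¹)).bddAbove
  refine ⟨(max B 1)⁻¹, by positivity, fun p q hpq => ?_⟩
  have h1 : (dist p q)⁻¹ ≤ B := hB ⟨(p, q), rfl⟩
  exact inv_le_of_inv_le₀ (dist_pos.2 hpq) (h1.trans (le_max_left _ _))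

/-- The spanner construction, with explicit constants. -/
theorem exists_spanner [Fintype P] {d : ℕ} (hP : DoublingDimLE P d) {δ : ℝ} (hδ : 0 < δ)
    (hδ' : δ ≤ 1 / 8) {m L : ℕ} (hm : 4 * (2 / δ + 4) ≤ 2 ^ m) (hL : 2 * (2 / δ + 4) ≤ 2 ^ L)
    {W M : ℕ} (hW : W = 2 ^ (d * m)) (hM : M = L + 1 + L * W * L)
    {k R : ℕ} (hk : 1 ≤ k) (hR2 : 2 ≤ R) (hR : R ≤ ack k k) :
    ∃ H : Finset (Sym2 P), IsGraphOn H ∧ H.card ≤ (43 + 2 * W) * (M * Fintype.card P) ∧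
      (∀ p, degree H p ≤ M * (2 * W + 9) * R) ∧
      ∀ p q, Reach H (8 * Nat.log R (M * Fintype.card P) + 24 * k + 33)
        ((1 + 15 * δ) * dist p q) p q := by
  obtain ⟨c, hc, hcmin⟩ := exists_pos_le_dist (P := P)
  have hs : 0 < δ * c := mul_pos hδ hc
  have hmin : ∀ p q : P, p ≠ q → δ * c ≤ δ * dist p q := fun p q hpq =>
    mul_le_mul_of_nonneg_left (hcmin p q hpq) hδ.le
  obtain ⟨T⟩ := exists_netHierarchy hs.le fun p q hpq => by
    have h1 := hcmin p q hpq
    nlinarith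
  have hK : (2 : ℝ) ≤ 2 / δ + 4 := by
    have : 0 < 2 / δ := by positivity
    linarith
  obtain ⟨A, hA⟩ := exists_isFull hs T (2 / δ + 4)
  obtain ⟨rep, hrep, hrep0, hfib⟩ := hA.exists_rep hP hs hK hm hL
  rw [← hW, ← hM] at hfib
  have hAcard : A.card ≤ M * Fintype.card P :=
    Finset.card_le_mul_card_image_of_maps_to (f := rep) (t := Finset.univ)
      (fun _ _ => Finset.mem_univ _) M fun p _ =>
        hfib p _ (Finset.filter_subset _ _) fun a ha => (Finset.mem_filter.1 ha).2
  obtain ⟨F, hF, hFcard, hFD, hFhop⟩ := exists_shortcut Node.isForest hk hR2 hR A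
    (fun a _ => hA.card_children_le hP hs hK hm a)
  have hcross := pairDegree_crossPairs_le hP hs (by linarith : (0 : ℝ) < 2 / δ + 4) hm A
  rw [← hW] at hFD hcross
  refine ⟨repGraph rep (F ∪ crossPairs (2 / δ + 4) A), isGraphOn_repGraph _ _, ?_, ?_, ?_⟩
  · have h1 := card_le_of_pairDegree_le (F := crossPairs (2 / δ + 4) A)
      (Finset.filter_subset _ _) hcross
    calc _ ≤ F.card + (crossPairs (2 / δ + 4) A).card :=
          (card_repGraph_le _ _).trans (Finset.card_union_le _ _)
      _ ≤ (43 + 2 * W) * A.card := by linarith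
      _ ≤ _ := Nat.mul_le_mul_left _ hAcard
  · intro p
    have hsub : F ∪ crossPairs (2 / δ + 4) A ⊆ A ×ˢ A :=
      Finset.union_subset (hF.trans (ltPairs_subset_product A)) (Finset.filter_subset _ _)
    refine (degree_repGraph_le rep hsub (D := (2 * W + 9) * R) (fun a => ?_) p
      (hfib p _ (Finset.filter_subset _ _) fun a ha => (Finset.mem_filter.1 ha).2)).trans_eq
      (mul_assoc _ _ _).symm
    have h1 := pairDegree_union_le F (crossPairs (2 / δ + 4) A) a
    have h2 := hFD a
    have h3 := hcross a
    nlinarith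
  · intro p q
    have h1 := Nat.log_mono_right (b := R) hAcard
    exact (exists_reach hδ hδ' hs hmin hA hrep hrep0 hF hFhop p q).mono (by omega) le_rfl

end Doubling

theorem invAck_spec (x : ℝ) : 1 ≤ invAck x ∧ x ≤ ack (invAck x) (invAck x) := by
  have hne : {k : ℕ | 1 ≤ k ∧ x ≤ ack k k}.Nonempty := by
    refine ⟨max 1 ⌈x⌉₊, le_max_left _ _, (Nat.le_ceil x).trans ?_⟩
    exact_mod_cast (le_max_right _ _).trans (lt_ack_left _ _).le
  exact Nat.sInf_mem hne

theorem natLog_floor_le {ρ : ℝ} (hρ : 2 ≤ ρ) {M n : ℕ} (hM : 1 ≤ M) (hn : 1 ≤ n) :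
    (Nat.log ⌊ρ⌋₊ (M * n) : ℝ) ≤ 2 * (Real.logb 2 M + Real.logb ρ n) := by
  have hR : 2 ≤ ⌊ρ⌋₊ := Nat.le_floor (by exact_mod_cast hρ)
  have hR' : (2 : ℝ) ≤ ⌊ρ⌋₊ := by exact_mod_cast hR
  have hM' : (1 : ℝ) ≤ M := by exact_mod_cast hM
  have hn' : (1 : ℝ) ≤ n := by exact_mod_cast hn
  have hlog : Real.log ρ ≤ 2 * Real.log ⌊ρ⌋₊ := by
    have h1 : ρ ≤ (⌊ρ⌋₊ : ℝ) ^ 2 := by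
      have := (Nat.lt_floor_add_one ρ).le
      nlinarith
    have h2 := Real.log_le_log (by linarith) h1
    rwa [Real.log_pow, Nat.cast_ofNat] at h2
  have hlog2 : 0 < Real.log 2 := Real.log_pos one_lt_two
  have hlogρ : Real.log 2 ≤ Real.log ρ := Real.log_le_log two_pos hρ
  have hlogM : 0 ≤ Real.log M := Real.log_nonneg hM'
  have hlogn : 0 ≤ Real.log n := Real.log_nonneg hn'
  calc (Nat.log ⌊ρ⌋₊ (M * n) : ℝ) ≤ Real.logb ⌊ρ⌋₊ (M * n : ℕ) := Real.natLog_le_logb _ _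
    _ = (Real.log M + Real.log n) / Real.log ⌊ρ⌋₊ := by
        rw [Real.logb, Nat.cast_mul, Real.log_mul (by positivity) (by positivity)]
    _ ≤ (Real.log M + Real.log n) / (Real.log ρ / 2) := by
        apply div_le_div_of_nonneg_left (by positivity) (by linarith) (by linarith)
    _ = 2 * (Real.log M / Real.log ρ + Real.log n / Real.log ρ) := by
        field_simp
    _ ≤ 2 * (Real.logb 2 M + Real.logb ρ n) := by
        unfold Real.logb
        gcongr

/-- **Spanners for doubling metrics with optimal degree–diameter tradeoff.** For every
`d ≥ 1` and `ε > 0` there is a constant `C = C(d, ε) > 0` such that every finite metric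
space with `n ≥ 2` points and doubling dimension at most `d` admits, for every `ρ ≥ 2`,
a `(1+ε)`-spanner with at most `C·n` edges, degree at most `C·ρ`, and hop-diameter at
most `C·(log_ρ n + α(ρ))`. -/
theorem spanners_doubling_degree_diameter (d : ℕ) (hd : 1 ≤ d) (ε : ℝ) (hε : 0 < ε) :
    ∃ C : ℝ, 0 < C ∧
      ∀ (P : Type) [MetricSpace P] [Fintype P],
        2 ≤ Fintype.card P → DoublingDimLE P d →
        ∀ ρ : ℝ, 2 ≤ ρ →
        ∃ H : Finset (Sym2 P),
          IsGraphOn H ∧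
          IsSpanner H (1 + ε) ∧
          (H.card : ℝ) ≤ C * Fintype.card P ∧
          (∀ p, (degree H p : ℝ) ≤ C * ρ) ∧
          (∀ p q, ∃ k : ℕ,
            (k : ℝ) ≤ C * (Real.logb ρ (Fintype.card P) + invAck ρ) ∧
            IsSpannerPath H (1 + ε) p q k) := by
  have hδ : 0 < min (ε / 15) (1 / 8) := by positivity
  set δ := min (ε / 15) (1 / 8) with hδdef
  have hδε : 15 * δ ≤ ε := by
    have := min_le_left (ε / 15) (1 / 8)
    linarith
  have hδ8 : δ ≤ 1 / 8 := min_le_right _ _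
  obtain ⟨m, hm⟩ := pow_unbounded_of_one_lt (4 * (2 / δ + 4)) (one_lt_two : (1 : ℝ) < 2)
  have hL : 2 * (2 / δ + 4) ≤ 2 ^ m := by
    have : 0 < 2 / δ := by positivity
    linarith
  obtain ⟨W, hW⟩ : ∃ W : ℕ, W = 2 ^ (d * m) := ⟨_, rfl⟩
  obtain ⟨M, hM⟩ : ∃ M : ℕ, M = m + 1 + m * W * m := ⟨_, rfl⟩
  have hM1 : 1 ≤ M := by omega
  have hlogM : 0 ≤ Real.logb 2 M := Real.logb_nonneg one_lt_two (by exact_mod_cast hM1)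
  refine ⟨(43 + 2 * W) * M + M * (2 * W + 9) + 16 * Real.logb 2 M + 57, by positivity, ?_⟩
  intro P _ _ hcard hP ρ hρ
  have hR2 : 2 ≤ ⌊ρ⌋₊ := Nat.le_floor (by exact_mod_cast hρ)
  have hRρ : (⌊ρ⌋₊ : ℝ) ≤ ρ := Nat.floor_le (by linarith)
  obtain ⟨hk, hack⟩ := invAck_spec ρ
  obtain ⟨H, hgraph, hHcard, hdeg, hreach⟩ := exists_spanner hP hδ hδ8 hm.le hL hW hM hk hR2
    (by exact_mod_cast hRρ.trans hack)
  have hpath : ∀ p q : P, ∃ k : ℕ,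
      (k : ℝ) ≤ ((43 + 2 * W) * M + M * (2 * W + 9) + 16 * Real.logb 2 M + 57) *
        (Real.logb ρ (Fintype.card P) + invAck ρ) ∧ IsSpannerPath H (1 + ε) p q k := by
    intro p q
    obtain ⟨k, hkle, x, hx0, hxl, hxH, hsum⟩ := (hreach p q).exists_path
    refine ⟨k, ?_, x, hx0, hxl, hxH, hsum.trans ?_⟩
    · have h1 := natLog_floor_le hρ hM1 (by omega : 1 ≤ Fintype.card P)
      have h2 : (k : ℝ) ≤ 8 * (Nat.log ⌊ρ⌋₊ (M * Fintype.card P) : ℝ) + 24 * invAck ρ + 33 := by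
        exact_mod_cast hkle
      have h3 : (1 : ℝ) ≤ invAck ρ := by exact_mod_cast hk
      have h4 : 0 ≤ Real.logb ρ (Fintype.card P) :=
        Real.logb_nonneg (by linarith) (by exact_mod_cast (by omega : 1 ≤ Fintype.card P))
      have h5 : 0 ≤ ((43 + 2 * W) * M + M * (2 * W + 9) : ℝ) *
          (Real.logb ρ (Fintype.card P) + invAck ρ) := by positivity
      nlinarith [mul_nonneg hlogM h4, mul_nonneg hlogM (sub_nonneg.2 h3)]
    · exact mul_le_mul_of_nonneg_right (by linarith) dist_nonneg
  refine ⟨H, hgraph, fun p q => ?_, ?_, fun p => ?_, hpath⟩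
  · obtain ⟨k, -, hk⟩ := hpath p q
    exact ⟨k, hk⟩
  · have h1 : (H.card : ℝ) ≤ (43 + 2 * W) * (M * Fintype.card P) := by exact_mod_cast hHcard
    have h2 : (0 : ℝ) ≤ (M * (2 * W + 9) + 16 * Real.logb 2 M + 57) * Fintype.card P := by
      positivity
    linarith
  · have h1 : (degree H p : ℝ) ≤ M * (2 * W + 9) * ⌊ρ⌋₊ := by exact_mod_cast hdeg p
    have h2 : (M * (2 * W + 9) : ℝ) * ⌊ρ⌋₊ ≤ M * (2 * W + 9) * ρ := by gcongr
    have h3 : (0 : ℝ) ≤ ((43 + 2 * W) * M + 16 * Real.logb 2 M + 57) * ρ := by positivity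
    linarith

end Stmt5
end

section
/- There is an absolute constant C > 0 with the following property. Let T be a tree on a finite vertex set V with |V| = n ≥ 2, with positive edge weights, and let d_T denote the induced shortest-path (tree) metric on V. Then for every real ρ ≥ 2 there exists a graph G_ρ on V (each edge {u,v} of G_ρ carrying weight d_T(u,v)) such that G_ρ is a 1-spanner for the metric space (V, d_T) with at most C·n edges, maximum degree Δ(G_ρ) ≤ Δ(T) + 2ρ, and hop-diameter at most C·(log_ρ n + α(ρ)). -/
open scoped BigOperators

namespace Stmt6

variable {V : Type}

/-- `H` is a graph on `V`: a finite set of unordered pairs of *distinct* vertices. -/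
def IsGraphOn (H : Finset (Sym2 V)) : Prop :=
  ∀ e ∈ H, ¬ e.IsDiag

open Classical in
/-- The degree of the vertex `p` in the graph `H`: the number of edges incident on `p`. -/
noncomputable def degree (H : Finset (Sym2 V)) (p : V) : ℕ :=
  (H.filter (fun e => p ∈ e)).card

open Classical in
/-- The maximum degree of a graph on a finite vertex set. -/
noncomputable def maxDegree [Fintype V] (H : Finset (Sym2 V)) : ℕ :=
  Finset.univ.sup (fun p => degree H p)

/-- The graph `T` connects all the vertices of `V`. -/
def IsConnectedOn (T : Finset (Sym2 V)) : Prop :=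
  ∀ p q : V, ∃ (k : ℕ) (x : Fin (k + 1) → V), x 0 = p ∧ x (Fin.last k) = q ∧
    ∀ i : Fin k, s(x i.castSucc, x i.succ) ∈ T

/-- The shortest-path metric `d_T` induced by the edge-weighted graph `T`:
the infimum of the total weights of walks between `u` and `v`. -/
noncomputable def treeDist (T : Finset (Sym2 V)) (w : Sym2 V → ℝ) (u v : V) : ℝ :=
  sInf {c : ℝ | ∃ (k : ℕ) (x : Fin (k + 1) → V), x 0 = u ∧ x (Fin.last k) = v ∧
    (∀ i : Fin k, s(x i.castSucc, x i.succ) ∈ T) ∧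
    ∑ i : Fin k, w s(x i.castSucc, x i.succ) = c}

/-- A `t`-spanner path with `k` edges between `p` and `q` in the graph `H`, with respect
to the distance function `dfun` (each edge `{a,b}` carries weight `dfun a b`). -/
def IsSpannerPathD (dfun : V → V → ℝ) (H : Finset (Sym2 V)) (t : ℝ) (p q : V) (k : ℕ) :
    Prop :=
  ∃ x : Fin (k + 1) → V, x 0 = p ∧ x (Fin.last k) = q ∧
    (∀ i : Fin k, s(x i.castSucc, x i.succ) ∈ H) ∧
    ∑ i : Fin k, dfun (x i.castSucc) (x i.succ) ≤ t * dfun p q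

/-- The inverse Ackermann function: the least `k ≥ 1` with `A(k,k) ≥ x`. -/
noncomputable def invAck (x : ℝ) : ℕ :=
  sInf {k : ℕ | 1 ≤ k ∧ x ≤ ack k k}

/-- An order whose principal lower sets are chains: the ancestor order of a rooted forest. -/
def IsForestOrder (V : Type) [SemilatticeInf V] : Prop :=
  ∀ a b c : V, a ≤ c → b ≤ c → a ≤ b ∨ b ≤ a

/-- `x` lies on the tree path from `u` to `v`, where `⊓` is the lowest common ancestor. -/
def Btw [SemilatticeInf V] (u x v : V) : Prop :=
  u ⊓ v ≤ x ∧ (x ≤ u ∨ x ≤ v)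

/-- The finite vertex set `X` is closed under lowest common ancestors. -/
def InfClosedOn [SemilatticeInf V] (X : Finset V) : Prop :=
  ∀ a ∈ X, ∀ b ∈ X, a ⊓ b ∈ X

/-- `G` contains a path with at most `k` edges from `u` to `v` that runs monotonically along
the tree path from `u` to `v`. -/
inductive MonoPath [SemilatticeInf V] (G : Finset (Sym2 V)) : ℕ → V → V → Prop
  | nil (k : ℕ) (u : V) : MonoPath G k u u
  | cons {k : ℕ} {u a v : V} : s(u, a) ∈ G → Btw u a v → MonoPath G k a v →
      MonoPath G (k + 1) u v

section Betweenness

variable [SemilatticeInf V]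

theorem Btw.symm {u x v : V} (h : Btw u x v) : Btw v x u :=
  ⟨inf_comm u v ▸ h.1, h.2.symm⟩

theorem btw_left (u v : V) : Btw u u v := ⟨inf_le_left, Or.inl le_rfl⟩

theorem btw_right (u v : V) : Btw u v v := ⟨inf_le_right, Or.inr le_rfl⟩

theorem btw_inf (u v : V) : Btw u (u ⊓ v) v := ⟨le_rfl, Or.inl inf_le_left⟩

theorem Btw.eq_of_self {u x : V} (h : Btw u x u) : x = u := by
  obtain ⟨h1, h2⟩ := h
  rw [inf_idem] at h1
  exact le_antisymm (h2.elim id id) h1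

theorem btw_of_le {u x v : V} (h1 : u ≤ x) (h2 : x ≤ v) : Btw u x v :=
  ⟨inf_le_left.trans h1, Or.inr h2⟩

theorem btw_split_of_le (ht : IsForestOrder V) {u x v : V} (h : u ⊓ v ≤ x) (hx : x ≤ u)
    (a : V) : Btw u x a ∨ Btw a x v := by
  by_cases hxa : x ≤ a
  · rcases ht (a ⊓ v) x a inf_le_left hxa with h1 | h1
    · exact Or.inr ⟨h1, Or.inl hxa⟩
    · rcases ht (u ⊓ a) (a ⊓ v) a inf_le_right inf_le_left with h2 | h2
      · exact Or.inl ⟨(le_inf inf_le_left (h2.trans inf_le_right)).trans h, Or.inl hx⟩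
      · exact Or.inr ⟨(le_inf (h2.trans inf_le_left) inf_le_right).trans h, Or.inl hxa⟩
  · rcases ht (u ⊓ a) x u inf_le_left hx with h1 | h1
    · exact Or.inl ⟨h1, Or.inl hx⟩
    · exact absurd (h1.trans inf_le_right) hxa

theorem Btw.split (ht : IsForestOrder V) {u x v : V} (h : Btw u x v) (a : V) :
    Btw u x a ∨ Btw a x v := by
  rcases h.2 with hx | hx
  · exact btw_split_of_le ht h.1 hx a
  · exact (btw_split_of_le ht h.symm.1 hx a).symm.imp Btw.symm Btw.symm

theorem Btw.antisymm {u a x : V} (h : Btw u a x) (h' : Btw u x a) :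
    a = x := by
  obtain ⟨h1, h2⟩ := h
  obtain ⟨h3, h4⟩ := h'
  apply le_antisymm
  · rcases h2 with h2 | h2
    · exact (le_inf h2 le_rfl).trans h3
    · exact h2
  · rcases h4 with h4 | h4
    · exact (le_inf h4 le_rfl).trans h1
    · exact h4

/-- If `a` is on the way to `x` and `x` is on the way to `v`, then `a` is on the way to `v`. -/
theorem Btw.trans_left (ht : IsForestOrder V) {u a x v : V} (h : Btw u a x) (h' : Btw u x v) :
    Btw u a v := by
  rcases h.split ht v with h1 | h1
  · exact h1
  · rcases h'.split ht a with h2 | h2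
    · obtain rfl := h.antisymm h2
      exact h'
    · obtain rfl := h1.antisymm h2.symm
      exact h'

theorem Btw.trans_right (ht : IsForestOrder V) {u a x v : V} (h : Btw u a x) (h' : Btw u x v) :
    Btw a x v := by
  rcases h'.split ht a with h1 | h1
  · obtain rfl := h.antisymm h1
    exact btw_left _ _
  · exact h1

theorem MonoPath.mono_graph {G H : Finset (Sym2 V)} (hGH : G ⊆ H) {k : ℕ} {u v : V}
    (h : MonoPath G k u v) : MonoPath H k u v := by
  induction h with
  | nil k u => exact .nil k u
  | cons he hb _ ih => exact .cons (hGH he) hb ih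

theorem MonoPath.mono_hops {G : Finset (Sym2 V)} {k : ℕ} {u v : V}
    (h : MonoPath G k u v) {l : ℕ} (hkl : k ≤ l) : MonoPath G l u v := by
  induction h generalizing l with
  | nil k u => exact .nil l u
  | cons he hb _ ih =>
    obtain ⟨l, rfl⟩ : ∃ m, l = m + 1 := ⟨l - 1, by omega⟩
    exact .cons he hb (ih (by omega))

theorem MonoPath.single {G : Finset (Sym2 V)} {u v : V} (h : s(u, v) ∈ G) : MonoPath G 1 u v :=
  .cons h (btw_right u v) (.nil 0 v)

theorem MonoPath.append (ht : IsForestOrder V) {G : Finset (Sym2 V)} {k l : ℕ} {u x v : V}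
    (h : MonoPath G k u x) (hb : Btw u x v) (h' : MonoPath G l x v) :
    MonoPath G (k + l) u v := by
  induction h with
  | nil k u => exact h'.mono_hops (by omega)
  | @cons k u a x he hba _ ih =>
    rw [Nat.add_right_comm]
    exact .cons he (hba.trans_left ht hb) (ih (hba.trans_right ht hb) h')

theorem MonoPath.symm (ht : IsForestOrder V) {G : Finset (Sym2 V)} {k : ℕ} {u v : V}
    (h : MonoPath G k u v) : MonoPath G k v u := by
  induction h with
  | nil k u => exact .nil k u
  | cons he hb _ ih => exact ih.append ht hb.symm (.single (Sym2.eq_swap ▸ he))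

open Classical in
theorem MonoPath.filter_not_isDiag {G : Finset (Sym2 V)} {k : ℕ} {u v : V}
    (h : MonoPath G k u v) : MonoPath (G.filter fun e => ¬ e.IsDiag) k u v := by
  induction h with
  | nil k u => exact .nil k u
  | @cons k u a v he hb _ ih =>
    by_cases hua : u = a
    · subst hua
      exact ih.mono_hops (by omega)
    · exact .cons (Finset.mem_filter.2 ⟨he, by simpa using hua⟩) hb ih

end Betweenness

section Separator

open Classical

variable [SemilatticeInf V]

/-- The vertices of `X \ S` that no vertex of `S` separates from `u`. -/
noncomputable def cell (X S : Finset V) (u : V) : Finset V :=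
  (X \ S).filter fun v => ∀ s ∈ S, ¬ Btw u s v

/-- The vertices of `S` that can be reached from `u` without meeting another vertex of `S`. -/
noncomputable def border (S : Finset V) (u : V) : Finset V :=
  S.filter fun s => ∀ s' ∈ S, Btw u s' s → s' = s

theorem mem_cell {X S : Finset V} {u v : V} :
    v ∈ cell X S u ↔ (v ∈ X ∧ v ∉ S) ∧ ∀ s ∈ S, ¬ Btw u s v := by
  simp [cell]

theorem mem_border {S : Finset V} {u s : V} :
    s ∈ border S u ↔ s ∈ S ∧ ∀ s' ∈ S, Btw u s' s → s' = s := by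
  simp [border]

theorem self_mem_cell {X S : Finset V} {u : V} (hu : u ∈ X) (huS : u ∉ S) : u ∈ cell X S u :=
  mem_cell.2 ⟨⟨hu, huS⟩, fun _ hs h => huS (h.eq_of_self ▸ hs)⟩

theorem not_btw_of_mem_cell (ht : IsForestOrder V) {X S : Finset V} {u v w : V}
    (hv : v ∈ cell X S u) (hw : w ∈ cell X S u) : ∀ s ∈ S, ¬ Btw v s w := by
  intro s hs h
  rcases h.split ht u with h1 | h1
  · exact (mem_cell.1 hv).2 s hs h1.symm
  · exact (mem_cell.1 hw).2 s hs h1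

theorem cell_eq_of_mem (ht : IsForestOrder V) {X S : Finset V} {u v : V}
    (hv : v ∈ cell X S u) : cell X S v = cell X S u := by
  ext w
  constructor
  · intro hw
    have hw' := mem_cell.1 hw
    refine mem_cell.2 ⟨hw'.1, fun s hs h => ?_⟩
    rcases h.split ht v with h1 | h1
    · exact (mem_cell.1 hv).2 s hs h1
    · exact hw'.2 s hs h1
  · intro hw
    exact mem_cell.2 ⟨(mem_cell.1 hw).1, not_btw_of_mem_cell ht hv hw⟩

theorem cell_subset {X S : Finset V} {u : V} : cell X S u ⊆ X :=
  fun _ hv => (mem_cell.1 hv).1.1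

theorem infClosedOn_cell (ht : IsForestOrder V) {X S : Finset V} (hX : InfClosedOn X) {u : V} :
    InfClosedOn (cell X S u) := by
  intro a ha b hb
  have hab := not_btw_of_mem_cell ht ha hb
  refine mem_cell.2 ⟨⟨hX a (cell_subset ha) b (cell_subset hb),
    fun h => hab _ h (btw_inf a b)⟩, fun s hs h => ?_⟩
  rcases h.split ht a with h1 | h1
  · exact (mem_cell.1 ha).2 s hs h1
  · exact hab s hs (h1.trans_left ht (btw_inf a b))

/-- The family of all cells of `X \ S`. -/
noncomputable def cells (X S : Finset V) : Finset (Finset V) :=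
  (X \ S).image (cell X S)

theorem mem_cells {X S C : Finset V} : C ∈ cells X S ↔ ∃ u, (u ∈ X ∧ u ∉ S) ∧ cell X S u = C := by
  simp [cells]

theorem cell_mem_cells {X S : Finset V} {u : V} (hu : u ∈ X) (huS : u ∉ S) :
    cell X S u ∈ cells X S := mem_cells.2 ⟨u, ⟨hu, huS⟩, rfl⟩

theorem eq_cell_of_mem_cells (ht : IsForestOrder V) {X S C : Finset V} (hC : C ∈ cells X S)
    {v : V} (hv : v ∈ C) : C = cell X S v := by
  obtain ⟨u, _, rfl⟩ := mem_cells.1 hC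
  exact (cell_eq_of_mem ht hv).symm

theorem sum_card_cells_add (ht : IsForestOrder V) {X S : Finset V} (hS : S ⊆ X) :
    ∑ C ∈ cells X S, C.card + S.card ≤ X.card := by
  have hdisj : (↑(cells X S) : Set (Finset V)).PairwiseDisjoint id := by
    intro C hC D hD hCD
    refine Finset.disjoint_left.2 fun v hv hv' => hCD ?_
    rw [eq_cell_of_mem_cells ht hC hv, eq_cell_of_mem_cells ht hD hv']
  have h1 : ∑ C ∈ cells X S, C.card = ((cells X S).biUnion id).card :=
    (Finset.card_biUnion hdisj).symm
  have h2 : ((cells X S).biUnion id).card ≤ (X \ S).card := by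
    apply Finset.card_le_card
    intro v hv
    obtain ⟨C, hC, hvC⟩ := Finset.mem_biUnion.1 hv
    obtain ⟨u, hu, rfl⟩ := mem_cells.1 hC
    simpa using (mem_cell.1 hvC).1
  have := Finset.card_sdiff_add_card_eq_card hS
  omega

theorem card_border_le (ht : IsForestOrder V) {S : Finset V} (hS : InfClosedOn S) (u : V) :
    (border S u).card ≤ 2 := by
  have h1 : ((border S u).filter fun s => s ≤ u).card ≤ 1 := by
    refine Finset.card_le_one.2 fun a ha b hb => ?_
    simp only [Finset.mem_filter, mem_border] at ha hb
    rcases ht a b u ha.2 hb.2 with h | h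
    · exact (ha.1.2 b hb.1.1 (btw_of_le h hb.2).symm).symm
    · exact hb.1.2 a ha.1.1 (btw_of_le h ha.2).symm
  have key : ∀ a b, a ∈ border S u → b ∈ border S u → ¬ a ≤ u → u ⊓ a ≤ u ⊓ b → a = b := by
    intro a b ha hb hau h
    rw [mem_border] at ha hb
    have h2 := ha.2 _ (hS a ha.1 b hb.1)
      ⟨le_inf inf_le_right (h.trans inf_le_right), Or.inr inf_le_left⟩
    have hab : a ≤ b := inf_eq_left.1 h2
    rcases ht (u ⊓ b) a b inf_le_right hab with h3 | h3
    · exact hb.2 a ha.1 ⟨h3, Or.inr hab⟩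
    · exact absurd (h3.trans inf_le_left) hau
  have h2 : ((border S u).filter fun s => ¬ s ≤ u).card ≤ 1 := by
    refine Finset.card_le_one.2 fun a ha b hb => ?_
    simp only [Finset.mem_filter] at ha hb
    rcases ht (u ⊓ a) (u ⊓ b) u inf_le_left inf_le_left with h | h
    · exact key a b ha.1 hb.1 ha.2 h
    · exact (key b a hb.1 ha.1 hb.2 h).symm
  have := Finset.card_filter_add_card_filter_not (s := border S u) (fun s => s ≤ u)
  omega

theorem exists_mem_border [Fintype V] (ht : IsForestOrder V) {S : Finset V} {u v s : V}
    (hs : s ∈ S) (h : Btw u s v) : ∃ a ∈ border S u, Btw u a v := by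
  obtain ⟨a, ha, hmin⟩ := Finset.exists_min_image (S.filter fun a => Btw u a v)
    (fun a => (Finset.univ.filter fun x => Btw u x a).card) ⟨s, by simp [hs, h]⟩
  simp only [Finset.mem_filter] at ha hmin
  refine ⟨a, mem_border.2 ⟨ha.1, fun b hb hba => ?_⟩, ha.2⟩
  by_contra hne
  refine absurd (hmin b ⟨hb, hba.trans_left ht ha.2⟩) (not_le.2 (Finset.card_lt_card ?_))
  refine Finset.ssubset_iff_subset_ne.2 ⟨fun x hx => ?_, fun heq => ?_⟩
  · simp only [Finset.mem_filter, Finset.mem_univ, true_and] at hx ⊢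
    exact hx.trans_left ht hba
  · have : a ∈ Finset.univ.filter fun x => Btw u x b := by rw [heq]; simp [btw_right]
    simp only [Finset.mem_filter, Finset.mem_univ, true_and] at this
    exact hne (hba.antisymm this)

/-- The total weight of the vertices of `X` at or below `x` in the tree. -/
noncomputable def subtreeWeight (X : Finset V) (wt : V → ℕ) (x : V) : ℕ :=
  ∑ y ∈ X.filter (x ≤ ·), wt y

theorem subtreeWeight_anti {X : Finset V} {wt : V → ℕ} {x y : V} (h : x ≤ y) :
    subtreeWeight X wt y ≤ subtreeWeight X wt x := by
  refine Finset.sum_le_sum_of_subset fun z hz => ?_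
  simp only [Finset.mem_filter] at hz ⊢
  exact ⟨hz.1, h.trans hz.2⟩

theorem sum_subtreeWeight_le {X M : Finset V} {wt : V → ℕ} {x : V} (hM : ∀ m ∈ M, x ≤ m)
    (hdisj : ∀ m ∈ M, ∀ m' ∈ M, ∀ z, m ≤ z → m' ≤ z → m = m') :
    ∑ m ∈ M, subtreeWeight X wt m ≤ subtreeWeight X wt x := by
  unfold subtreeWeight
  rw [← Finset.sum_biUnion]
  · refine Finset.sum_le_sum_of_subset fun z hz => ?_
    simp only [Finset.mem_biUnion, Finset.mem_filter] at hz ⊢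
    obtain ⟨m, hm, hz⟩ := hz
    exact ⟨hz.1, (hM m hm).trans hz.2⟩
  · intro m hm m' hm' hne
    refine Finset.disjoint_left.2 fun z hz hz' => hne ?_
    simp only [Finset.mem_filter] at hz hz'
    exact hdisj m hm m' hm' z hz.2 hz'.2

/-- The vertices of `X` where the subtree weight, counted in units of `t`, strictly exceeds that
of every proper descendant. -/
noncomputable def separator (X : Finset V) (wt : V → ℕ) (t : ℕ) : Finset V :=
  X.filter fun x => 1 ≤ subtreeWeight X wt x / t ∧
    ∀ y ∈ X, x < y → subtreeWeight X wt y / t < subtreeWeight X wt x / t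

theorem mem_separator {X : Finset V} {wt : V → ℕ} {t : ℕ} {x : V} :
    x ∈ separator X wt t ↔ x ∈ X ∧ 1 ≤ subtreeWeight X wt x / t ∧
      ∀ y ∈ X, x < y → subtreeWeight X wt y / t < subtreeWeight X wt x / t := by
  simp [separator]

theorem separator_subset {X : Finset V} {wt : V → ℕ} {t : ℕ} : separator X wt t ⊆ X :=
  Finset.filter_subset _ _

theorem infClosedOn_separator (ht : IsForestOrder V) {X : Finset V} (hX : InfClosedOn X)
    (wt : V → ℕ) {t : ℕ} (htpos : 0 < t) : InfClosedOn (separator X wt t) := by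
  intro a ha b hb
  by_cases hab : a ≤ b
  · rwa [inf_eq_left.2 hab]
  by_cases hba : b ≤ a
  · rwa [inf_eq_right.2 hba]
  rw [mem_separator] at ha hb ⊢
  refine ⟨hX a ha.1 b hb.1,
    ha.2.1.trans (Nat.div_le_div_right (subtreeWeight_anti inf_le_left)), fun y hy hlt => ?_⟩
  have main : ∀ c, a ⊓ b ≤ c → 1 ≤ subtreeWeight X wt c / t → (∀ z, y ≤ z → c ≤ z → False) →
      subtreeWeight X wt y / t < subtreeWeight X wt (a ⊓ b) / t := by
    intro c hc hc1 hdis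
    have hyc : y ≠ c := fun h => hdis y le_rfl h.ge
    have := sum_subtreeWeight_le (X := X) (M := {y, c}) (wt := wt) (x := a ⊓ b)
      (by simp [hlt.le, hc])
      (by
        simp only [Finset.mem_insert, Finset.mem_singleton]
        rintro m (rfl | rfl) m' (rfl | rfl) z h1 h2
        · rfl
        · exact (hdis z h1 h2).elim
        · exact (hdis z h2 h1).elim
        · rfl)
    rw [Finset.sum_pair hyc] at this
    have h1 : t ≤ subtreeWeight X wt c := (Nat.one_le_div_iff htpos).1 hc1
    calc subtreeWeight X wt y / t < subtreeWeight X wt y / t + 1 := Nat.lt_succ_self _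
      _ = (subtreeWeight X wt y + t) / t := (Nat.add_div_right _ htpos).symm
      _ ≤ _ := Nat.div_le_div_right (by omega)
  by_cases h1 : ∃ z, y ≤ z ∧ a ≤ z
  · refine main b inf_le_right hb.2.1 fun z' hyz' hbz' => ?_
    obtain ⟨z, hyz, haz⟩ := h1
    rcases ht y a z hyz haz with h | h
    · rcases ht y b z' hyz' hbz' with h' | h'
      · exact hlt.not_ge (le_inf h h')
      · exact hba (h'.trans h)
    · rcases ht y b z' hyz' hbz' with h' | h'
      · exact hab (h.trans h')
      · exact (ht a b y h h').elim hab hba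
  · exact main a inf_le_left ha.2.1 fun z h h' => h1 ⟨z, h, h'⟩

theorem mem_separator_of_le_weight {X : Finset V} {wt : V → ℕ} {t : ℕ}
    (htpos : 0 < t) {x : V} (hx : x ∈ X) (hwt : t ≤ wt x) : x ∈ separator X wt t := by
  have hself : wt x ≤ subtreeWeight X wt x :=
    Finset.single_le_sum (f := wt) (fun _ _ => Nat.zero_le _) (by simp [hx])
  refine mem_separator.2 ⟨hx, (Nat.one_le_div_iff htpos).2 (hwt.trans hself), fun y _ hxy => ?_⟩
  have h1 : wt x + subtreeWeight X wt y ≤ subtreeWeight X wt x := by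
    unfold subtreeWeight
    have hnot : x ∉ X.filter (y ≤ ·) := by simp [hxy.not_ge]
    rw [← Finset.sum_insert hnot]
    refine Finset.sum_le_sum_of_subset fun z hz => ?_
    simp only [Finset.mem_insert, Finset.mem_filter] at hz ⊢
    rcases hz with rfl | hz
    · exact ⟨hx, le_rfl⟩
    · exact ⟨hz.1, hxy.le.trans hz.2⟩
  calc subtreeWeight X wt y / t < subtreeWeight X wt y / t + 1 := Nat.lt_succ_self _
    _ = (subtreeWeight X wt y + t) / t := (Nat.add_div_right _ htpos).symm
    _ ≤ _ := Nat.div_le_div_right (by omega)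

theorem sum_cell_separator_lt (ht : IsForestOrder V) {X : Finset V} (hX : InfClosedOn X)
    (wt : V → ℕ) {t : ℕ} (htpos : 0 < t) {u : V} (hu : u ∈ X) (huS : u ∉ separator X wt t) :
    ∑ v ∈ cell X (separator X wt t) u, wt v < t := by
  set S := separator X wt t with hS
  obtain ⟨r, hr⟩ := (cell X S u).exists_minimal ⟨u, self_mem_cell hu huS⟩
  have hrX := cell_subset hr.prop
  have hmin : ∀ v ∈ cell X S u, r ≤ v := fun v hv =>
    (hr.le_of_le (infClosedOn_cell ht hX r hr.prop v hv) inf_le_left).trans inf_le_right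
  by_cases h0 : subtreeWeight X wt r / t = 0
  · have h1 : subtreeWeight X wt r < t := by
      rcases Nat.div_eq_zero_iff.1 h0 with h | h <;> omega
    refine lt_of_le_of_lt (Finset.sum_le_sum_of_subset fun v hv => ?_) h1
    simp [cell_subset hv, hmin v hv]
  · obtain ⟨s, hs⟩ := (X.filter fun y => r ≤ y ∧
      subtreeWeight X wt y / t = subtreeWeight X wt r / t).exists_maximal ⟨r, by simp [hrX]⟩
    have hsp := hs.prop
    simp only [Finset.mem_filter] at hsp
    have hsS : s ∈ S := by
      refine mem_separator.2 ⟨hsp.1, hsp.2.2 ▸ Nat.one_le_iff_ne_zero.2 h0, fun y hy hlt => ?_⟩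
      have h1 := Nat.div_le_div_right (c := t) (subtreeWeight_anti (X := X) (wt := wt) hlt.le)
      refine lt_of_le_of_ne h1 fun heq => ?_
      exact hs.not_gt (by simp [hy, hsp.2.1.trans hlt.le, heq, hsp.2.2]) hlt
    have hdisj : Disjoint (cell X S u) (X.filter (s ≤ ·)) := by
      refine Finset.disjoint_left.2 fun v hv hv' => ?_
      simp only [Finset.mem_filter] at hv'
      exact not_btw_of_mem_cell ht hr.prop hv s hsS (btw_of_le hsp.2.1 hv'.2)
    have h1 : ∑ v ∈ cell X S u, wt v + subtreeWeight X wt s ≤ subtreeWeight X wt r := by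
      unfold subtreeWeight
      rw [← Finset.sum_union hdisj]
      refine Finset.sum_le_sum_of_subset fun z hz => ?_
      simp only [Finset.mem_union, Finset.mem_filter] at hz ⊢
      rcases hz with hz | hz
      · exact ⟨cell_subset hz, hmin z hz⟩
      · exact ⟨hz.1, hsp.2.1.trans hz.2⟩
    have h2 := Nat.div_add_mod (subtreeWeight X wt s) t
    have h3 := Nat.div_add_mod (subtreeWeight X wt r) t
    have h4 := Nat.mod_lt (subtreeWeight X wt r) htpos
    rw [hsp.2.2] at h2
    omega

theorem card_separator_filter_lt (ht : IsForestOrder V) {X : Finset V} {wt : V → ℕ} {t : ℕ}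
    (htpos : 0 < t) (n : ℕ) : ∀ x ∈ separator X wt t,
    ((separator X wt t).filter (x ≤ ·)).card = n → n + 1 ≤ 2 * (subtreeWeight X wt x / t) := by
  induction n using Nat.strong_induction_on with
  | _ n ih =>
  intro x hx hn
  set S := separator X wt t with hS
  set φ : V → ℕ := fun y => subtreeWeight X wt y / t with hφ
  set M := S.filter fun m => x < m ∧ ∀ m' ∈ S, x < m' → m' ≤ m → m' = m with hM
  have hMmem : ∀ m, m ∈ M ↔ m ∈ S ∧ x < m ∧ ∀ m' ∈ S, x < m' → m' ≤ m → m' = m := by simp [hM]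
  have hbelow : ∀ m ∈ M, (S.filter (m ≤ ·)).card + 1 ≤ 2 * φ m := by
    intro m hm
    rw [hMmem] at hm
    refine ih _ ?_ m hm.1 rfl
    rw [← hn]
    refine Finset.card_lt_card (Finset.ssubset_iff_subset_ne.2 ⟨fun z hz => ?_, fun heq => ?_⟩)
    · simp only [Finset.mem_filter] at hz ⊢
      exact ⟨hz.1, hm.2.1.le.trans hz.2⟩
    · have : x ∈ S.filter (m ≤ ·) := by rw [heq]; simp [hx]
      simp only [Finset.mem_filter] at this
      exact hm.2.1.not_ge this.2
  have hcover : S.filter (x ≤ ·) ⊆ insert x (M.biUnion fun m => S.filter (m ≤ ·)) := by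
    intro z hz
    simp only [Finset.mem_filter] at hz
    rcases hz.2.eq_or_lt with rfl | hlt
    · exact Finset.mem_insert_self _ _
    · obtain ⟨m, hm⟩ := (S.filter fun m => x < m ∧ m ≤ z).exists_minimal
        ⟨z, by simp [hz.1, hlt]⟩
      have hmp := hm.prop
      simp only [Finset.mem_filter] at hmp
      refine Finset.mem_insert_of_mem (Finset.mem_biUnion.2 ⟨m, (hMmem m).2
        ⟨hmp.1, hmp.2.1, fun m' hm' hxm' hle => ?_⟩, by simp [hz.1, hmp.2.2]⟩)
      exact hm.eq_of_le (by simp [hm', hxm', hle.trans hmp.2.2]) hle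
  have hcard : n + M.card ≤ 1 + 2 * ∑ m ∈ M, φ m := by
    have h1 := (Finset.card_le_card hcover).trans (Finset.card_insert_le _ _)
    have h2 := Finset.card_biUnion_le (s := M) (t := fun m => S.filter (m ≤ ·))
    have h3 := Finset.sum_le_sum hbelow
    rw [Finset.sum_add_distrib, ← Finset.mul_sum] at h3
    simp only [Finset.sum_const, smul_eq_mul, mul_one] at h3
    omega
  have hsum : ∑ m ∈ M, φ m ≤ φ x := by
    refine (Nat.le_div_iff_mul_le htpos).2 ?_
    rw [Finset.sum_mul]
    refine (Finset.sum_le_sum fun m _ => Nat.div_mul_le_self _ t).trans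
      (sum_subtreeWeight_le (fun m hm => ((hMmem m).1 hm).2.1.le) fun m hm m' hm' z h h' => ?_)
    rw [hMmem] at hm hm'
    rcases ht m m' z h h' with h | h
    · exact hm'.2.2 m hm.1 hm.2.1 h
    · exact (hm.2.2 m' hm'.1 hm'.2.1 h).symm
  have hx' := mem_separator.1 hx
  change n + 1 ≤ 2 * φ x
  have hx1 : 1 ≤ φ x := hx'.2.1
  rcases Nat.lt_or_ge 1 M.card with h | h
  · omega
  · have : Nonempty V := ⟨x⟩
    rcases Finset.card_le_one_iff_subset_singleton.1 h |>.imp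
      fun _ h => Finset.subset_singleton_iff.1 h with ⟨m, hm | hm⟩
    · rw [hm] at hcard
      simp only [Finset.card_empty, Finset.sum_empty] at hcard
      omega
    · have hmM := (hMmem m).1 (by simp [hm])
      have : φ m < φ x := hx'.2.2 m (separator_subset hmM.1) hmM.2.1
      rw [hm] at hcard
      simp only [Finset.card_singleton, Finset.sum_singleton] at hcard
      omega

theorem card_separator_le (ht : IsForestOrder V) {X : Finset V} (hX : InfClosedOn X)
    (wt : V → ℕ) {t : ℕ} (htpos : 0 < t) :
    (separator X wt t).card ≤ 2 * ((∑ x ∈ X, wt x) / t) - 1 := by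
  rcases (separator X wt t).eq_empty_or_nonempty with h | h
  · simp [h]
  · obtain ⟨m, hm⟩ := (separator X wt t).exists_minimal h
    have hmin : ∀ v ∈ separator X wt t, m ≤ v := fun v hv =>
      (hm.le_of_le (infClosedOn_separator ht hX wt htpos m hm.prop v hv) inf_le_left).trans
        inf_le_right
    have h1 := card_separator_filter_lt ht htpos _ m hm.prop rfl
    rw [Finset.filter_true_of_mem hmin] at h1
    have h2 : subtreeWeight X wt m / t ≤ (∑ x ∈ X, wt x) / t :=
      Nat.div_le_div_right (Finset.sum_le_sum_of_subset (Finset.filter_subset _ _))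
    omega

end Separator

section Shortcut

open Classical

variable [SemilatticeInf V]

/-- Some graph on `X` with at most `e` edges joins any two vertices of `X` by a monotone path with
at most `h` edges. -/
def HasShortcut (X : Finset V) (h e : ℕ) : Prop :=
  ∃ G : Finset (Sym2 V), (∀ f ∈ G, ∀ x ∈ f, x ∈ X) ∧ G.card ≤ e ∧
    ∀ u ∈ X, ∀ v ∈ X, MonoPath G h u v

theorem HasShortcut.mono {X : Finset V} {h e h' e' : ℕ} (H : HasShortcut X h e) (hh : h ≤ h')
    (he : e ≤ e') : HasShortcut X h' e' := by
  obtain ⟨G, h1, h2, h3⟩ := H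
  exact ⟨G, h1, h2.trans he, fun u hu v hv => (h3 u hu v hv).mono_hops hh⟩

theorem hasShortcut_complete (X : Finset V) : HasShortcut X 1 (X.card * X.card) := by
  refine ⟨(X ×ˢ X).image fun p => s(p.1, p.2), ?_, ?_, fun u hu v hv => .single ?_⟩
  · intro f hf x hx
    obtain ⟨p, hp, rfl⟩ := Finset.mem_image.1 hf
    rw [Finset.mem_product] at hp
    rcases Sym2.mem_iff.1 hx with rfl | rfl
    exacts [hp.1, hp.2]
  · exact Finset.card_image_le.trans_eq (Finset.card_product X X)
  · exact Finset.mem_image.2 ⟨(u, v), Finset.mem_product.2 ⟨hu, hv⟩, rfl⟩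

theorem hasShortcut_tree (ht : IsForestOrder V) (n : ℕ) : ∀ X : Finset V, InfClosedOn X →
    X.card = n → HasShortcut X n n := by
  induction n with
  | zero =>
    intro X _ hn
    rw [Finset.card_eq_zero] at hn
    exact ⟨∅, by simp, by simp, by simp [hn]⟩
  | succ n ih =>
    intro X hX hn
    obtain ⟨x, hx⟩ := X.exists_maximal (Finset.card_pos.1 (by omega))
    have hinf : ∀ a ∈ X.erase x, ∀ b ∈ X, a ⊓ b ∈ X.erase x := by
      intro a ha b hb
      rw [Finset.mem_erase] at ha ⊢
      refine ⟨fun h => ha.1 ?_, hX a ha.2 b hb⟩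
      exact hx.eq_of_ge ha.2 (h ▸ inf_le_left)
    obtain ⟨G, hG, hcard, hpath⟩ := ih (X.erase x)
      (fun a ha b hb => hinf a ha b (Finset.mem_of_mem_erase hb))
      (by rw [Finset.card_erase_of_mem hx.prop, hn, Nat.add_sub_cancel])
    rcases (X.erase x).eq_empty_or_nonempty with hemp | hne
    · refine ⟨∅, by simp, by simp, fun u hu v hv => ?_⟩
      have hall : ∀ z ∈ X, z = x := by
        intro z hz
        by_contra h
        exact Finset.notMem_empty z (hemp ▸ Finset.mem_erase.2 ⟨h, hz⟩)
      rw [hall u hu, hall v hv]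
      exact .nil _ _
    · obtain ⟨y, hy⟩ := ((X.erase x).image (· ⊓ x)).exists_maximal (hne.image _)
      obtain ⟨z, hz, hzy⟩ := Finset.mem_image.1 hy.prop
      have hyX : y ∈ X.erase x := hzy ▸ hinf z hz x hx.prop
      have hyx : y ≤ x := hzy ▸ inf_le_right
      have hbtw : ∀ v ∈ X.erase x, Btw x y v := by
        intro v hv
        refine ⟨?_, Or.inl hyx⟩
        rw [inf_comm]
        rcases ht (v ⊓ x) y x inf_le_right hyx with h | h
        · exact h
        · exact (hy.eq_of_le (Finset.mem_image_of_mem _ hv) h).ge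
      have hxv : ∀ v ∈ X.erase x, MonoPath (insert s(x, y) G) (n + 1) x v := fun v hv =>
        .cons (Finset.mem_insert_self _ _) (hbtw v hv)
          ((hpath y hyX v hv).mono_graph (Finset.subset_insert _ _))
      refine ⟨insert s(x, y) G, ?_, (Finset.card_insert_le _ _).trans (by omega), ?_⟩
      · intro f hf a ha
        rcases Finset.mem_insert.1 hf with rfl | hf
        · rcases Sym2.mem_iff.1 ha with rfl | rfl
          exacts [hx.prop, Finset.mem_of_mem_erase hyX]
        · exact Finset.mem_of_mem_erase (hG f hf a ha)
      · intro u hu v hv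
        by_cases hux : u = x
        · by_cases hvx : v = x
          · rw [hux, hvx]
            exact .nil _ _
          · exact hux ▸ hxv v (Finset.mem_erase.2 ⟨hvx, hv⟩)
        · have hu' := Finset.mem_erase.2 ⟨hux, hu⟩
          by_cases hvx : v = x
          · exact hvx ▸ (hxv u hu').symm ht
          · exact ((hpath u hu' v (Finset.mem_erase.2 ⟨hvx, hv⟩)).mono_graph
              (Finset.subset_insert _ _)).mono_hops (Nat.le_succ n)

theorem HasShortcut.of_separator [Fintype V] (ht : IsForestOrder V) {X S : Finset V}
    (hSX : S ⊆ X) (hS : InfClosedOn S) {h₁ e₁ h₂ e₂ : ℕ} (hsep : HasShortcut S h₁ e₁)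
    (hcell : ∀ C ∈ cells X S, HasShortcut C h₂ (e₂ * C.card)) :
    HasShortcut X (max h₂ (h₁ + 2)) (e₁ + 2 * X.card + e₂ * X.card) := by
  obtain ⟨G, hG, hGcard, hGpath⟩ := hsep
  choose! F hF hFcard hFpath using hcell
  set B := (X \ S).biUnion fun u => (border S u).image fun b => s(u, b) with hB
  have hlink : ∀ u ∈ X, ∀ v s, s ∈ S → Btw u s v →
      ∃ a ∈ S, Btw u a v ∧ MonoPath (G ∪ B ∪ (cells X S).biUnion F) 1 u a := by
    intro u hu v s hs h
    by_cases huS : u ∈ S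
    · exact ⟨u, huS, btw_left u v, .nil _ _⟩
    · obtain ⟨a, ha, hb⟩ := exists_mem_border ht hs h
      refine ⟨a, (mem_border.1 ha).1, hb, .single ?_⟩
      refine Finset.mem_union_left _ (Finset.mem_union_right _ (Finset.mem_biUnion.2 ⟨u, ?_, ?_⟩))
      · simp [hu, huS]
      · exact Finset.mem_image_of_mem _ ha
  refine ⟨G ∪ B ∪ (cells X S).biUnion F, ?_, ?_, ?_⟩
  · intro f hf x hx
    simp only [Finset.mem_union, hB, Finset.mem_biUnion, Finset.mem_image, Finset.mem_sdiff] at hf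
    rcases hf with (hf | ⟨u, hu, b, hb, rfl⟩) | ⟨C, hC, hf⟩
    · exact hSX (hG f hf x hx)
    · rcases Sym2.mem_iff.1 hx with rfl | rfl
      exacts [hu.1, hSX (mem_border.1 hb).1]
    · obtain ⟨u, -, hu⟩ := mem_cells.1 hC
      have hxC := hF C hC f hf x hx
      rw [← hu] at hxC
      exact cell_subset hxC
  · have h1 : B.card ≤ 2 * X.card := by
      refine (Finset.card_biUnion_le_card_mul _ _ 2 fun u _ =>
        Finset.card_image_le.trans (card_border_le ht hS u)).trans ?_
      rw [mul_comm]
      exact Nat.mul_le_mul_left _ (Finset.card_le_card Finset.sdiff_subset)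
    have h2 : ((cells X S).biUnion F).card ≤ e₂ * X.card := by
      refine Finset.card_biUnion_le.trans ((Finset.sum_le_sum hFcard).trans ?_)
      rw [← Finset.mul_sum]
      exact Nat.mul_le_mul_left _ (le_of_add_le_left (sum_card_cells_add ht hSX))
    have h3 := Finset.card_union_le (G ∪ B) ((cells X S).biUnion F)
    have h4 := Finset.card_union_le G B
    omega
  · intro u hu v hv
    by_cases hsame : ∃ s ∈ S, Btw u s v
    · obtain ⟨s, hs, hsb⟩ := hsame
      obtain ⟨a, ha, hab, hua⟩ := hlink u hu v s hs hsb
      obtain ⟨b, hb, hbb, hvb⟩ := hlink v hv a a ha (btw_right v a)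
      have hGab := (hGpath a ha b hb).mono_graph
        (Finset.subset_union_left.trans (Finset.subset_union_left
          (s₁ := G ∪ B) (s₂ := (cells X S).biUnion F)))
      have hav := hGab.append ht hbb.symm (hvb.symm ht)
      exact (hua.append ht hab hav).mono_hops (le_max_of_le_right (by omega))
    · push Not at hsame
      have huS : u ∉ S := fun h => hsame u h (btw_left u v)
      have hvS : v ∉ S := fun h => hsame v h (btw_right u v)
      have hC := cell_mem_cells hu huS
      refine ((hFpath _ hC u (self_mem_cell hu huS) v
        (mem_cell.2 ⟨⟨hv, hvS⟩, hsame⟩)).mono_graph ?_).mono_hops (le_max_left _ _)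
      exact (Finset.subset_biUnion_of_mem F hC).trans Finset.subset_union_right

theorem HasShortcut.divide [Fintype V] (ht : IsForestOrder V) {X : Finset V} (hX : InfClosedOn X)
    {t : ℕ} (htpos : 0 < t) {h₁ e₁ h₂ e₂ : ℕ}
    (hsep : ∀ S : Finset V, InfClosedOn S → S ⊆ X → S.card * t ≤ 2 * X.card → HasShortcut S h₁ e₁)
    (hcell : ∀ C : Finset V, InfClosedOn C → C.card < t → HasShortcut C h₂ (e₂ * C.card)) :
    HasShortcut X (max h₂ (h₁ + 2)) (e₁ + 2 * X.card + e₂ * X.card) := by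
  have hS := infClosedOn_separator ht hX (fun _ => 1) htpos
  refine HasShortcut.of_separator ht separator_subset hS (hsep _ hS separator_subset ?_) ?_
  · have h1 := card_separator_le ht hX (fun _ => 1) htpos
    simp only [Finset.sum_const, smul_eq_mul, mul_one] at h1
    have h2 := Nat.div_mul_le_self X.card t
    calc _ ≤ 2 * (X.card / t) * t := Nat.mul_le_mul_right _ (h1.trans (Nat.sub_le _ _))
      _ ≤ _ := by rw [mul_assoc]; omega
  · intro C hC
    obtain ⟨u, hu, rfl⟩ := mem_cells.1 hC
    refine hcell _ (infClosedOn_cell ht hX) ?_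
    simpa using sum_cell_separator_lt ht hX (fun _ => 1) htpos hu.1 hu.2

theorem hasShortcut_ack [Fintype V] (ht : IsForestOrder V) (k : ℕ) : ∀ (r : ℕ) (X : Finset V),
    InfClosedOn X → X.card ≤ 8 * ack k r →
    HasShortcut X (2 * k + 1) (64 * (r + 1) * X.card) := by
  induction k with
  | zero =>
    intro r X _ hc
    rw [ack_zero] at hc
    exact (hasShortcut_complete X).mono (by omega) (Nat.mul_le_mul_right _ (by omega))
  | succ k ihk =>
    intro r
    induction r with
    | zero =>
      intro X hX hc
      rw [ack_succ_zero] at hc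
      refine (HasShortcut.divide ht hX (t := 33) (by norm_num) (h₁ := 2 * k + 1) (h₂ := 1)
        (e₁ := 8 * X.card) (e₂ := 32) (fun S hS hSX hSt => ?_) fun C hC hCt => ?_).mono
          (by omega) (by omega)
      · exact (ihk 1 S hS ((Finset.card_le_card hSX).trans hc)).mono le_rfl (by omega)
      · exact (hasShortcut_complete C).mono le_rfl (Nat.mul_le_mul_right _ (by omega))
    | succ r ihr =>
      intro X hX hc
      rw [ack_succ_succ] at hc
      have hβ : 2 ≤ ack (k + 1) r := by
        have := add_lt_ack (k + 1) r
        omega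
      generalize hβ' : ack (k + 1) r = β at hc hβ ihr
      refine (HasShortcut.divide ht hX (t := 8 * β + 1) (by omega) (h₁ := 2 * k + 1)
        (h₂ := 2 * (k + 1) + 1) (e₁ := 24 * X.card) (e₂ := 64 * (r + 1))
        (fun S hS hSX hSt => ?_) fun C hC hCt => ?_).mono (by omega) (by ring_nf; omega)
      · refine (ihk β S hS ((Finset.card_le_card hSX).trans hc)).mono le_rfl ?_
        nlinarith
      · exact ihr C hC (by omega)

/-- Trees with at most `8 * ack k k` vertices have linear-size shortcuts with `O(k)` hops. -/
theorem hasShortcut_linear [Fintype V] (ht : IsForestOrder V) {k : ℕ} {X : Finset V}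
    (hX : InfClosedOn X) (hc : X.card ≤ 8 * ack k k) :
    HasShortcut X (2 * k + 3) (131 * X.card) := by
  refine (HasShortcut.divide ht hX (t := k + 1) (by omega) (h₁ := 2 * k + 1) (h₂ := k)
    (e₁ := 128 * X.card) (e₂ := 1) (fun S hS hSX hSt => ?_) fun C hC hCt => ?_).mono
      (by omega) (by omega)
  · refine (hasShortcut_ack ht k k S hS ((Finset.card_le_card hSX).trans hc)).mono le_rfl ?_
    nlinarith
  · exact (hasShortcut_tree ht _ C hC rfl).mono (by omega) (by omega)

end Shortcut

section BoundedDegree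

open Classical

theorem degree_le_of_subset {G H : Finset (Sym2 V)} {p : V}
    (h : ∀ f ∈ G, p ∈ f → f ∈ H) : degree G p ≤ degree H p := by
  refine Finset.card_le_card fun f hf => ?_
  rw [Finset.mem_filter] at hf ⊢
  exact ⟨h f hf.1 hf.2, hf.2⟩

theorem degree_lt_card {G : Finset (Sym2 V)} {S : Finset V} (hG : ∀ f ∈ G, ¬ f.IsDiag)
    (hGS : ∀ f ∈ G, ∀ x ∈ f, x ∈ S) {p : V} (hp : p ∈ S) : degree G p < S.card := by
  have h1 : degree G p ≤ ((S.erase p).image fun q => s(p, q)).card := by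
    refine Finset.card_le_card fun f hf => ?_
    rw [Finset.mem_filter] at hf
    obtain ⟨q, rfl⟩ := hf.2
    refine Finset.mem_image_of_mem _ (Finset.mem_erase.2 ⟨fun h => ?_, ?_⟩)
    · exact hG _ hf.1 (by simp [h])
    · exact hGS _ hf.1 q (by simp)
  have h2 := Finset.card_erase_lt_of_mem hp
  have h3 := Finset.card_image_le (s := S.erase p) (f := fun q => s(p, q))
  omega

variable [SemilatticeInf V]

/-- The edges of `T` join consecutive vertices of the tree whose ancestor order is the order of
`V`. -/
structure IsTreeOfOrder (T : Finset (Sym2 V)) : Prop where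
  exists_step : ∀ u a : V, u ≠ a → ∃ x, x ≠ a ∧ Btw u x a ∧ s(x, a) ∈ T
  btw_of_adj : ∀ s x y : V, s(x, s) ∈ T → s(y, s) ∈ T → x ≠ y → Btw x s y
  eq_or_eq : ∀ x y z : V, s(x, y) ∈ T → Btw x z y → z = x ∨ z = y

/-- `K` spans a connected subtree. -/
def TreeConvex (K : Finset V) : Prop :=
  ∀ u ∈ K, ∀ v ∈ K, ∀ x, Btw u x v → x ∈ K

theorem TreeConvex.infClosedOn {K : Finset V} (hK : TreeConvex K) : InfClosedOn K :=
  fun a ha b hb => hK a ha b hb _ (btw_inf a b)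

theorem TreeConvex.cell (ht : IsForestOrder V) {K S : Finset V} (hK : TreeConvex K) (w : V) :
    TreeConvex (cell K S w) := by
  intro u hu v hv x hx
  have huv := not_btw_of_mem_cell ht hu hv
  refine mem_cell.2 ⟨⟨hK u (cell_subset hu) v (cell_subset hv) x hx, fun h => huv x h hx⟩,
    fun s hs h => ?_⟩
  rcases h.split ht u with h1 | h1
  · exact (mem_cell.1 hu).2 s hs h1
  · exact huv s hs (h1.trans_left ht hx)

/-- The vertices of `C` that have a neighbour in `S`. -/
noncomputable def portals (T : Finset (Sym2 V)) (S C : Finset V) : Finset V :=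
  C.filter fun x => ∃ s ∈ S, s(x, s) ∈ T

theorem card_portals_le (ht : IsForestOrder V) {T : Finset (Sym2 V)} (hT : IsTreeOfOrder T)
    {K S : Finset V} (hS : InfClosedOn S) (u : V) : (portals T S (cell K S u)).card ≤ 2 := by
  have hex : ∀ x ∈ portals T S (cell K S u), ∃ s ∈ S, s(x, s) ∈ T := fun x hx =>
    (Finset.mem_filter.1 hx).2
  have hcell : ∀ x ∈ portals T S (cell K S u), x ∈ cell K S u := fun x hx =>
    (Finset.mem_filter.1 hx).1
  choose! f hfS hfT using hex
  refine (Finset.card_le_card_of_injOn f (fun x hx => ?_) fun x hx y hy hxy => ?_).trans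
    (card_border_le ht hS u)
  · have hxc := mem_cell.1 (hcell x hx)
    refine mem_border.2 ⟨hfS x hx, fun s hs h => ?_⟩
    rcases h.split ht x with h1 | h1
    · exact absurd h1 (hxc.2 s hs)
    · rcases hT.eq_or_eq x _ s (hfT x hx) h1 with rfl | h2
      · exact absurd hs hxc.1.2
      · exact h2
  · by_contra hne
    refine not_btw_of_mem_cell ht (hcell x hx) (hcell y hy) (f x) (hfS x hx)
      (hT.btw_of_adj _ x y (hfT x hx) ?_ hne)
    rw [hxy]
    exact hfT y hy

/-- Connected sets with fewer than `r ^ d` vertices have bounded-degree shortcuts, in which at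
most two prescribed vertices `P` are reached even faster. -/
theorem exists_boundedDegree_shortcut [Fintype V] (ht : IsForestOrder V) {T : Finset (Sym2 V)}
    (hT : IsTreeOfOrder T) {r h e : ℕ} (hr : 2 ≤ r)
    (hshort : ∀ S : Finset V, InfClosedOn S → S.card ≤ 2 * r + 1 → HasShortcut S h (e * S.card))
    (d : ℕ) : ∀ K P : Finset V, TreeConvex K → P ⊆ K → P.card ≤ 2 → K.card < r ^ d →
      ∃ G : Finset (Sym2 V), (∀ f ∈ G, ¬ f.IsDiag) ∧ (∀ f ∈ G, ∀ x ∈ f, x ∈ K) ∧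
        G.card ≤ (e + 2) * K.card ∧ (∀ p, degree G p ≤ 2 * r) ∧
        (∀ u ∈ K, ∀ p ∈ P, MonoPath (G ∪ T) (2 * d) u p) ∧
        ∀ u ∈ K, ∀ v ∈ K, MonoPath (G ∪ T) (4 * d + h) u v := by
  induction d with
  | zero =>
    intro K P _ _ _ hK
    have hK0 : K = ∅ := by
      rw [← Finset.card_eq_zero]
      simpa using hK
    subst hK0
    exact ⟨∅, by simp, by simp, by simp, by simp [degree], by simp, by simp⟩
  | succ d ih =>
    intro K P hK hPK hP hcard
    set t := K.card / r + 1 with htdef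
    have htpos : 0 < t := Nat.succ_pos _
    set wt : V → ℕ := fun x => 1 + if x ∈ P then t else 0 with hwt
    set S := separator K wt t with hSdef
    have hSK : S ⊆ K := separator_subset
    have hS : InfClosedOn S := infClosedOn_separator ht hK.infClosedOn wt htpos
    have hPS : P ⊆ S := fun x hx =>
      mem_separator_of_le_weight htpos (hPK hx) (by simp [hwt, hx])
    have hScard : S.card ≤ 2 * r + 1 := by
      have h1 := card_separator_le ht hK.infClosedOn wt htpos
      have h2 : ∑ x ∈ K, wt x ≤ K.card + t * 2 := by
        simp only [hwt, Finset.sum_add_distrib, Finset.sum_const, smul_eq_mul, mul_one,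
          ← Finset.sum_filter]
        have h3 : (K.filter (· ∈ P)).card ≤ 2 :=
          (Finset.card_le_card fun x hx => (Finset.mem_filter.1 hx).2).trans hP
        have := Nat.mul_le_mul_right t h3
        omega
      have h3 : (∑ x ∈ K, wt x) / t ≤ K.card / t + 2 :=
        (Nat.div_le_div_right h2).trans_eq (Nat.add_mul_div_left _ _ htpos)
      have h4 : K.card / t < r := by
        rw [Nat.div_lt_iff_lt_mul htpos, htdef]
        exact Nat.lt_mul_div_succ _ (by omega)
      change S.card ≤ _ at h1
      omega
    obtain ⟨H, hHS, hHcard, hHpath⟩ := hshort S hS hScard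
    have hrec : ∀ C ∈ cells K S, ∃ G : Finset (Sym2 V), (∀ f ∈ G, ¬ f.IsDiag) ∧
        (∀ f ∈ G, ∀ x ∈ f, x ∈ C) ∧ G.card ≤ (e + 2) * C.card ∧ (∀ p, degree G p ≤ 2 * r) ∧
        (∀ u ∈ C, ∀ p ∈ portals T S C, MonoPath (G ∪ T) (2 * d) u p) ∧
        ∀ u ∈ C, ∀ v ∈ C, MonoPath (G ∪ T) (4 * d + h) u v := by
      intro C hC
      obtain ⟨u, hu, rfl⟩ := mem_cells.1 hC
      refine ih _ _ (hK.cell ht u) (Finset.filter_subset _ _) (card_portals_le ht hT hS u) ?_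
      have h1 := sum_cell_separator_lt ht hK.infClosedOn wt htpos hu.1 hu.2
      have h2 : (cell K S u).card ≤ ∑ v ∈ cell K S u, wt v := by
        rw [Finset.card_eq_sum_ones]
        exact Finset.sum_le_sum fun v _ => Nat.le_add_right _ _
      have h3 : K.card / r < r ^ d := by
        rw [Nat.div_lt_iff_lt_mul (by omega)]
        rwa [pow_succ] at hcard
      change ∑ v ∈ cell K S u, wt v < t at h1
      omega
    choose! F hFdiag hFC hFcard hFdeg hFportal hFpath using hrec
    set star := (P ×ˢ S).image fun p => s(p.1, p.2) with hstar
    set G₁ := (H ∪ star).filter fun f => ¬ f.IsDiag with hG₁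
    have hG₁S : ∀ f ∈ G₁, ∀ x ∈ f, x ∈ S := by
      intro f hf x hx
      rcases Finset.mem_union.1 (Finset.mem_filter.1 hf).1 with hf | hf
      · exact hHS f hf x hx
      · obtain ⟨p, hp, rfl⟩ := Finset.mem_image.1 hf
        rw [Finset.mem_product] at hp
        rcases Sym2.mem_iff.1 hx with rfl | rfl
        exacts [hPS hp.1, hp.2]
    have hG₁diag : ∀ f ∈ G₁, ¬ f.IsDiag := fun f hf => (Finset.mem_filter.1 hf).2
    have hG₁sub : G₁ ⊆ G₁ ∪ (cells K S).biUnion F ∪ T :=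
      Finset.subset_union_left.trans Finset.subset_union_left
    have hFsub : ∀ C ∈ cells K S, F C ∪ T ⊆ G₁ ∪ (cells K S).biUnion F ∪ T := fun C hC =>
      Finset.union_subset_union_left
        ((Finset.subset_biUnion_of_mem F hC).trans Finset.subset_union_right)
    have hCS : ∀ C ∈ cells K S, ∀ x ∈ C, x ∈ K ∧ x ∉ S := by
      intro C hC x hx
      rw [eq_cell_of_mem_cells ht hC hx] at hx
      exact (mem_cell.1 hx).1
    have hHfast : ∀ a ∈ S, ∀ b ∈ S, MonoPath (G₁ ∪ (cells K S).biUnion F ∪ T) h a b :=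
      fun a ha b hb => (((hHpath a ha b hb).mono_graph
        Finset.subset_union_left).filter_not_isDiag).mono_graph hG₁sub
    have hstarfast : ∀ a ∈ S, ∀ p ∈ P, MonoPath (G₁ ∪ (cells K S).biUnion F ∪ T) 1 a p := by
      intro a ha p hp
      have hmem : s(a, p) ∈ H ∪ star := Finset.mem_union_right _
        (Finset.mem_image.2 ⟨(p, a), Finset.mem_product.2 ⟨hp, ha⟩, Sym2.eq_swap⟩)
      exact ((MonoPath.single hmem).filter_not_isDiag).mono_graph hG₁sub
    have hlink : ∀ u ∈ K, ∀ v s, s ∈ S → Btw u s v → ∃ a ∈ S, Btw u a v ∧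
        MonoPath (G₁ ∪ (cells K S).biUnion F ∪ T) (2 * d + 1) u a := by
      intro u hu v s hs hsb
      by_cases huS : u ∈ S
      · exact ⟨u, huS, btw_left u v, .nil _ _⟩
      obtain ⟨a, ha, hav⟩ := exists_mem_border ht hs hsb
      rw [mem_border] at ha
      obtain ⟨x, hxa, hux, hxT⟩ := hT.exists_step u a fun h => huS (h ▸ ha.1)
      have hxS : x ∉ S := fun h => hxa (ha.2 x h hux)
      have hxc : x ∈ cell K S u := by
        refine mem_cell.2 ⟨⟨hK u hu a (hSK ha.1) x hux, hxS⟩, fun s' hs' hb => ?_⟩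
        obtain rfl := ha.2 s' hs' (hb.trans_left ht hux)
        exact hxa (hux.antisymm hb)
      have hC := cell_mem_cells hu huS
      refine ⟨a, ha.1, hav, ?_⟩
      exact ((hFportal _ hC u (self_mem_cell hu huS) x
        (Finset.mem_filter.2 ⟨hxc, a, ha.1, hxT⟩)).mono_graph (hFsub _ hC)).append ht hux
          (.single (Finset.mem_union_right _ hxT))
    refine ⟨G₁ ∪ (cells K S).biUnion F, ?_, ?_, ?_, ?_, ?_, ?_⟩
    · intro f hf
      rcases Finset.mem_union.1 hf with hf | hf
      · exact hG₁diag f hf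
      · obtain ⟨C, hC, hf⟩ := Finset.mem_biUnion.1 hf
        exact hFdiag C hC f hf
    · intro f hf x hx
      rcases Finset.mem_union.1 hf with hf | hf
      · exact hSK (hG₁S f hf x hx)
      · obtain ⟨C, hC, hf⟩ := Finset.mem_biUnion.1 hf
        exact (hCS C hC x (hFC C hC f hf x hx)).1
    · have h1 : G₁.card ≤ H.card + star.card :=
        (Finset.card_filter_le _ _).trans (Finset.card_union_le _ _)
      have h2 : star.card ≤ 2 * S.card :=
        Finset.card_image_le.trans ((Finset.card_product P S).trans_le
          (Nat.mul_le_mul_right _ hP))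
      have h3 : ((cells K S).biUnion F).card ≤ (e + 2) * ∑ C ∈ cells K S, C.card := by
        rw [Finset.mul_sum]
        exact Finset.card_biUnion_le.trans (Finset.sum_le_sum hFcard)
      have h4 := Nat.mul_le_mul_left (e + 2) (sum_card_cells_add ht hSK)
      have h5 := Finset.card_union_le G₁ ((cells K S).biUnion F)
      rw [mul_add, add_mul e 2 S.card] at h4
      omega
    · intro p
      by_cases hpS : p ∈ S
      · have h1 : degree (G₁ ∪ (cells K S).biUnion F) p ≤ degree G₁ p := by
          refine degree_le_of_subset fun f hf hp => ?_
          rcases Finset.mem_union.1 hf with hf | hf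
          · exact hf
          · obtain ⟨C, hC, hf⟩ := Finset.mem_biUnion.1 hf
            exact absurd hpS (hCS C hC p (hFC C hC f hf p hp)).2
        have h2 := degree_lt_card hG₁diag hG₁S hpS
        omega
      · have h1 : ∀ f ∈ G₁ ∪ (cells K S).biUnion F, p ∈ f → p ∈ K ∧ f ∈ F (cell K S p) := by
          intro f hf hp
          rcases Finset.mem_union.1 hf with hf | hf
          · exact absurd (hG₁S f hf p hp) hpS
          · obtain ⟨C, hC, hf⟩ := Finset.mem_biUnion.1 hf
            have hpC := hFC C hC f hf p hp
            exact ⟨(hCS C hC p hpC).1, eq_cell_of_mem_cells ht hC hpC ▸ hf⟩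
        by_cases hpK : p ∈ K
        · exact (degree_le_of_subset fun f hf hp => (h1 f hf hp).2).trans
            (hFdeg _ (cell_mem_cells hpK hpS) p)
        · refine (degree_le_of_subset (H := ∅)
            fun f hf hp => absurd (h1 f hf hp).1 hpK).trans ?_
          simp [degree]
    · intro u hu p hp
      obtain ⟨a, ha, hb, hua⟩ := hlink u hu p p (hPS hp) (btw_right u p)
      exact (hua.append ht hb (hstarfast a ha p hp)).mono_hops (by omega)
    · intro u hu v hv
      by_cases hsame : ∃ s ∈ S, Btw u s v
      · obtain ⟨s, hs, hsb⟩ := hsame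
        obtain ⟨a, ha, hab, hua⟩ := hlink u hu v s hs hsb
        obtain ⟨b, hb, hbb, hvb⟩ := hlink v hv a a ha (btw_right v a)
        exact (hua.append ht hab ((hHfast a ha b hb).append ht hbb.symm (hvb.symm ht))).mono_hops
          (by omega)
      · push Not at hsame
        have huS : u ∉ S := fun h => hsame u h (btw_left u v)
        have hvS : v ∉ S := fun h => hsame v h (btw_right u v)
        have hC := cell_mem_cells hu huS
        exact ((hFpath _ hC u (self_mem_cell hu huS) v
          (mem_cell.2 ⟨⟨hv, hvS⟩, hsame⟩)).mono_graph (hFsub _ hC)).mono_hops (by omega)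

end BoundedDegree

section TreeOrder

/-- `G` contains a walk with `k` edges from `u` to `v` whose steps have total length `c`. -/
inductive WeightedWalk (G : Finset (Sym2 V)) (f : V → V → ℝ) : ℕ → V → V → ℝ → Prop
  | nil (u : V) : WeightedWalk G f 0 u u 0
  | cons {k : ℕ} {u a v : V} {c : ℝ} : s(u, a) ∈ G → WeightedWalk G f k a v c →
      WeightedWalk G f (k + 1) u v (f u a + c)

theorem weightedWalk_iff {G : Finset (Sym2 V)} {f : V → V → ℝ} {k : ℕ} {u v : V} {c : ℝ} :
    WeightedWalk G f k u v c ↔ ∃ x : Fin (k + 1) → V, x 0 = u ∧ x (Fin.last k) = v ∧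
      (∀ i : Fin k, s(x i.castSucc, x i.succ) ∈ G) ∧
      ∑ i : Fin k, f (x i.castSucc) (x i.succ) = c := by
  constructor
  · intro h
    induction h with
    | nil u => exact ⟨fun _ => u, rfl, rfl, fun i => i.elim0, by simp⟩
    | @cons k u a v c he _ ih =>
      obtain ⟨x, hx0, hxl, hxe, hxc⟩ := ih
      refine ⟨Fin.cons u x, rfl, ?_, ?_, ?_⟩
      · rw [← Fin.succ_last, Fin.cons_succ, hxl]
      · intro i
        refine Fin.cases ?_ (fun j => ?_) i
        · simpa [hx0] using he
        · simpa [← Fin.succ_castSucc] using hxe j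
      · rw [Fin.sum_univ_succ, ← hxc]
        simp [hx0]
  · rintro ⟨x, rfl, rfl, hxe, rfl⟩
    induction k with
    | zero => simpa using WeightedWalk.nil (G := G) (f := f) (x 0)
    | succ k ih =>
      rw [Fin.sum_univ_succ]
      have h := ih (fun i => x i.succ) fun i => by simpa using hxe i.succ
      exact .cons (by simpa using hxe 0) (by simpa [← Fin.succ_castSucc] using h)

/-- The order in which `par` maps every vertex to its parent, `dep` being the depth. -/
@[reducible]
noncomputable def parentSemilattice (par : V → V) (dep : V → ℕ) (root : V)
    (hdep : ∀ x, dep (par x) = dep x - 1) (hroot : ∀ x, dep x = 0 ↔ x = root) :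
    SemilatticeInf V :=
  have hiter : ∀ k x, dep (par^[k] x) = dep x - k := by
    intro k
    induction k with
    | zero => intro x; rfl
    | succ k ih =>
      intro x
      rw [Function.iterate_succ_apply, ih, hdep]
      omega
  have hex : ∀ a b, ∃ k l, par^[l] b = par^[k] a := by
    intro a b
    refine ⟨dep a, dep b, ?_⟩
    rw [(hroot (par^[dep b] b)).1 (by rw [hiter, Nat.sub_self]),
      (hroot (par^[dep a] a)).1 (by rw [hiter, Nat.sub_self])]
  { le := fun x y => ∃ k, par^[k] y = x
    le_refl := fun x => ⟨0, rfl⟩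
    le_trans := by
      rintro x y z ⟨k, rfl⟩ ⟨l, rfl⟩
      exact ⟨k + l, Function.iterate_add_apply par k l z⟩
    le_antisymm := by
      rintro x y ⟨k, rfl⟩ ⟨l, hl⟩
      have h1 := hiter k y
      have h2 := hiter l (par^[k] y)
      rw [hl] at h2
      rcases Nat.eq_zero_or_pos (dep y) with h | h
      · rw [(hroot y).1 h]
        exact (hroot _).1 (by rw [hiter, ← (hroot y).1 h, h, Nat.zero_sub])
      · obtain rfl : k = 0 := by omega
        rfl
    inf := fun a b => par^[sInf {k | ∃ l, par^[l] b = par^[k] a}] a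
    inf_le_left := fun a b => ⟨_, rfl⟩
    inf_le_right := fun a b => Nat.sInf_mem (s := {k | ∃ l, par^[l] b = par^[k] a}) (hex a b)
    le_inf := by
      rintro c a b ⟨k, rfl⟩ hb
      have hle : sInf {k | ∃ l, par^[l] b = par^[k] a} ≤ k := Nat.sInf_le hb
      refine ⟨k - sInf {k | ∃ l, par^[l] b = par^[k] a}, ?_⟩
      rw [← Function.iterate_add_apply, Nat.sub_add_cancel hle] }

theorem exists_depth {T : Finset (Sym2 V)} (hconn : IsConnectedOn T) (root : V) :
    ∃ (par : V → V) (dep : V → ℕ), (∀ x, dep (par x) = dep x - 1) ∧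
      (∀ x, dep x = 0 ↔ x = root) ∧ ∀ x, x ≠ root → s(x, par x) ∈ T := by
  classical
  set W : V → Set ℕ := fun x => {k | ∃ c, WeightedWalk T (fun _ _ => 0) k x root c} with hW
  have hne : ∀ x, (W x).Nonempty := by
    intro x
    obtain ⟨k, y, h0, hl, he⟩ := hconn x root
    exact ⟨k, _, weightedWalk_iff.2 ⟨y, h0, hl, he, rfl⟩⟩
  set dep : V → ℕ := fun x => sInf (W x) with hdep
  have hmem : ∀ x, dep x ∈ W x := fun x => Nat.sInf_mem (hne x)
  have hzero : ∀ x, dep x = 0 ↔ x = root := by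
    intro x
    constructor
    · intro h
      have h1 := hmem x
      rw [h] at h1
      obtain ⟨c, hc⟩ := h1
      cases hc
      rfl
    · rintro rfl
      exact Nat.le_zero.1 (Nat.sInf_le ⟨0, .nil x⟩)
  have hstep : ∀ x, ∃ y, dep y = dep x - 1 ∧ (x ≠ root → s(x, y) ∈ T) := by
    intro x
    by_cases hx : x = root
    · refine ⟨x, ?_, fun h => absurd hx h⟩
      rw [(hzero x).2 hx]
    · obtain ⟨c, hc⟩ := hmem x
      generalize hk : dep x = k at hc
      cases hc with
      | nil => exact absurd rfl hx
      | @cons k _ a _ c he h =>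
        refine ⟨a, ?_, fun _ => he⟩
        have h1 : dep a ≤ k := Nat.sInf_le ⟨c, h⟩
        obtain ⟨c', hc'⟩ := hmem a
        have h2 : dep x ≤ dep a + 1 := Nat.sInf_le ⟨_, .cons he hc'⟩
        omega
  choose par hpar hparT using hstep
  exact ⟨par, dep, hpar, hzero, hparT⟩

/-- `q` is the parent of `x`. -/
def IsParent [SemilatticeInf V] (q x : V) : Prop :=
  q ≤ x ∧ q ≠ x ∧ ∀ z, z ≤ x → z = x ∨ z ≤ q

theorem IsTreeOfOrder.of_isParent [SemilatticeInf V] [Fintype V] {T : Finset (Sym2 V)} {root : V}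
    (hroot : ∀ x, root ≤ x) (hpar : ∀ x, x ≠ root → ∃ q, IsParent q x ∧ s(x, q) ∈ T)
    (hT : ∀ x y, s(x, y) ∈ T → IsParent x y ∨ IsParent y x) : IsTreeOfOrder T := by
  classical
  have hbtw : ∀ x y z : V, IsParent x y → Btw x z y → z = x ∨ z = y := by
    rintro x y z ⟨hxy, -, hz⟩ ⟨h1, h2⟩
    rw [inf_eq_left.2 hxy] at h1
    rcases hz z (h2.elim (fun h => h.trans hxy) id) with h | h
    · exact Or.inr h
    · exact Or.inl (le_antisymm h h1)
  refine ⟨fun u a hne => ?_, fun s x y hx hy hne => ?_, fun x y z hxy hb => ?_⟩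
  · by_cases hau : a ≤ u
    · obtain ⟨x, hx⟩ := (Finset.univ.filter fun x => a < x ∧ x ≤ u).exists_minimal
        ⟨u, by simpa using lt_of_le_of_ne hau hne.symm⟩
      have hxp := hx.prop
      simp only [Finset.mem_filter, Finset.mem_univ, true_and] at hxp
      obtain ⟨q, hq, hqT⟩ := hpar x fun h => (h ▸ hxp.1).not_ge (hroot a)
      refine ⟨x, hxp.1.ne', ⟨?_, Or.inl hxp.2⟩, ?_⟩
      · exact inf_le_right.trans hxp.1.le
      · have haq : a ≤ q := (hq.2.2 a hxp.1.le).resolve_left hxp.1.ne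
        rcases haq.eq_or_lt with rfl | hlt
        · exact hqT
        · refine absurd (hx.eq_of_le ?_ hq.1) hq.2.1
          simpa using ⟨hlt, hq.1.trans hxp.2⟩
    · obtain ⟨q, hq, hqT⟩ := hpar a fun h => hau (h ▸ hroot u)
      refine ⟨q, hq.2.1, ⟨?_, Or.inr hq.1⟩, Sym2.eq_swap ▸ hqT⟩
      exact (hq.2.2 _ inf_le_right).resolve_left fun h => hau (inf_eq_right.1 h)
  · rcases hT _ _ hx with hx | hx <;> rcases hT _ _ hy with hy | hy
    · refine absurd (le_antisymm ?_ ?_) hne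
      · exact (hy.2.2 x hx.1).resolve_left hx.2.1
      · exact (hx.2.2 y hy.1).resolve_left hy.2.1
    · exact btw_of_le hx.1 hy.1
    · exact (btw_of_le hy.1 hx.1).symm
    · refine ⟨(hx.2.2 _ inf_le_left).resolve_left fun h => ?_, Or.inl hx.1⟩
      have hxs := (hy.2.2 x (inf_eq_left.1 h)).resolve_left hne
      exact hx.2.1 (le_antisymm hx.1 hxs)
  · rcases hT _ _ hxy with h | h
    · exact hbtw x y z h hb
    · exact (hbtw y x z h hb.symm).symm

/-- A connected graph with `n - 1` edges is the tree of some rooted ancestor order. -/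
theorem exists_treeOrder [Fintype V] {T : Finset (Sym2 V)} (hconn : IsConnectedOn T)
    (hcard : T.card = Fintype.card V - 1) (root : V) :
    ∃ _ : SemilatticeInf V, IsForestOrder V ∧ IsTreeOfOrder T := by
  classical
  obtain ⟨par, dep, hdep, hroot, hparT⟩ := exists_depth hconn root
  have hpos : ∀ x, x ≠ root → 0 < dep x := fun x hx =>
    Nat.pos_of_ne_zero fun h => hx ((hroot x).1 h)
  have hTeq : (Finset.univ.erase root).image (fun x => s(x, par x)) = T := by
    refine Finset.eq_of_subset_of_card_le (fun f hf => ?_) ?_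
    · obtain ⟨x, hx, rfl⟩ := Finset.mem_image.1 hf
      exact hparT x (Finset.ne_of_mem_erase hx)
    · rw [Finset.card_image_of_injOn, Finset.card_erase_of_mem (Finset.mem_univ _),
        Finset.card_univ, hcard]
      intro x hx y hy hxy
      rcases Sym2.eq_iff.1 hxy with h | h
      · exact h.1
      · have h1 := hpos x (Finset.ne_of_mem_erase hx)
        have h2 := hdep x
        have h3 := hdep y
        rw [h.2] at h2
        rw [← h.1] at h3
        omega
  let _ := parentSemilattice par dep root hdep hroot
  have hforest : IsForestOrder V := by
    rintro a b c ⟨i, rfl⟩ ⟨j, rfl⟩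
    rcases le_total i j with h | h
    · refine Or.inr ⟨j - i, ?_⟩
      rw [← Function.iterate_add_apply, Nat.sub_add_cancel h]
    · refine Or.inl ⟨i - j, ?_⟩
      rw [← Function.iterate_add_apply, Nat.sub_add_cancel h]
  have hparent : ∀ x, x ≠ root → IsParent (par x) x := by
    intro x hx
    refine ⟨⟨1, rfl⟩, fun h => ?_, ?_⟩
    · have h1 := hdep x
      rw [h] at h1
      have := hpos x hx
      omega
    · rintro z ⟨k, rfl⟩
      cases k with
      | zero => exact Or.inl rfl
      | succ k => exact Or.inr ⟨k, rfl⟩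
  have hbot : ∀ n x, dep x = n → root ≤ x := by
    intro n
    induction n with
    | zero => exact fun x hx => ((hroot x).1 hx).ge
    | succ n ih =>
      intro x hx
      exact (ih (par x) (by rw [hdep, hx, Nat.add_sub_cancel])).trans ⟨1, rfl⟩
  refine ⟨inferInstance, hforest, IsTreeOfOrder.of_isParent (fun x => hbot _ x rfl)
    (fun x hx => ⟨par x, hparent x hx, hparT x hx⟩) fun x y hxy => ?_⟩
  rw [← hTeq] at hxy
  obtain ⟨z, hz, hzxy⟩ := Finset.mem_image.1 hxy
  have hz' := hparent z (Finset.ne_of_mem_erase hz)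
  rcases Sym2.eq_iff.1 hzxy with ⟨rfl, rfl⟩ | ⟨rfl, rfl⟩
  exacts [Or.inr hz', Or.inl hz']

end TreeOrder

section Distance

theorem treeDist_eq (T : Finset (Sym2 V)) (w : Sym2 V → ℝ) (u v : V) :
    treeDist T w u v = sInf {c | ∃ k, WeightedWalk T (fun a b => w s(a, b)) k u v c} := by
  simp only [treeDist, weightedWalk_iff]

theorem WeightedWalk.nonneg {T : Finset (Sym2 V)} {w : Sym2 V → ℝ} (hw : ∀ e ∈ T, 0 < w e) {k : ℕ}
    {u v : V} {c : ℝ} (h : WeightedWalk T (fun a b => w s(a, b)) k u v c) : 0 ≤ c := by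
  induction h with
  | nil u => exact le_rfl
  | cons he _ ih => exact add_nonneg (hw _ he).le ih

theorem treeDist_nonneg {T : Finset (Sym2 V)} {w : Sym2 V → ℝ} (hw : ∀ e ∈ T, 0 < w e) (u v : V) :
    0 ≤ treeDist T w u v := by
  rw [treeDist_eq]
  exact Real.sInf_nonneg fun c ⟨_, hc⟩ => hc.nonneg hw

variable [SemilatticeInf V]

theorem WeightedWalk.exists_split (ht : IsForestOrder V) {T : Finset (Sym2 V)}
    (hT : IsTreeOfOrder T) {f : V → V → ℝ} {k : ℕ} {u v : V} {c : ℝ}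
    (h : WeightedWalk T f k u v c) {x : V} (hx : Btw u x v) :
    ∃ k₁ c₁ k₂ c₂, WeightedWalk T f k₁ u x c₁ ∧ WeightedWalk T f k₂ x v c₂ ∧ c₁ + c₂ = c := by
  induction h with
  | nil u =>
    obtain rfl := hx.eq_of_self
    exact ⟨0, 0, 0, 0, .nil x, .nil x, add_zero 0⟩
  | @cons k u a v c he h ih =>
    by_cases hxu : x = u
    · subst hxu
      exact ⟨0, 0, k + 1, _, .nil x, .cons he h, zero_add _⟩
    · have hxa : Btw a x v := by
        rcases hx.split ht a with h1 | h1
        · obtain rfl := (hT.eq_or_eq u a x he h1).resolve_left hxu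
          exact btw_left x v
        · exact h1
      obtain ⟨k₁, c₁, k₂, c₂, h1, h2, rfl⟩ := ih hxa
      exact ⟨k₁ + 1, _, k₂, c₂, .cons he h1, h2, add_assoc _ _ _⟩

theorem treeDist_add_le (ht : IsForestOrder V) {T : Finset (Sym2 V)} (hT : IsTreeOfOrder T)
    (hconn : IsConnectedOn T) {w : Sym2 V → ℝ} (hw : ∀ e ∈ T, 0 < w e) {u x v : V}
    (hx : Btw u x v) : treeDist T w u x + treeDist T w x v ≤ treeDist T w u v := by
  have hle : ∀ {a b c k}, WeightedWalk T (fun a b => w s(a, b)) k a b c →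
      treeDist T w a b ≤ c := fun {a b c k} h => by
    rw [treeDist_eq]
    exact csInf_le ⟨0, fun c ⟨_, hc⟩ => hc.nonneg hw⟩ ⟨k, h⟩
  rw [treeDist_eq T w u v]
  refine le_csInf ?_ ?_
  · obtain ⟨k, y, h0, hl, he⟩ := hconn u v
    exact ⟨_, k, weightedWalk_iff.2 ⟨y, h0, hl, he, rfl⟩⟩
  · rintro c ⟨k, h⟩
    obtain ⟨k₁, c₁, k₂, c₂, h1, h2, rfl⟩ := h.exists_split ht hT hx
    exact add_le_add (hle h1) (hle h2)

theorem MonoPath.exists_spannerPath (ht : IsForestOrder V) {T : Finset (Sym2 V)}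
    (hT : IsTreeOfOrder T) (hconn : IsConnectedOn T) {w : Sym2 V → ℝ} (hw : ∀ e ∈ T, 0 < w e)
    {G : Finset (Sym2 V)} {k : ℕ} {u v : V} (h : MonoPath G k u v) :
    ∃ l ≤ k, IsSpannerPathD (treeDist T w) G 1 u v l := by
  have key : ∃ l ≤ k, ∃ c ≤ treeDist T w u v, WeightedWalk G (treeDist T w) l u v c := by
    induction h with
    | nil k u => exact ⟨0, Nat.zero_le _, 0, treeDist_nonneg hw u u, .nil u⟩
    | cons he hb _ ih =>
      obtain ⟨l, hl, c, hc, hwalk⟩ := ih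
      refine ⟨l + 1, Nat.succ_le_succ hl, _, ?_, .cons he hwalk⟩
      have := treeDist_add_le ht hT hconn hw hb
      linarith
  obtain ⟨l, hl, c, hc, hwalk⟩ := key
  obtain ⟨x, h0, hlast, he, hsum⟩ := weightedWalk_iff.1 hwalk
  exact ⟨l, hl, x, h0, hlast, he, by rw [hsum, one_mul]; exact hc⟩

end Distance

section Parameters

theorem invAck_spec (x : ℝ) : 1 ≤ invAck x ∧ x ≤ ack (invAck x) (invAck x) := by
  refine Nat.sInf_mem (s := {k : ℕ | 1 ≤ k ∧ x ≤ ack k k}) ⟨⌈x⌉₊ + 1, by omega, ?_⟩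
  have h1 : ⌈x⌉₊ ≤ ack (⌈x⌉₊ + 1) (⌈x⌉₊ + 1) :=
    ((Nat.le_succ _).trans (lt_ack_left _ _).le)
  exact (Nat.le_ceil x).trans (by exact_mod_cast h1)

theorem natLog_floor_le {ρ : ℝ} (hρ : 2 ≤ ρ) {n : ℕ} (hn : n ≠ 0) :
    (Nat.log ⌊ρ⌋₊ n : ℝ) ≤ 2 * Real.logb ρ n := by
  have hr : 2 ≤ ⌊ρ⌋₊ := Nat.le_floor (by exact_mod_cast hρ)
  have hr' : (2 : ℝ) ≤ ⌊ρ⌋₊ := by exact_mod_cast hr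
  have hρr : ρ ≤ (⌊ρ⌋₊ : ℝ) ^ 2 := by
    have := Nat.lt_floor_add_one ρ
    nlinarith
  have hn0 : (0 : ℝ) < n := by exact_mod_cast Nat.pos_of_ne_zero hn
  have hpow : ((⌊ρ⌋₊ : ℝ)) ^ Nat.log ⌊ρ⌋₊ n ≤ n := by
    exact_mod_cast Nat.pow_log_le_self ⌊ρ⌋₊ hn
  have h1 : (Nat.log ⌊ρ⌋₊ n : ℝ) ≤ Real.logb ρ ((n : ℝ) ^ 2) := by
    rw [Real.le_logb_iff_rpow_le (by linarith) (by positivity), Real.rpow_natCast]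
    calc ρ ^ Nat.log ⌊ρ⌋₊ n ≤ ((⌊ρ⌋₊ : ℝ) ^ 2) ^ Nat.log ⌊ρ⌋₊ n := by gcongr
      _ = ((⌊ρ⌋₊ : ℝ) ^ Nat.log ⌊ρ⌋₊ n) ^ 2 := by rw [← pow_mul, ← pow_mul, mul_comm]
      _ ≤ _ := by gcongr
  rwa [Real.logb_pow, Nat.cast_ofNat] at h1

end Parameters

/-- **Tree shortcutting.** There is an absolute constant `C > 0` such that for every
tree `T` (a connected graph with `n - 1` edges) on a finite vertex set `V` of `n ≥ 2`
vertices, with positive edge weights `w` inducing the tree metric `d_T`, and every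
`ρ ≥ 2`, there is a graph `G` on `V` which is a 1-spanner for `(V, d_T)` with at most
`C·n` edges, maximum degree at most `Δ(T) + 2ρ`, and hop-diameter at most
`C·(log_ρ n + α(ρ))`. -/
theorem tree_shortcutting :
    ∃ C : ℝ, 0 < C ∧
      ∀ (V : Type) [Fintype V], 2 ≤ Fintype.card V →
      ∀ (T : Finset (Sym2 V)) (w : Sym2 V → ℝ),
        IsGraphOn T → IsConnectedOn T → T.card = Fintype.card V - 1 →
        (∀ e ∈ T, 0 < w e) →
        ∀ ρ : ℝ, 2 ≤ ρ →
        ∃ G : Finset (Sym2 V),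
          IsGraphOn G ∧
          (∀ u v : V, ∃ k : ℕ, IsSpannerPathD (treeDist T w) G 1 u v k) ∧
          (G.card : ℝ) ≤ C * Fintype.card V ∧
          (∀ p : V, (degree G p : ℝ) ≤ (maxDegree T : ℝ) + 2 * ρ) ∧
          (∀ u v : V, ∃ k : ℕ,
            (k : ℝ) ≤ C * (Real.logb ρ (Fintype.card V) + invAck ρ) ∧
            IsSpannerPathD (treeDist T w) G 1 u v k) := by
  refine ⟨134, by norm_num, fun V _ hV T w hTG hconn hcard hw ρ hρ => ?_⟩
  classical
  obtain ⟨root⟩ : Nonempty V := Fintype.card_pos_iff.1 (by omega)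
  obtain ⟨_, ht, hT⟩ := exists_treeOrder hconn hcard root
  obtain ⟨hk1, hk⟩ := invAck_spec ρ
  set k := invAck ρ
  set r := ⌊ρ⌋₊
  set n := Fintype.card V
  have hr : 2 ≤ r := Nat.le_floor (by exact_mod_cast hρ)
  have hrρ : (r : ℝ) ≤ ρ := Nat.floor_le (by linarith)
  have hrk : r ≤ ack k k := by exact_mod_cast hrρ.trans hk
  obtain ⟨G, hGdiag, -, hGcard, hGdeg, -, hGpath⟩ := exists_boundedDegree_shortcut ht hT hr
    (h := 2 * k + 3) (e := 131) (fun S hS hSc => hasShortcut_linear ht hS (by omega))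
    (Nat.log r n + 1) Finset.univ ∅ (fun _ _ _ _ x _ => Finset.mem_univ x)
    (Finset.empty_subset _) (by simp) (Nat.lt_pow_succ_log_self (by omega) n)
  have hhop : ∀ u v : V, ∃ l : ℕ, (l : ℝ) ≤ 134 * (Real.logb ρ n + k) ∧
      IsSpannerPathD (treeDist T w) (G ∪ T) 1 u v l := by
    intro u v
    obtain ⟨l, hl, hpath⟩ := (hGpath u (Finset.mem_univ u) v
      (Finset.mem_univ v)).exists_spannerPath ht hT hconn hw
    refine ⟨l, ?_, hpath⟩
    have h1 : (l : ℝ) ≤ 4 * (Nat.log r n + 1) + (2 * k + 3) := by exact_mod_cast hl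
    have h2 := natLog_floor_le hρ (n := n) (by omega)
    have h3 : (1 : ℝ) ≤ k := by exact_mod_cast hk1
    have h4 : 0 ≤ Real.logb ρ n := Real.logb_nonneg (by linarith)
      (by exact_mod_cast (by omega : 1 ≤ n))
    change (Nat.log r n : ℝ) ≤ _ at h2
    linarith
  refine ⟨G ∪ T, ?_, fun u v => (hhop u v).imp fun _ h => h.2, ?_, fun p => ?_, hhop⟩
  · intro e he
    rcases Finset.mem_union.1 he with he | he
    exacts [hGdiag e he, hTG e he]
  · have h1 := Finset.card_union_le G T
    rw [Finset.card_univ] at hGcard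
    have h2 : (G ∪ T).card ≤ 134 * n := by omega
    exact_mod_cast h2
  · have h1 : degree (G ∪ T) p ≤ degree G p + degree T p := by
      unfold degree
      rw [Finset.filter_union]
      exact Finset.card_union_le _ _
    have h2 : degree T p ≤ maxDegree T :=
      Finset.le_sup (f := fun q => degree T q) (Finset.mem_univ p)
    have h3 : degree (G ∪ T) p ≤ maxDegree T + 2 * r := by
      have := hGdeg p
      omega
    have h4 : (degree (G ∪ T) p : ℝ) ≤ maxDegree T + 2 * r := by exact_mod_cast h3
    linarith

end Stmt6
end
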